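/- Let A = 𝕋 × I where 𝕋 = ℝ/ℤ and I ⊆ ℝ is a nontrivial interval, let f be a homeomorphism of A isotopic to the identity (f leaves each end or boundary circle of A invariant and admits a lift f̃ to Ã = ℝ × I commuting with T : (x,y) ↦ (x+1,y)), and fix such a lift f̃. Suppose there exist two ergodic f-invariant compactly supported Borel probability measures μ_1 and μ_2 with rot_{f̃}(μ_1) < rot_{f̃}(μ_2). Then: either for every rational number p/q ∈ (rot_{f̃}(μ_1), rot_{f̃}(μ_2)), written in lowest terms with q ≥ 1, there exists a periodic point z of f of period q whose rotation number for f̃ is p/q; or there exists an essential simple loop λ contained in the interior int(A) such that f(λ) ∩ λ = ∅. -/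

import Mathlib

open Filter Set Topology MeasureTheory

/-- The annulus `A = 𝕋 × I`, where `𝕋 = ℝ/ℤ` and `I ⊆ ℝ` is an interval. -/
abbrev AnnulusT (I : Set ℝ) : Type := AddCircle (1:ℝ) × I

/-- The universal covering space `Ã = ℝ × I` of the annulus `A = 𝕋 × I`. -/
abbrev StripT (I : Set ℝ) : Type := ℝ × I

/-- The covering projection `π : Ã → A`, `(x,y) ↦ (x + ℤ, y)`. -/
noncomputable def projT (I : Set ℝ) : StripT I → AnnulusT I :=
  fun z => ((z.1 : AddCircle (1:ℝ)), z.2)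

open Filter Set Topology MeasureTheory

namespace PB

theorem exp_lift {X : Type*} [TopologicalSpace X] [SimplyConnectedSpace X]
    [LocallyPathConnectedSpace X]
    (h : X → ℂ) (hc : Continuous h) (h0 : ∀ x, h x ≠ 0) :
    ∃ H : X → ℂ, Continuous H ∧ ∀ x, Complex.exp (H x) = h x := by
  obtain ⟨a⟩ : Nonempty X := inferInstance
  obtain ⟨F, ⟨-, hF⟩, -⟩ := Complex.isCoveringMapOn_exp.existsUnique_continuousMap_lifts
    (⟨h, hc⟩ : C(X, ℂ)) (a₀ := a) (e₀ := Complex.log (h a)) (Complex.exp_log (h0 a))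
    (fun x => by simpa using h0 x)
  exact ⟨F, F.continuous, fun x => congrFun hF x⟩

theorem exp_uniq {X : Type*} [TopologicalSpace X] [PreconnectedSpace X] {g₁ g₂ : X → ℂ}
    (h₁ : Continuous g₁) (h₂ : Continuous g₂) (he : ∀ x, Complex.exp (g₁ x) = Complex.exp (g₂ x))
    (a : X) (ha : g₁ a = g₂ a) : ∀ x, g₁ x = g₂ x := by
  have := Complex.isCoveringMap_exp.eq_of_comp_eq h₁ h₂ (funext fun x => Subtype.ext (he x)) a ha
  exact congrFun this

theorem exp_const {X : Type*} [TopologicalSpace X] [PreconnectedSpace X] {g : X → ℂ}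
    (h : Continuous g) (he : ∀ x, Complex.exp (g x) = 1) (a x : X) : g x = g a :=
  exp_uniq h continuous_const (fun y => by rw [he, he]) a rfl x

def Conf : Set (ℂ × ℂ) := {p | p.1 ≠ p.2}

def OP (F : ℂ → ℂ) : Prop :=
  ∃ L : ℂ × ℂ → ℂ, ContinuousOn L Conf ∧
    ∀ p ∈ Conf, Complex.exp (L p) * (p.1 - p.2) = F p.1 - F p.2

theorem isOpen_Conf : IsOpen Conf := isOpen_ne_fun continuous_fst continuous_snd

theorem OP.id : OP id := ⟨fun _ => 0, continuousOn_const, by simp⟩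

theorem OP.comp {F G : ℂ → ℂ} (hG : OP G) (hF : OP F) (hc : Continuous F)
    (hi : Function.Injective F) : OP (G ∘ F) := by
  obtain ⟨L, hL, hL'⟩ := hF
  obtain ⟨M, hM, hM'⟩ := hG
  refine ⟨fun p => M (F p.1, F p.2) + L p, ?_, ?_⟩
  · refine ContinuousOn.add (hM.comp (by fun_prop) ?_) hL
    intro p hp h
    exact hp (hi h)
  · intro p hp
    have := hM' (F p.1, F p.2) (fun h => hp (hi h))
    rw [Complex.exp_add, mul_assoc, hL' p hp, this]; rfl

theorem OP.symm {F : ℂ ≃ₜ ℂ} (hF : OP F) : OP F.symm := by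
  obtain ⟨L, hL, hL'⟩ := hF
  have hm : MapsTo (fun p : ℂ × ℂ => (F.symm p.1, F.symm p.2)) Conf Conf :=
    fun p hp h => hp (F.symm.injective h)
  refine ⟨fun p => - L (F.symm p.1, F.symm p.2), ?_, ?_⟩
  · exact (hL.comp (by fun_prop) hm).neg
  · intro p hp
    have := hL' _ (hm hp)
    simp only [Homeomorph.apply_symm_apply] at this
    rw [← this, Complex.exp_neg, inv_mul_cancel_left₀ (Complex.exp_ne_zero _)]

theorem OP.trans {F G : ℂ ≃ₜ ℂ} (hF : OP F) (hG : OP G) : OP (F.trans G) :=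
  hG.comp hF F.continuous F.injective

noncomputable def confMap (p : ℂ × ℂ) : ℂ × ℂ := (p.1 + Complex.exp p.2, p.1)

theorem confMap_mem (p : ℂ × ℂ) : confMap p ∈ Conf := by
  simp [confMap, Conf]

theorem continuous_confMap : Continuous confMap := by unfold confMap; fun_prop

theorem confMap_surj {p : ℂ × ℂ} (hp : p ∈ Conf) : ∃ s, confMap s = p :=
  ⟨(p.2, Complex.log (p.1 - p.2)), by
    simp [confMap, Complex.exp_log (sub_ne_zero.2 hp)]⟩

theorem conf_const {g : ℂ × ℂ → ℂ} (hg : ContinuousOn g Conf)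
    (he : ∀ p ∈ Conf, Complex.exp (g p) = 1) {p q : ℂ × ℂ} (hp : p ∈ Conf) (hq : q ∈ Conf) :
    g p = g q := by
  obtain ⟨s, rfl⟩ := confMap_surj hp
  obtain ⟨t, rfl⟩ := confMap_surj hq
  exact exp_const (g := g ∘ confMap) (hg.comp_continuous continuous_confMap confMap_mem)
    (fun x => he _ (confMap_mem x)) t s

/-- fixed point free maps have no points of period two -/
theorem no_period_two {F : ℂ → ℂ} (hc : Continuous F) (hF : OP F) (hfpf : ∀ z, F z ≠ z) (a : ℂ) :
    F (F a) ≠ a := by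
  intro haa
  obtain ⟨L, hL, hL'⟩ := hF
  obtain ⟨θ, hθ, hθ'⟩ := exp_lift (fun z => F z - z) (by fun_prop) (fun z => sub_ne_zero.2 (hfpf z))
  have hanti : ∀ p ∈ Conf, L p = L p.swap := by
    intro p hp
    have hs : p.swap ∈ Conf := fun h => hp h.symm
    have key : ∀ p ∈ Conf, Complex.exp (L p - L p.swap) = 1 := by
      intro p hp
      have hs : p.swap ∈ Conf := fun h => hp h.symm
      have h1 := hL' p hp
      have h2 := hL' _ hs
      simp only [Prod.fst_swap, Prod.snd_swap] at h2
      have h3 : p.1 - p.2 ≠ 0 := sub_ne_zero.2 hp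
      rw [Complex.exp_sub, div_eq_one_iff_eq (Complex.exp_ne_zero _)]
      apply mul_right_cancel₀ h3
      linear_combination h1 + h2
    have := conf_const (g := fun p => L p - L p.swap)
      (hL.sub (hL.comp continuous_swap.continuousOn (fun p hp h => hp h.symm))) key hp hs
    simp only [Prod.swap_swap] at this
    linear_combination this / 2
  have hcst := exp_const (g := fun z => L (F z, z) + θ z - θ (F z))
    (by
      have : Continuous fun z => L (F z, z) := hL.comp_continuous (by fun_prop) (fun z => hfpf z)
      exact (this.add hθ).sub (hθ.comp hc)) (fun z => by
      have h := hL' (F z, z) (hfpf z)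
      simp only at h
      rw [← hθ' (F z), ← hθ' z] at h
      rw [Complex.exp_sub, Complex.exp_add, h, div_self (Complex.exp_ne_zero _)]) a (F a)
  simp only [haa] at hcst
  have h1 := hanti (F a, a) (hfpf a)
  simp only [Prod.swap_prod_mk] at h1
  have h2 : θ (F a) = θ a := by linear_combination (hcst + h1) / 2
  have h3 := hθ' (F a)
  rw [h2, hθ' a, haa] at h3
  exact hfpf a (by linear_combination h3 / 2)

end PB

open Filter Set Topology MeasureTheory

namespace PB

theorem bump_lip (a : ℂ) {r : ℝ} (hr : 0 < r) (v : ℂ) (z w : ℂ) :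
    ‖((max 0 (1 - ‖z - a‖ / r) : ℝ) : ℂ) * v - ((max 0 (1 - ‖w - a‖ / r) : ℝ) : ℂ) * v‖
      ≤ ‖v‖ / r * ‖z - w‖ := by
  rw [← sub_mul, norm_mul, ← Complex.ofReal_sub, Complex.norm_real]
  have h1 : ‖max 0 (1 - ‖z - a‖ / r) - max 0 (1 - ‖w - a‖ / r)‖ ≤ ‖z - w‖ / r := by
    rw [Real.norm_eq_abs]
    refine (abs_max_sub_max_le_max _ _ _ _).trans ?_
    have h2 : |‖z - a‖ - ‖w - a‖| ≤ ‖z - w‖ := by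
      have := abs_norm_sub_norm_le (z - a) (w - a)
      simpa using this
    have h3 : (1 - ‖z - a‖ / r) - (1 - ‖w - a‖ / r) = -((‖z - a‖ - ‖w - a‖) / r) := by ring
    rw [h3, abs_neg, abs_div, abs_of_pos hr]
    simp only [sub_self, abs_zero]
    apply max_le (by positivity)
    gcongr
  calc _ ≤ ‖z - w‖ / r * ‖v‖ := by gcongr
    _ = _ := by ring

/-- maps near the identity are orientation preserving homeomorphisms -/
theorem near_id_homeo (g : ℂ → ℂ) (c : ℝ) (hc0 : 0 ≤ c) (hc : c < 1)
    (hg : ∀ z w, ‖g z - g w‖ ≤ c * ‖z - w‖) :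
    ∃ h : ℂ ≃ₜ ℂ, OP h ∧ ∀ z, h z = z + g z := by
  lift c to NNReal using hc0
  have hA : ApproximatesLinearOn (fun z => z + g z)
      ((ContinuousLinearEquiv.refl ℝ ℂ : ℂ ≃L[ℝ] ℂ) : ℂ →L[ℝ] ℂ) univ c := by
    rw [ApproximatesLinearOn.eq_1]
    intro x _ y _
    have := hg x y
    simp only [ContinuousLinearEquiv.coe_coe, ContinuousLinearEquiv.refl_apply]
    have e : x + g x - (y + g y) - (x - y) = g x - g y := by ring
    rw [e]
    exact this
  have hN : c < ‖((ContinuousLinearEquiv.refl ℝ ℂ).symm : ℂ →L[ℝ] ℂ)‖₊⁻¹ := by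
    have : ((ContinuousLinearEquiv.refl ℝ ℂ).symm : ℂ →L[ℝ] ℂ) = ContinuousLinearMap.id ℝ ℂ := rfl
    rw [this, ContinuousLinearMap.nnnorm_id, inv_one]
    exact_mod_cast hc
  have hE : ∀ z, hA.toHomeomorph _ (Or.inr hN) z = z + g z := fun z => rfl
  refine ⟨hA.toHomeomorph _ (Or.inr hN), ?_, hE⟩
  have hgc : Continuous g := by
    refine (LipschitzWith.of_dist_le_mul (K := c) fun x y => ?_).continuous
    rw [dist_eq_norm, dist_eq_norm]; exact hg x y
  have hsl : ∀ p ∈ Conf, 1 + (g p.1 - g p.2) / (p.1 - p.2) ∈ Complex.slitPlane := by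
    intro p hp
    have h3 : p.1 - p.2 ≠ 0 := sub_ne_zero.2 hp
    apply Complex.mem_slitPlane_of_norm_lt_one
    rw [norm_div, div_lt_one (norm_pos_iff.2 h3)]
    refine (hg _ _).trans_lt ?_
    have := norm_pos_iff.2 h3
    nlinarith
  refine ⟨fun p => Complex.log (1 + (g p.1 - g p.2) / (p.1 - p.2)), ?_, ?_⟩
  · refine ContinuousOn.clog ?_ hsl
    refine continuousOn_const.add (ContinuousOn.div (by fun_prop) (by fun_prop) ?_)
    intro p hp
    exact sub_ne_zero.2 hp
  · intro p hp
    have h3 : p.1 - p.2 ≠ 0 := sub_ne_zero.2 hp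
    rw [Complex.exp_log (Complex.slitPlane_ne_zero (hsl p hp)), hE, hE]
    field_simp
    ring

def Push (U : Set ℂ) (a b : ℂ) : Prop :=
  ∃ h : ℂ ≃ₜ ℂ, OP h ∧ h a = b ∧ ∀ z, z ∉ U → h z = z

theorem push_local {U : Set ℂ} {a b : ℂ} {r : ℝ} (hr : 0 < r) (hU : Metric.ball a r ⊆ U)
    (hb : b ∈ Metric.ball a r) : Push U a b := by
  have hv : ‖b - a‖ / r < 1 := by
    rw [div_lt_one hr]; rwa [Metric.mem_ball, dist_eq_norm] at hb
  obtain ⟨h, hop, hh⟩ := near_id_homeo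
    (fun z => ((max 0 (1 - ‖z - a‖ / r) : ℝ) : ℂ) * (b - a)) (‖b - a‖ / r) (by positivity) hv
    (fun z w => bump_lip a hr (b - a) z w)
  refine ⟨h, hop, ?_, ?_⟩
  · rw [hh]; simp
  · intro z hz
    have : r ≤ ‖z - a‖ := by
      by_contra hlt
      exact hz (hU (by rw [Metric.mem_ball, dist_eq_norm]; exact not_le.1 hlt))
    have h1 : 1 - ‖z - a‖ / r ≤ 0 := by
      rw [sub_nonpos, one_le_div hr]; exact this
    rw [hh, max_eq_left h1]; simp

theorem push_conn {U : Set ℂ} (hU : IsOpen U) (hc : IsPreconnected U) {a b : ℂ} (ha : a ∈ U)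
    (hb : b ∈ U) : Push U a b := by
  refine hc.induction₂ (Push U) ?_ ?_ ?_ ha hb
  · intro x hx
    obtain ⟨r, hr, hr'⟩ := Metric.isOpen_iff.1 hU x hx
    filter_upwards [nhdsWithin_le_nhds (Metric.ball_mem_nhds x hr)] with y hy
    exact push_local hr hr' hy
  · rintro x y z - - - ⟨h, hop, h1, h2⟩ ⟨k, kop, k1, k2⟩
    refine ⟨h.trans k, hop.trans kop, by simp [h1, k1], fun w hw => by simp [h2 w hw, k2 w hw]⟩
  · rintro x y - - ⟨h, hop, h1, h2⟩
    refine ⟨h.symm, hop.symm, by rw [← h1]; simp, fun w hw => ?_⟩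
    rw [Homeomorph.symm_apply_eq, h2 w hw]

theorem push_family {ι : Type*} (s : Finset ι) (N : ι → Set ℂ) (a b : ι → ℂ)
    (ho : ∀ i ∈ s, IsOpen (N i)) (hc : ∀ i ∈ s, IsPreconnected (N i))
    (ha : ∀ i ∈ s, a i ∈ N i) (hb : ∀ i ∈ s, b i ∈ N i)
    (hd : ∀ i ∈ s, ∀ j ∈ s, i ≠ j → Disjoint (N i) (N j)) :
    ∃ h : ℂ ≃ₜ ℂ, OP h ∧ (∀ i ∈ s, h (a i) = b i) ∧ (∀ z, (∀ i ∈ s, z ∉ N i) → h z = z) ∧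
      ∀ i ∈ s, ∀ z, z ∈ N i → h z ∈ N i := by
  classical
  induction s using Finset.induction_on with
  | empty => exact ⟨Homeomorph.refl ℂ, OP.id, by simp, by simp, by simp⟩
  | insert i s his ih =>
    obtain ⟨h, hop, h1, h2, h3⟩ := ih (fun i hi => ho i (Finset.mem_insert_of_mem hi))
      (fun i hi => hc i (Finset.mem_insert_of_mem hi))
      (fun i hi => ha i (Finset.mem_insert_of_mem hi))
      (fun i hi => hb i (Finset.mem_insert_of_mem hi))
      (fun i hi j hj => hd i (Finset.mem_insert_of_mem hi) j (Finset.mem_insert_of_mem hj))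
    have hi := Finset.mem_insert_self i s
    obtain ⟨k, kop, k1, k2⟩ := push_conn (ho i hi) (hc i hi) (ha i hi) (hb i hi)
    have hdi : ∀ j ∈ s, ∀ z, z ∈ N j → z ∉ N i := fun j hj z hz hz' =>
      Set.disjoint_left.1 (hd j (Finset.mem_insert_of_mem hj) i hi
        (fun h => his (h ▸ hj))) hz hz'
    refine ⟨h.trans k, hop.trans kop, ?_, ?_, ?_⟩
    · intro j hj
      rcases Finset.mem_insert.1 hj with rfl | hj'
      · simp only [Homeomorph.trans_apply]
        rw [h2 (a j) (fun l hl hz => hdi l hl _ hz (ha j hj)), k1]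
      · simp only [Homeomorph.trans_apply]
        rw [h1 j hj', k2 _ (hdi j hj' _ (hb j hj))]
    · intro z hz
      simp only [Homeomorph.trans_apply]
      rw [h2 z (fun l hl => hz l (Finset.mem_insert_of_mem hl)), k2 z (hz i hi)]
    · intro j hj z hz
      simp only [Homeomorph.trans_apply]
      rcases Finset.mem_insert.1 hj with rfl | hj'
      · rw [h2 z (fun l hl hz' => hdi l hl _ hz' hz)]
        by_contra hcon
        have : k (k z) = k z := k2 _ hcon
        rw [k.injective this] at hcon
        exact hcon hz
      · rw [k2 _ (hdi j hj' _ (h3 j hj' z hz))]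
        exact h3 j hj' z hz

def Free (F : ℂ → ℂ) (K : Set ℂ) : Prop := ∀ z ∈ K, F z ∉ K

theorem Free.mono {F : ℂ → ℂ} {K K' : Set ℂ} (h : Free F K) (hs : K' ⊆ K) : Free F K' :=
  fun z hz hz' => h z (hs hz) (hs hz')

theorem push_free {ι : Type*} {F : ℂ ≃ₜ ℂ} (hF : OP F) (hfpf : ∀ z, F z ≠ z)
    (s : Finset ι) (N : ι → Set ℂ) (a b : ι → ℂ)
    (ho : ∀ i ∈ s, IsOpen (N i)) (hc : ∀ i ∈ s, IsPreconnected (N i))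
    (ha : ∀ i ∈ s, a i ∈ N i) (hb : ∀ i ∈ s, b i ∈ N i)
    (hd : ∀ i ∈ s, ∀ j ∈ s, i ≠ j → Disjoint (N i) (N j))
    (hfree : ∀ i ∈ s, Free F (N i)) :
    ∃ G : ℂ ≃ₜ ℂ, OP G ∧ (∀ z, G z ≠ z) ∧ (∀ i ∈ s, ∀ x, F x = a i → G x = b i) ∧
      (∀ x, (∀ i ∈ s, F x ∉ N i) → G x = F x) := by
  obtain ⟨h, hop, h1, h2, h3⟩ := push_family s N a b ho hc ha hb hd
  refine ⟨F.trans h, hF.trans hop, ?_, ?_, ?_⟩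
  · intro z hz
    simp only [Homeomorph.trans_apply] at hz
    by_cases hcase : ∀ i ∈ s, F z ∉ N i
    · rw [h2 _ hcase] at hz; exact hfpf z hz
    · push Not at hcase
      obtain ⟨i, hi, hzi⟩ := hcase
      have := h3 i hi _ hzi
      rw [hz] at this
      exact hfree i hi z this hzi
  · intro i hi x hx; simp [hx, h1 i hi]
  · intro x hx; simp [h2 _ hx]

theorem exists_conn_nhd {K O : Set ℂ} (hK : IsPreconnected K) (hO : IsOpen O)
    (hKO : K ⊆ O) (hne : K.Nonempty) : ∃ N, IsOpen N ∧ IsPreconnected N ∧ K ⊆ N ∧ N ⊆ O := by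
  obtain ⟨x, hx⟩ := hne
  exact ⟨connectedComponentIn O x, hO.connectedComponentIn, isPreconnected_connectedComponentIn,
    hK.subset_connectedComponentIn hx hKO, connectedComponentIn_subset O x⟩

theorem exists_free_nhd {F : ℂ → ℂ} (hF : Continuous F) {K : Set ℂ} (hK : IsCompact K)
    (hfree : Free F K) : ∃ O, IsOpen O ∧ K ⊆ O ∧ Free F O := by
  have hd : Disjoint K (F '' K) := by
    rw [Set.disjoint_left]
    rintro x hx ⟨y, hy, rfl⟩
    exact hfree y hy hx
  obtain ⟨U, V, hU, hV, hKU, hKV, hUV⟩ := SeparatedNhds.of_isCompact_isCompact hK (hK.image hF) hd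
  refine ⟨U ∩ F ⁻¹' V, hU.inter (hV.preimage hF), fun x hx => ⟨hKU hx, hKV ⟨x, hx, rfl⟩⟩, ?_⟩
  rintro z ⟨-, hz⟩ ⟨hz', -⟩
  exact Set.disjoint_left.1 hUV hz' hz

end PB

open Filter Set Topology MeasureTheory

namespace PB

theorem minball (F : ℂ ≃ₜ ℂ) (hfpf : ∀ z, F z ≠ z) (z : ℂ) :
    ∃ (u : ℂ) (r : ℝ), 0 < r ∧ r ≤ ‖F z - z‖ ∧ ‖u - z‖ = r ∧ ‖F u - z‖ = r ∧
      ∀ a, ‖a - z‖ ≤ r → ‖F a - z‖ ≤ r → ‖a - z‖ = r ∧ ‖F a - z‖ = r := by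
  set m : ℂ → ℝ := fun a => max ‖a - z‖ ‖F a - z‖ with hm
  have hmc : Continuous m := by fun_prop
  have hlim : Tendsto m (cocompact ℂ) atTop := by
    have h1 : Tendsto (fun a : ℂ => ‖a - z‖) (cocompact ℂ) atTop :=
      tendsto_norm_cocompact_atTop.comp (Homeomorph.subRight z).isClosedEmbedding.tendsto_cocompact
    exact tendsto_atTop_mono (fun a => le_max_left _ _) h1
  obtain ⟨u, hu⟩ := hmc.exists_forall_le hlim
  have key : ∀ a, m a ≤ m u → ‖a - z‖ = m u ∧ ‖F a - z‖ = m u := by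
    intro a ha
    have hau : m a = m u := le_antisymm ha (hu a)
    have hpos : 0 < m u := by
      rcases (le_max_of_le_left (norm_nonneg _) : 0 ≤ m u).lt_or_eq with h | h
      · exact h
      · exfalso
        have h1 : ‖u - z‖ ≤ 0 := h ▸ le_max_left _ _
        have h2 : ‖F u - z‖ ≤ 0 := h ▸ le_max_right _ _
        rw [norm_le_zero_iff, sub_eq_zero] at h1 h2
        exact hfpf u (h2.trans h1.symm)
    have hle1 : ‖a - z‖ ≤ m u := hau ▸ le_max_left _ _
    have hle2 : ‖F a - z‖ ≤ m u := hau ▸ le_max_right _ _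
    -- general perturbation argument
    have pert : ∀ c : ℝ → ℂ, Continuous c → c 0 = a →
        ¬ (‖a - z‖ < m u ∧ ∀ t, 0 < t → t < 1 → ‖F (c t) - z‖ < m u) ∧
        ¬ (‖F a - z‖ < m u ∧ ∀ t, 0 < t → t < 1 → ‖c t - z‖ < m u) := by
      intro c hc h0
      constructor
      · rintro ⟨h1, h2⟩
        have : ∀ᶠ t in 𝓝[>] (0:ℝ), ‖c t - z‖ < m u := by
          apply nhdsWithin_le_nhds
          exact (by fun_prop : Continuous fun t => ‖c t - z‖).continuousAt.eventually_lt
            continuousAt_const (by simpa [h0] using h1)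
        obtain ⟨t, ht, ht0, ht1⟩ := (this.and (Ioo_mem_nhdsGT (zero_lt_one' ℝ))).exists
        exact absurd (hu (c t)) (not_le.2 (max_lt ht (h2 t ht0 ht1)))
      · rintro ⟨h1, h2⟩
        have : ∀ᶠ t in 𝓝[>] (0:ℝ), ‖F (c t) - z‖ < m u := by
          apply nhdsWithin_le_nhds
          exact (by fun_prop : Continuous fun t => ‖F (c t) - z‖).continuousAt.eventually_lt
            continuousAt_const (by simpa [h0] using h1)
        obtain ⟨t, ht, ht0, ht1⟩ := (this.and (Ioo_mem_nhdsGT (zero_lt_one' ℝ))).exists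
        exact absurd (hu (c t)) (not_le.2 (max_lt (h2 t ht0 ht1) ht))
    have shrink : ∀ w : ℂ, ‖w - z‖ ≤ m u → ∀ t : ℝ, 0 < t → t < 1 →
        ‖z + (1 - t : ℝ) * (w - z) - z‖ < m u := by
      intro w hw t ht0 ht1
      have : ‖z + (1 - t : ℝ) * (w - z) - z‖ = (1 - t) * ‖w - z‖ := by
        rw [add_sub_cancel_left, norm_mul, Complex.norm_real, Real.norm_of_nonneg (by linarith)]
      rw [this]
      nlinarith [norm_nonneg (w - z)]
    constructor
    · by_contra hne
      have hlt := lt_of_le_of_ne hle1 hne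
      refine (pert (fun t => F.symm (z + (1 - t : ℝ) * (F a - z))) (by fun_prop) (by simp)).1
        ⟨hlt, fun t h0 h1 => ?_⟩
      rw [F.apply_symm_apply]
      exact shrink _ hle2 t h0 h1
    · by_contra hne
      have hlt := lt_of_le_of_ne hle2 hne
      exact (pert (fun t => (z + (1 - t : ℝ) * (a - z))) (by fun_prop) (by simp)).2
        ⟨hlt, fun t h0 h1 => shrink _ hle1 t h0 h1⟩
  have hposu := key u le_rfl
  refine ⟨u, m u, ?_, ?_, hposu.1, hposu.2, fun a h1 h2 => key a (max_le h1 h2)⟩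
  · rcases (le_max_of_le_left (norm_nonneg _) : 0 ≤ m u).lt_or_eq with h | h
    · exact h
    · exfalso
      have h1 : ‖u - z‖ ≤ 0 := h ▸ le_max_left _ _
      have h2 : ‖F u - z‖ ≤ 0 := h ▸ le_max_right _ _
      rw [norm_le_zero_iff, sub_eq_zero] at h1 h2
      exact hfpf u (h2.trans h1.symm)
  · have := hu z
    have hz : m z = ‖F z - z‖ := by simp [hm]
    rwa [hz] at this

theorem seg_norm_le {z v x : ℂ} (hx : x ∈ segment ℝ z v) : ‖x - z‖ ≤ ‖v - z‖ := by
  have := norm_sub_le_of_mem_segment hx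
  exact this

theorem seg_norm_eq {z v x : ℂ} (hx : x ∈ segment ℝ z v) (h : ‖x - z‖ = ‖v - z‖) : x = v := by
  rw [segment_eq_image'] at hx
  obtain ⟨t, ⟨h0, h1⟩, rfl⟩ := hx
  simp only [add_sub_cancel_left, norm_smul, Real.norm_of_nonneg h0] at h
  by_cases hv : ‖v - z‖ = 0
  · rw [norm_eq_zero] at hv
    rw [hv]; simpa using (sub_eq_zero.1 hv).symm
  · have : t = 1 := by
      have := mul_right_cancel₀ hv (h.trans (one_mul _).symm)
      exact this
    subst this; simp

theorem seg_key {F : ℂ ≃ₜ ℂ} (hF : OP F) (hfpf : ∀ z, F z ≠ z) {z u : ℂ} {r : ℝ}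
    (hu : ‖u - z‖ = r) (hv : ‖F u - z‖ = r)
    (hmin : ∀ a, ‖a - z‖ ≤ r → ‖F a - z‖ ≤ r → ‖a - z‖ = r ∧ ‖F a - z‖ = r) {a : ℂ}
    (ha : a ∈ segment ℝ z u ∪ segment ℝ z (F u)) (hFa : F a ∈ segment ℝ z u ∪ segment ℝ z (F u)) :
    a = u := by
  have hle : ∀ b, b ∈ segment ℝ z u ∪ segment ℝ z (F u) → ‖b - z‖ ≤ r := by
    rintro b (hb | hb)
    · exact hu ▸ seg_norm_le hb
    · exact hv ▸ seg_norm_le hb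
  obtain ⟨h1, h2⟩ := hmin a (hle a ha) (hle _ hFa)
  have heq : ∀ b, b ∈ segment ℝ z u ∪ segment ℝ z (F u) → ‖b - z‖ = r → b = u ∨ b = F u := by
    rintro b (hb | hb) h
    · exact Or.inl (seg_norm_eq hb (h.trans hu.symm))
    · exact Or.inr (seg_norm_eq hb (h.trans hv.symm))
  rcases heq a ha h1 with h | h
  · exact h
  · exfalso
    rcases heq _ hFa h2 with h' | h'
    · rw [h] at h'
      exact no_period_two F.continuous hF hfpf u h'
    · exact hfpf a (h'.trans h.symm)

theorem isCompact_seg (z w : ℂ) : IsCompact (segment ℝ z w) := by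
  rw [segment_eq_image']
  exact isCompact_Icc.image (by fun_prop)

theorem isPreconnected_seg (z w : ℂ) : IsPreconnected (segment ℝ z w) :=
  (convex_segment z w).isPreconnected

/-- first return inside a free connected compact set -/
theorem no_return {n : ℕ}
    (IH : ∀ m < n, 1 ≤ m → ∀ F : ℂ ≃ₜ ℂ, OP F → (∀ z, F z ≠ z) → ∀ x, F^[m] x ≠ x)
    {F : ℂ ≃ₜ ℂ} (hF : OP F) (hfpf : ∀ z, F z ≠ z) {K : Set ℂ} (hK : IsCompact K)
    (hKc : IsPreconnected K) (hfree : Free F K) {y : ℂ} (hy : y ∈ K) :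
    ∀ j, 1 ≤ j → j < n → F^[j] y ∉ K := by
  intro j
  induction j using Nat.strong_induction_on with
  | _ j ih =>
    intro hj hjn hjK
    set C : Set ℂ := (fun i => F^[i] y) '' {i | 1 ≤ i ∧ i < j} with hC
    have hCf : C.Finite := by
      apply Set.Finite.image
      exact (Set.finite_lt_nat j).subset fun i hi => hi.2
    have hCK : ∀ x ∈ K, x ∉ C := by
      rintro x hx ⟨i, ⟨h1, h2⟩, rfl⟩
      exact ih i h2 h1 (h2.trans hjn) hx
    obtain ⟨O, hO, hKO, hOf⟩ := exists_free_nhd F.continuous hK hfree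
    obtain ⟨N, hN, hNc, hKN, hNO⟩ := exists_conn_nhd hKc (hO.sdiff hCf.isClosed)
      (fun x hx => ⟨hKO hx, hCK x hx⟩) ⟨y, hy⟩
    obtain ⟨G, hG, hGf, hG1, hG2⟩ := push_free hF hfpf ({()} : Finset Unit) (fun _ => N)
      (fun _ => F^[j] y) (fun _ => y) (fun _ _ => hN) (fun _ _ => hNc) (fun _ _ => hKN hjK)
      (fun _ _ => hKN hy) (by simp) (fun _ _ => hOf.mono fun x hx => (hNO hx).1)
    have hit : ∀ i, i < j → G^[i] y = F^[i] y := by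
      intro i
      induction i with
      | zero => intro _; rfl
      | succ i ihi =>
        intro hi
        rw [Function.iterate_succ_apply', Function.iterate_succ_apply', ihi (by omega)]
        apply hG2
        intro _ _ hmem
        apply (hNO hmem).2
        exact ⟨i + 1, ⟨by omega, hi⟩, Function.iterate_succ_apply' _ _ _⟩
    obtain ⟨k, rfl⟩ : ∃ k, j = k + 1 := ⟨j - 1, by omega⟩
    refine IH (k + 1) hjn hj G hG hGf y ?_
    rw [Function.iterate_succ_apply', hit k (by omega)]
    exact hG1 () (by simp) _ (Function.iterate_succ_apply' _ _ _).symm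

theorem brouwer (n : ℕ) : 1 ≤ n → ∀ F : ℂ ≃ₜ ℂ, OP F → (∀ z, F z ≠ z) → ∀ x, F^[n] x ≠ x := by
  induction n using Nat.strong_induction_on with
  | _ n IH =>
  intro hn F hF hfpf x hx
  obtain rfl | rfl | hn3 : n = 1 ∨ n = 2 ∨ 3 ≤ n := by omega
  · exact hfpf x hx
  · exact no_period_two F.continuous hF hfpf x hx
  obtain ⟨u, r, hr, -, hu, hv, hmin⟩ := minball F hfpf x
  have key := fun a => seg_key (a := a) hF hfpf hu hv hmin
  have huv : F u ≠ u := hfpf u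
  have hun : u ∉ segment ℝ x (F u) := fun h => huv (seg_norm_eq h (hu.trans hv.symm)).symm
  have hvn : F u ∉ segment ℝ x u := fun h => huv (seg_norm_eq h (hv.trans hu.symm))
  have hS1 : Free F (segment ℝ x (F u)) := by
    intro a ha hFa
    have := key a (Or.inr ha) (Or.inr hFa)
    exact hun (this ▸ ha)
  have hS0 : Free F (segment ℝ x u) := by
    intro a ha hFa
    have := key a (Or.inl ha) (Or.inl hFa)
    exact hvn (this ▸ hFa)
  set S1 := segment ℝ x (F u) with hS1d
  set S2 := (fun a => F (F a)) '' segment ℝ x u with hS2d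
  have hS2 : Free F S2 := by
    rintro _ ⟨a, ha, rfl⟩ ⟨b, hb, hab⟩
    have : b = F a := F.injective (F.injective hab)
    exact hS0 a ha (this ▸ hb)
  have hS2k : IsCompact S2 := (isCompact_seg _ _).image (by fun_prop)
  have hS2c : IsPreconnected S2 := (isPreconnected_seg _ _).image _ (by fun_prop)
  have hdisj : Disjoint S1 S2 := by
    rw [Set.disjoint_left]
    rintro _ hb ⟨a, ha, rfl⟩
    simp only at hb
    by_cases hau : a = u
    · subst hau
      exact huv (key (F a) (Or.inr (right_mem_segment ℝ _ _)) (Or.inr hb))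
    · set K := segment ℝ x a ∪ segment ℝ x (F (F a)) with hK
      have hs1 : segment ℝ x a ⊆ segment ℝ x u :=
        (convex_segment x u).segment_subset (left_mem_segment ℝ _ _) ha
      have hs2 : segment ℝ x (F (F a)) ⊆ segment ℝ x (F u) :=
        (convex_segment x (F u)).segment_subset (left_mem_segment ℝ _ _) hb
      have hKs : K ⊆ segment ℝ x u ∪ segment ℝ x (F u) := union_subset_union hs1 hs2
      have hKf : Free F K := by
        intro c hc hFc
        have hcu := key c (hKs hc) (hKs hFc)
        subst hcu
        rcases hc with hc | hc
        · apply hau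
          have h1 := seg_norm_le hc
          have h2 := seg_norm_le ha
          exact seg_norm_eq ha (le_antisymm h2 h1)
        · exact hun (hs2 hc)
      exact no_return IH hF hfpf ((isCompact_seg _ _).union (isCompact_seg _ _))
        (IsPreconnected.union x (left_mem_segment ℝ _ _) (left_mem_segment ℝ _ _)
          (isPreconnected_seg _ _) (isPreconnected_seg _ _)) hKf
        (Or.inl (right_mem_segment ℝ _ _)) 2 (by omega) (by omega)
        (Or.inr (right_mem_segment ℝ _ _))
  have hC1 : ∀ j, 3 ≤ j → j < n → F^[j] x ∉ S1 := fun j h1 h2 =>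
    no_return IH hF hfpf (isCompact_seg _ _) (isPreconnected_seg _ _) hS1
      (left_mem_segment ℝ _ _) j (by omega) h2
  have hx2 : F (F x) ∈ S2 := ⟨x, left_mem_segment ℝ _ _, rfl⟩
  have hC2 : ∀ j, 3 ≤ j → j < n → F^[j] x ∉ S2 := fun j h1 h2 => by
    have := no_return IH hF hfpf hS2k hS2c hS2 hx2 (j - 2) (by omega) (by omega)
    have e : F^[j] x = F^[j - 2] (F (F x)) := by
      conv_lhs => rw [show j = (j - 2) + 2 by omega, Function.iterate_add_apply]
      rfl
    rwa [e]
  set C : Set ℂ := (fun i => F^[i] x) '' {i | 3 ≤ i ∧ i < n} with hC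
  have hCf : C.Finite := by
    apply Set.Finite.image
    exact (Set.finite_lt_nat n).subset fun i hi => hi.2
  obtain ⟨U1, U2, hU1, hU2, hSU1, hSU2, hUd⟩ :=
    SeparatedNhds.of_isCompact_isCompact (isCompact_seg _ _) hS2k hdisj
  obtain ⟨O1, hO1, hSO1, hO1f⟩ := exists_free_nhd F.continuous (isCompact_seg _ _) hS1
  obtain ⟨O2, hO2, hSO2, hO2f⟩ := exists_free_nhd F.continuous hS2k hS2
  obtain ⟨N1, hN1, hN1c, hSN1, hN1O⟩ := exists_conn_nhd (isPreconnected_seg _ _)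
    ((hU1.inter hO1).sdiff hCf.isClosed) (K := S1)
    (fun y hy => ⟨⟨hSU1 hy, hSO1 hy⟩, by
      rintro ⟨i, ⟨h1, h2⟩, rfl⟩
      exact hC1 i h1 h2 hy⟩) ⟨x, left_mem_segment ℝ _ _⟩
  obtain ⟨N2, hN2, hN2c, hSN2, hN2O⟩ := exists_conn_nhd hS2c
    ((hU2.inter hO2).sdiff hCf.isClosed)
    (fun y hy => ⟨⟨hSU2 hy, hSO2 hy⟩, by
      rintro ⟨i, ⟨h1, h2⟩, rfl⟩
      exact hC2 i h1 h2 hy⟩) ⟨_, hx2⟩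
  have hNd : Disjoint N1 N2 := hUd.mono (fun y hy => (hN1O hy).1.1) (fun y hy => (hN2O hy).1.1)
  obtain ⟨G, hG, hGf, hG1, hG2⟩ := push_free hF hfpf (Finset.univ : Finset Bool)
    (fun i => if i then N1 else N2) (fun i => if i then x else F (F u))
    (fun i => if i then F u else F (F x))
    (by rintro (_ | _) _ <;> simp [hN1, hN2]) (by rintro (_ | _) _ <;> simp [hN1c, hN2c])
    (by
      rintro (_ | _) _
      · simpa using hSN2 ⟨u, right_mem_segment ℝ _ _, rfl⟩
      · simpa using hSN1 (left_mem_segment ℝ _ _))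
    (by
      rintro (_ | _) _
      · simpa using hSN2 hx2
      · simpa using hSN1 (right_mem_segment ℝ _ _))
    (by rintro (_ | _) _ (_ | _) _ <;> simp [hNd, hNd.symm])
    (by
      rintro (_ | _) _
      · simpa using hO2f.mono fun y hy => (hN2O hy).1.2
      · simpa using hO1f.mono fun y hy => (hN1O hy).1.2)
  have hG0 : G (F u) = F (F x) := hG1 false (by simp) _ rfl
  have hit : ∀ i, i + 2 < n → G^[i + 1] (F u) = F^[i + 2] x := by
    intro i
    induction i with
    | zero => intro _; exact hG0
    | succ i ihi =>
      intro hi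
      rw [Function.iterate_succ_apply', ihi (by omega)]
      have e : F (F^[i + 2] x) = F^[i + 1 + 2] x :=
        (Function.iterate_succ_apply' F (i + 2) x).symm
      rw [← e]
      apply hG2
      have hmem : F (F^[i + 2] x) ∈ C := ⟨i + 1 + 2, ⟨by omega, hi⟩, e.symm⟩
      rintro (_ | _) _
      · simpa using fun h => (hN2O h).2 hmem
      · simpa using fun h => (hN1O h).2 hmem
  refine IH (n - 1) (by omega) (by omega) G hG hGf (F u) ?_
  obtain ⟨k, rfl⟩ : ∃ k, n = k + 3 := ⟨n - 3, by omega⟩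
  rw [show k + 3 - 1 = (k + 1) + 1 by omega, Function.iterate_succ_apply', hit k (by omega)]
  refine hG1 true (by simp) _ ?_
  rw [← Function.iterate_succ_apply' F]
  simpa using hx

end PB

open Filter Set Topology MeasureTheory

namespace PB

theorem transGen_chain {ι : Type*} {r : ι → ι → Prop} {a b : ι} (h : Relation.TransGen r a b) :
    ∃ n, 1 ≤ n ∧ ∃ s : ℕ → ι, s 0 = a ∧ s n = b ∧ ∀ k < n, r (s k) (s (k + 1)) := by
  induction h with
  | single h =>
    rename_i b
    refine ⟨1, le_rfl, fun k => if k = 0 then a else b, by simp, by simp, ?_⟩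
    intro k hk
    obtain rfl : k = 0 := by omega
    simpa using h
  | tail h hr ih =>
    rename_i b c
    obtain ⟨n, hn, s, h0, hb, hs⟩ := ih
    refine ⟨n + 1, by omega, fun k => if k ≤ n then s k else c, by simp [h0], by simp, ?_⟩
    intro k hk
    rcases Nat.lt_or_ge k n with h1 | h1
    · have h2 : k + 1 ≤ n := h1
      simp only [h1.le, h2, if_true]
      exact hs k h1
    · obtain rfl : k = n := by omega
      simpa [hb] using hr

theorem ball_sub_eventually {O : Set ℂ} (hO : IsOpen O) {p : ℂ} (hp : p ∈ O) :
    ∀ᶠ ε in 𝓝[>] (0:ℝ), Metric.ball p ε ⊆ O := by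
  obtain ⟨r, hr, h⟩ := Metric.isOpen_iff.1 hO p hp
  filter_upwards [Ioo_mem_nhdsGT hr] with ε hε
  exact (Metric.ball_subset_ball hε.2.le).trans h

def BRel {ι : Type*} (F : ℂ → ℂ) (B : ι → Set ℂ) (i j : ι) : Prop := ∃ x ∈ B i, F x ∈ B j

/-- Franks lemma: no closed chains of free bricks -/
theorem franks {ι : Type*} {F : ℂ ≃ₜ ℂ} (hF : OP F) (hfpf : ∀ z, F z ≠ z) (B : ι → Set ℂ)
    (hk : ∀ i, IsCompact (B i)) (hcl : ∀ i, B i ⊆ closure (interior (B i)))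
    (hintg : ∀ i, IsPreconnected (interior (B i)))
    (hdis : ∀ i j, B i = B j ∨ Disjoint (interior (B i)) (interior (B j)))
    (hfree : ∀ i, Free F (B i)) (i₀ : ι) : ¬ Relation.TransGen (BRel F B) i₀ i₀ := by
  classical
  intro hT
  let P : ℕ → Prop := fun n => 1 ≤ n ∧ ∃ s : ℕ → ι, (∀ k < n, BRel F B (s k) (s (k + 1))) ∧
    B (s n) = B (s 0)
  have hP : ∃ n, P n := by
    obtain ⟨n, hn, s, h0, hb, hs⟩ := transGen_chain hT
    exact ⟨n, hn, s, hs, by rw [h0, hb]⟩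
  obtain ⟨n, hPn, hmin⟩ : ∃ n, P n ∧ ∀ m, P m → n ≤ m :=
    ⟨Nat.find hP, Nat.find_spec hP, fun m hm => Nat.find_min' hP hm⟩
  obtain ⟨hn, s, hs, hsn⟩ := hPn
  choose! y hyB hFy using hs
  have c1 : ∀ i j, i < j → j ≤ n → j - i < n → B (s i) ≠ B (s j) := by
    intro i j hij hjn hlt heq
    have := hmin (j - i) ⟨by omega, fun k => s (i + k), fun k hk => ?_, ?_⟩
    · omega
    · exact ⟨y (i + k), hyB _ (by omega), hFy (i + k) (by omega)⟩
    · simp only [add_zero]; rw [show i + (j - i) = j by omega, heq]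
  have c2 : ∀ k < n, ∀ j, 1 ≤ j → j ≤ n → j ≠ k + 1 → F (y k) ∉ B (s j) := by
    intro k hk j hj1 hjn hne hmem
    rcases Nat.lt_or_ge (k + 1) j with hlt | hge
    · have := hmin (n - (j - k - 1)) ⟨by omega,
        fun i => if i ≤ k then s i else s (i + (j - k - 1)), fun i hi => ?_, ?_⟩
      · omega
      · dsimp only
        rcases Nat.lt_trichotomy i k with h | h | h
        · rw [if_pos h.le, if_pos (by omega)]
          exact ⟨y i, hyB _ (by omega), hFy _ (by omega)⟩
        · subst h
          rw [if_pos le_rfl, if_neg (by omega)]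
          refine ⟨y i, hyB _ (by omega), ?_⟩
          rwa [show i + 1 + (j - i - 1) = j by omega]
        · rw [if_neg (by omega), if_neg (by omega)]
          refine ⟨y (i + (j - k - 1)), hyB _ (by omega), ?_⟩
          rw [show i + 1 + (j - k - 1) = i + (j - k - 1) + 1 by omega]
          exact hFy _ (by omega)
      · simp only
        rw [if_neg (by omega), if_pos (by omega), show n - (j - k - 1) + (j - k - 1) = n by omega,
          hsn]
    · have := hmin (k - j + 1) ⟨by omega,
        fun i => if i ≤ k - j then s (j + i) else s j, fun i hi => ?_, ?_⟩
      · omega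
      · dsimp only
        rcases Nat.lt_or_ge i (k - j) with h | h
        · rw [if_pos h.le, if_pos (by omega)]
          exact ⟨y (j + i), hyB _ (by omega), hFy (j + i) (by omega)⟩
        · obtain rfl : i = k - j := by omega
          rw [if_pos le_rfl, if_neg (by omega)]
          refine ⟨y (j + (k - j)), hyB _ (by omega), ?_⟩
          rwa [show j + (k - j) = k by omega]
      · simp
  have hOex : ∀ i, ∃ O, IsOpen O ∧ B i ⊆ O ∧ Free F O := fun i =>
    exists_free_nhd F.continuous (hk i) (hfree i)
  choose O hO hBO hOf using hOex
  have hε : ∀ᶠ ε in 𝓝[>] (0:ℝ), (∀ i ∈ Finset.range n, Metric.ball (F (y i)) ε ⊆ O (s (i + 1))) ∧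
      (∀ i ∈ Finset.range n, ∀ j ∈ Finset.range n, i ≠ j →
        Metric.ball (F (y i)) ε ⊆ (B (s (j + 1)))ᶜ) ∧
      (∀ i ∈ Finset.range n, ∀ j ∈ Finset.range n, i ≠ j →
        Disjoint (Metric.ball (F (y i)) ε) (Metric.ball (F (y j)) ε)) := by
    refine Filter.Eventually.and ?_ (Filter.Eventually.and ?_ ?_)
    · rw [Filter.eventually_all_finset]
      intro i hi
      rw [Finset.mem_range] at hi
      exact ball_sub_eventually (hO _) (hBO _ (hFy i hi))
    · rw [Filter.eventually_all_finset]
      intro i hi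
      rw [Filter.eventually_all_finset]
      intro j hj
      rw [Finset.mem_range] at hi hj
      rw [Filter.eventually_imp_distrib_left]
      intro hij
      exact ball_sub_eventually (hk _).isClosed.isOpen_compl
        (c2 i hi (j + 1) (by omega) (by omega) (by omega))
    · rw [Filter.eventually_all_finset]
      intro i hi
      rw [Filter.eventually_all_finset]
      intro j hj
      rw [Finset.mem_range] at hi hj
      rw [Filter.eventually_imp_distrib_left]
      intro hij
      have hne : F (y i) ≠ F (y j) := by
        intro h
        exact c2 i hi (j + 1) (by omega) (by omega) (by omega) (h ▸ hFy j hj)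
      have hpos : 0 < dist (F (y i)) (F (y j)) / 2 := half_pos (dist_pos.2 hne)
      filter_upwards [Ioo_mem_nhdsGT hpos] with ε hε
      exact Metric.ball_disjoint_ball (by linarith [hε.2])
  obtain ⟨ε, ⟨e1, e2, e3⟩, hε0⟩ := (hε.and self_mem_nhdsWithin).exists
  have hε0 : 0 < ε := hε0
  have hy' : ∀ i, i < n → ∃ w ∈ interior (B (s i)), F w ∈ Metric.ball (F (y i)) ε := by
    intro i hi
    have h1 : y i ∈ closure (interior (B (s i))) := hcl _ (hyB i hi)
    obtain ⟨w, hw1, hw2⟩ := mem_closure_iff.1 h1 (F ⁻¹' Metric.ball (F (y i)) ε)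
      (Metric.isOpen_ball.preimage F.continuous) (Metric.mem_ball_self hε0)
    exact ⟨w, hw2, hw1⟩
  choose! y' hy'1 hy'2 using hy'
  set Y : ℕ → ℂ := fun i => if i = n then y' 0 else y' i with hY
  have hY1 : ∀ i < n, Y (i + 1) ∈ interior (B (s (i + 1))) := by
    intro i hi
    by_cases h : i + 1 = n
    · simp only [hY, h, if_true]
      rw [hsn]
      exact hy'1 0 (by omega)
    · simp only [hY, h, if_false]
      exact hy'1 _ (by omega)
  obtain ⟨G, hG, hGf, hG1, -⟩ := push_free hF hfpf (Finset.range n)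
    (fun i => interior (B (s (i + 1))) ∪ Metric.ball (F (y i)) ε)
    (fun i => F (y' i)) (fun i => Y (i + 1))
    (fun i _ => isOpen_interior.union Metric.isOpen_ball)
    (fun i hi => by
      rw [Finset.mem_range] at hi
      obtain ⟨w, hw1, hw2⟩ := mem_closure_iff.1 (hcl _ (hFy i hi)) _ Metric.isOpen_ball
        (Metric.mem_ball_self hε0)
      exact IsPreconnected.union w hw2 hw1 (hintg _) (convex_ball _ _).isPreconnected)
    (fun i hi => Or.inr (hy'2 i (Finset.mem_range.1 hi)))
    (fun i hi => Or.inl (hY1 i (Finset.mem_range.1 hi)))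
    (fun i hi j hj hij => by
      have hi' := Finset.mem_range.1 hi
      have hj' := Finset.mem_range.1 hj
      rw [Set.disjoint_left]
      rintro x (hx | hx) (hx' | hx')
      · rcases hdis (s (i + 1)) (s (j + 1)) with h | h
        · rcases Nat.lt_or_gt_of_ne hij with h' | h'
          · exact c1 (i + 1) (j + 1) (by omega) (by omega) (by omega) h
          · exact c1 (j + 1) (i + 1) (by omega) (by omega) (by omega) h.symm
        · exact Set.disjoint_left.1 h hx hx'
      · exact e2 j hj i hi hij.symm hx' (interior_subset hx)
      · exact e2 i hi j hj hij hx (interior_subset hx')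
      · exact Set.disjoint_left.1 (e3 i hi j hj hij) hx hx')
    (fun i hi => (hOf _).mono (union_subset (interior_subset.trans (hBO _)) (e1 i hi)))
  have hit : ∀ i ≤ n, G^[i] (Y 0) = Y i := by
    intro i
    induction i with
    | zero => intro _; rfl
    | succ i ih =>
      intro hi
      rw [Function.iterate_succ_apply', ih (by omega)]
      refine hG1 i (Finset.mem_range.2 hi) _ ?_
      simp only [hY]
      rw [if_neg (by omega)]
  refine brouwer n hn G hG hGf (Y 0) ?_
  rw [hit n le_rfl]
  simp only [hY, if_true]
  rw [if_neg (by omega)]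

end PB

open Filter Set Topology MeasureTheory

namespace PB

theorem log_neg_of_im_pos {z : ℂ} (h : 0 < z.im) :
    Complex.log (-z) = Complex.log z - Real.pi * Complex.I := by
  apply Complex.ext
  · simp [Complex.log_re]
  · simp [Complex.log_im, Complex.arg_neg_eq_arg_sub_pi_of_im_pos h]

theorem log_neg_of_im_neg {z : ℂ} (h : z.im < 0) :
    Complex.log (-z) = Complex.log z + Real.pi * Complex.I := by
  apply Complex.ext
  · simp [Complex.log_re]
  · simp [Complex.log_im, Complex.arg_neg_eq_arg_add_pi_of_im_neg h]

/-- Crossing paths must meet. -/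
theorem crossing {γ δ : ℝ → ℂ} (hγ : Continuous γ) (hδ : Continuous δ)
    (h1 : ∀ t, (γ 0 - δ t).re < 0) (h2 : ∀ t, 0 < (γ 1 - δ t).re)
    (h3 : ∀ s, 0 < (γ s - δ 0).im) (h4 : ∀ s, (γ s - δ 1).im < 0) :
    ∃ s t, γ s = δ t := by
  by_contra hno
  push Not at hno
  obtain ⟨H, hH, hH'⟩ := exp_lift (fun p : ℝ × ℝ => γ p.1 - δ p.2) (by fun_prop)
    (fun p => sub_ne_zero.2 (hno p.1 p.2))
  have gen : ∀ (c : ℝ → ℝ × ℝ) (hc : Continuous c) (σ : ℂ),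
      (∀ t, σ * (γ (c t).1 - δ (c t).2) ∈ Complex.slitPlane) →
      H (c 1) - Complex.log (σ * (γ (c 1).1 - δ (c 1).2)) =
        H (c 0) - Complex.log (σ * (γ (c 0).1 - δ (c 0).2)) := by
    intro c hc σ hσ
    have hσ0 : σ ≠ 0 := by
      rintro rfl
      have := hσ 0
      simp at this
    have hcl : Continuous fun t => Complex.log (σ * (γ (c t).1 - δ (c t).2)) :=
      Continuous.clog (by fun_prop) hσ
    have := exp_const (g := fun t => H (c t) - Complex.log (σ * (γ (c t).1 - δ (c t).2))
        + Complex.log σ)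
      (((hH.comp hc).sub hcl).add continuous_const) (fun t => by
        rw [Complex.exp_add, Complex.exp_sub, hH',
          Complex.exp_log (Complex.slitPlane_ne_zero (hσ t)), Complex.exp_log hσ0]
        have : γ (c t).1 - δ (c t).2 ≠ 0 := sub_ne_zero.2 (hno _ _)
        field_simp) 0 1
    simpa using this
  have e1 := gen (fun t => (1, t)) (by fun_prop) 1 (fun t => by
    rw [one_mul]; exact Or.inl (h2 t))
  have e2 := gen (fun t => (t, 0)) (by fun_prop) 1 (fun t => by
    rw [one_mul]; exact Or.inr (h3 t).ne')
  have e3 := gen (fun t => (t, 1)) (by fun_prop) 1 (fun t => by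
    rw [one_mul]; exact Or.inr (h4 t).ne)
  have e4 := gen (fun t => (0, t)) (by fun_prop) (-1) (fun t => by
    left
    have := h1 t
    rw [neg_one_mul, Complex.neg_re]; linarith)
  simp only [one_mul, neg_one_mul] at e1 e2 e3 e4
  rw [log_neg_of_im_pos (h3 0), log_neg_of_im_neg (h4 0)] at e4
  have : (Real.pi : ℂ) * Complex.I = 0 := by
    linear_combination (e1 + e2 - e3 - e4) / 2
  simp [Real.pi_ne_zero] at this

theorem joined_translate {E : Set ℂ} {x y : ℂ} (h : JoinedIn E x y) {E' : Set ℂ} {c : ℂ}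
    (hE : ∀ z ∈ E, z + c ∈ E') : JoinedIn E' (x + c) (y + c) := by
  obtain ⟨p, hp⟩ := h
  exact ⟨p.map (f := fun z => z + c) (by fun_prop), fun t => by simpa using hE _ (hp t)⟩

/-- A periodic path connected set is a barrier. -/
theorem barrier {N : ℝ} (hN : 0 < N) {E : Set ℂ} (hne : E.Nonempty)
    (hper : ∀ z : ℂ, z + N ∈ E ↔ z ∈ E) (hpc : ∀ x ∈ E, ∀ y ∈ E, JoinedIn E x y) :
    ∃ M₀ : ℝ, 0 < M₀ ∧ ∀ M ≥ M₀, ∀ (C : Set ℂ) (x y : ℂ), JoinedIn C x y → x.im ≤ -M → M ≤ y.im →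
      (C ∩ E).Nonempty := by
  obtain ⟨e, he⟩ := hne
  have hperz : ∀ (k : ℤ) (z : ℂ), z + k * N ∈ E ↔ z ∈ E := by
    intro k
    induction k using Int.induction_on with
    | zero => intro z; simp
    | succ i ih =>
      intro z
      rw [← ih z, ← hper (z + ((i:ℤ):ℂ) * N)]; push_cast; ring_nf
    | pred i ih =>
      intro z
      rw [← ih z, ← hper (z + ((-(i:ℤ) - 1 : ℤ) : ℂ) * N)]; push_cast; ring_nf
  obtain ⟨p, hp⟩ := hpc e he (e + N) ((hper e).2 he)
  have hcomp : IsCompact (range p) := isCompact_range p.continuous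
  obtain ⟨M₁, hM₁⟩ := (hcomp.image Complex.continuous_im).isBounded.exists_norm_le
  set Γ : Set ℂ := {z | ∃ k : ℤ, z + k * N ∈ range p} with hΓ
  have hΓE : Γ ⊆ E := by
    rintro z ⟨k, t, ht⟩
    rw [← hperz k, ← ht]; exact hp t
  have hΓim : ∀ z ∈ Γ, |z.im| ≤ M₁ := by
    rintro z ⟨k, t, ht⟩
    have h1 := hM₁ _ ⟨_, ⟨t, rfl⟩, rfl⟩
    rw [ht] at h1
    simpa using h1
  have hΓτ : ∀ (k : ℤ) z, z ∈ Γ → z + k * N ∈ Γ := by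
    rintro k z ⟨j, hj⟩
    exact ⟨j - k, by push_cast; convert hj using 1; ring⟩
  have hstep : JoinedIn Γ e (e + N) := ⟨p, fun t => ⟨0, by simp⟩⟩
  have hnat : ∀ k : ℕ, JoinedIn Γ e (e + k * N) := by
    intro k
    induction k with
    | zero => simpa using JoinedIn.refl hstep.source_mem
    | succ k ih =>
      refine ih.trans ?_
      have := joined_translate hstep (hΓτ k)
      convert this using 1 <;> push_cast <;> ring
  refine ⟨max M₁ 0 + 1, by positivity, ?_⟩
  rintro M hM C x y ⟨q, hq⟩ hx hy
  have hM' : M₁ < M := lt_of_lt_of_le (lt_of_le_of_lt (le_max_left _ _) (lt_add_one _)) hM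
  obtain ⟨R, hR⟩ := ((isCompact_range q.continuous).image Complex.continuous_re).isBounded.exists_norm_le
  obtain ⟨k, hk⟩ := exists_nat_gt ((R + |e.re|) / N)
  rw [div_lt_iff₀ hN] at hk
  have hj : JoinedIn Γ (e + (-(k:ℤ) : ℤ) * N) (e + k * N) := by
    refine JoinedIn.trans (y := e) ?_ (hnat k)
    have := joined_translate (hnat k) (hΓτ (-(k:ℤ)))
    convert this using 1
    push_cast; ring
  obtain ⟨g, hg⟩ := hj
  have hqre : ∀ t, |(q.extend t).re| ≤ R := fun t => by
    refine hR _ ⟨_, ?_, rfl⟩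
    rw [← q.extend_range]; exact ⟨t, rfl⟩
  have hgim : ∀ t, |(g.extend t).im| ≤ M₁ := fun t => by
    apply hΓim
    have : g.extend t ∈ range g := by rw [← g.extend_range]; exact ⟨t, rfl⟩
    obtain ⟨s, hs⟩ := this
    rw [← hs]; exact hg s
  obtain ⟨s, t, hst⟩ := crossing (γ := g.extend) (δ := q.extend) g.continuous_extend
    q.continuous_extend
    (fun t => by
      have := hqre t
      rw [abs_le] at this
      have := neg_abs_le e.re
      have := le_abs_self e.re
      simp; linarith)
    (fun t => by
      have := hqre t
      rw [abs_le] at this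
      have := neg_abs_le e.re
      have := le_abs_self e.re
      simp; linarith)
    (fun s => by
      have := hgim s
      rw [abs_le] at this
      simp; linarith)
    (fun s => by
      have := hgim s
      rw [abs_le] at this
      simp; linarith)
  refine ⟨q.extend t, ?_, ?_⟩
  · have : q.extend t ∈ range q := by rw [← q.extend_range]; exact ⟨t, rfl⟩
    obtain ⟨s, hs⟩ := this
    rw [← hs]; exact hq s
  · rw [← hst]
    have : g.extend s ∈ range g := by rw [← g.extend_range]; exact ⟨s, rfl⟩
    obtain ⟨s, hs⟩ := this
    rw [← hs]; exact hΓE (hg s)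

end PB

open Filter Set Topology MeasureTheory

namespace PB

def Barrier (E : Set ℂ) (M : ℝ) : Prop :=
  ∀ (C : Set ℂ) (x y : ℂ), JoinedIn C x y → x.im ≤ -M → M ≤ y.im → (C ∩ E).Nonempty

theorem Barrier.sgn {E : Set ℂ} {M : ℝ} (h : Barrier E M) {s : ℝ} (hs : s = 1 ∨ s = -1)
    {C : Set ℂ} {x y : ℂ} (hj : JoinedIn C x y) (hx : s * x.im ≤ -M) (hy : M ≤ s * y.im) :
    (C ∩ E).Nonempty := by
  rcases hs with rfl | rfl
  · exact h C x y hj (by linarith) (by linarith)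
  · exact h C y x hj.symm (by linarith) (by linarith)

theorem joined_segment {C : Set ℂ} {x y : ℂ} (h : segment ℝ x y ⊆ C) : JoinedIn C x y :=
  JoinedIn.of_segment_subset h

theorem halfplane_joined {s M : ℝ} {C : Set ℂ} (h : ∀ z : ℂ, M ≤ s * z.im → z ∈ C) {x y : ℂ}
    (hx : M ≤ s * x.im) (hy : M ≤ s * y.im) : JoinedIn C x y := by
  apply joined_segment
  rintro z ⟨a, b, ha, hb, hab, rfl⟩
  apply h
  simp only [Complex.add_im, Complex.real_smul, Complex.mul_im, Complex.ofReal_re,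
    Complex.ofReal_im, zero_mul, add_zero]
  have : M = a * M + b * M := by rw [← add_mul, hab, one_mul]
  nlinarith

theorem top_point {E : Set ℂ} (hE : IsClosed E) {M : ℝ} (hb : Barrier E M) {s : ℝ}
    (hs : s = 1 ∨ s = -1) :
    ∃ t ∈ E, segment ℝ t ((s * M : ℝ) * Complex.I) ∩ E ⊆ {t} := by
  have hss : s * s = 1 := by rcases hs with rfl | rfl <;> norm_num
  -- nonempty
  have hj : JoinedIn (segment ℝ ((-(s * M) : ℝ) * Complex.I) ((s * M : ℝ) * Complex.I))
      ((-(s * M) : ℝ) * Complex.I) ((s * M : ℝ) * Complex.I) := joined_segment subset_rfl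
  obtain ⟨w, hw, hwE⟩ := hb.sgn hs hj (by simp [← mul_assoc, hss]) (by simp [← mul_assoc, hss])
  have hcomp : IsCompact (segment ℝ ((-(s * M) : ℝ) * Complex.I) ((s * M : ℝ) * Complex.I) ∩ E) :=
    (isCompact_seg _ _).inter_right hE
  obtain ⟨t, ⟨ht, htE⟩, hmin⟩ := hcomp.exists_isMinOn ⟨w, hw, hwE⟩
    (f := fun z : ℂ => ‖z - (s * M : ℝ) * Complex.I‖) (by fun_prop)
  refine ⟨t, htE, ?_⟩
  rintro z ⟨hz, hzE⟩
  have hsub : segment ℝ t ((s * M : ℝ) * Complex.I) ⊆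
      segment ℝ ((-(s * M) : ℝ) * Complex.I) ((s * M : ℝ) * Complex.I) :=
    (convex_segment _ _).segment_subset ht (right_mem_segment ℝ _ _)
  have h1 := hmin ⟨hsub hz, hzE⟩
  change ‖t - _‖ ≤ ‖z - _‖ at h1
  rw [segment_symm] at hz
  exact seg_norm_eq hz (le_antisymm (seg_norm_le hz) h1)

theorem top_or {E1 E2 : Set ℂ} (h1 : IsClosed E1) (h2 : IsClosed E2) (hd : Disjoint E1 E2)
    {M : ℝ} (hb : Barrier E1 M) {s : ℝ} (hs : s = 1 ∨ s = -1) :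
    (∃ t ∈ E2, JoinedIn E1ᶜ t ((s * M : ℝ) * Complex.I)) ∨
    (∃ t ∈ E1, JoinedIn E2ᶜ t ((s * M : ℝ) * Complex.I)) := by
  have hb' : Barrier (E1 ∪ E2) M := fun C x y hj hx hy =>
    (hb C x y hj hx hy).mono (inter_subset_inter_right _ subset_union_left)
  obtain ⟨t, ht, htop⟩ := top_point (h1.union h2) hb' hs
  rcases ht with ht | ht
  · right
    refine ⟨t, ht, joined_segment fun z hz hz' => ?_⟩
    have := htop ⟨hz, Or.inr hz'⟩
    rw [mem_singleton_iff] at this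
    exact Set.disjoint_left.1 hd ht (this ▸ hz')
  · left
    refine ⟨t, ht, joined_segment fun z hz hz' => ?_⟩
    have := htop ⟨hz, Or.inl hz'⟩
    rw [mem_singleton_iff] at this
    exact Set.disjoint_left.1 hd (this ▸ hz') ht

theorem sep_aux (F : ℂ ≃ₜ ℂ) {N : ℝ} {E1 E2 : Set ℂ} (h1 : IsClosed E1)
    (hd : Disjoint E1 E2)
    (hper1 : ∀ z : ℂ, z + N ∈ E1 ↔ z ∈ E1) (hper2 : ∀ z : ℂ, z + N ∈ E2 ↔ z ∈ E2)
    (hpc1 : ∀ x ∈ E1, ∀ y ∈ E1, JoinedIn E1 x y) (hpc2 : ∀ x ∈ E2, ∀ y ∈ E2, JoinedIn E2 x y)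
    (hF1 : ∀ z ∈ E1, F z ∈ interior E1) (hF2 : ∀ z ∈ E2, F.symm z ∈ E2)
    {M : ℝ} (hb1 : Barrier E1 M) (hb2 : Barrier E2 M) {s : ℝ} (hs : s = 1 ∨ s = -1)
    {t : ℂ} (ht : t ∈ E2) (htj : JoinedIn E1ᶜ t ((s * M : ℝ) * Complex.I))
    {b : ℂ} (hb : b ∈ E1) (hbj : JoinedIn E2ᶜ b ((-s * M : ℝ) * Complex.I)) :
    ∃ O : Set ℂ, IsOpen O ∧ (∀ z : ℂ, z + N ∈ O ↔ z ∈ O) ∧ (∀ z ∈ closure O, F.symm z ∈ O) ∧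
      (∀ z : ℂ, M ≤ s * z.im → z ∈ O) ∧ (∀ z : ℂ, s * z.im ≤ -M → z ∉ O) := by
  have hss : s * s = 1 := by rcases hs with rfl | rfl <;> norm_num
  have hE12 : E1 ⊆ E2ᶜ := fun z h h' => Set.disjoint_left.1 hd h h'
  have hE21 : E2 ⊆ E1ᶜ := fun z h h' => Set.disjoint_left.1 hd h' h
  have hup : ∀ z : ℂ, M ≤ s * z.im → z ∈ E1ᶜ := by
    intro w hw hwE
    have hj : JoinedIn E2ᶜ w ((-s * M : ℝ) * Complex.I) := ((hpc1 w hwE b hb).mono hE12).trans hbj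
    obtain ⟨x, hx, hx'⟩ := hb2.sgn hs hj.symm (by simp [← mul_assoc, hss]) hw
    exact hx hx'
  set O : Set ℂ := {z | JoinedIn E1ᶜ z t} with hO
  have hOE : O ⊆ E1ᶜ := fun z hz => hz.source_mem
  have hnear : ∀ z ∈ closure O, z ∉ E1 → z ∈ O := by
    intro z hz hzE
    obtain ⟨r, hr, hrb⟩ := Metric.isOpen_iff.1 h1.isOpen_compl z hzE
    obtain ⟨w, hwO, hwr⟩ := Metric.mem_closure_iff.1 hz r hr
    refine JoinedIn.trans (joined_segment ?_) hwO
    refine ((convex_ball z r).segment_subset (Metric.mem_ball_self hr) ?_).trans hrb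
    rwa [Metric.mem_ball, dist_comm]
  have hE2O : E2 ⊆ O := fun z hz => (hpc2 z hz t ht).mono hE21
  have hFO : ∀ z ∈ O, F.symm z ∈ O := by
    intro z hz
    have h3 : JoinedIn E1ᶜ (F.symm z) (F.symm t) := by
      obtain ⟨p, hp⟩ := hz
      refine ⟨p.map F.symm.continuous, fun τ hmem => hp τ ?_⟩
      have := interior_subset (hF1 _ hmem)
      simpa using this
    exact h3.trans (hE2O (hF2 t ht))
  refine ⟨O, ?_, ?_, ?_, ?_, ?_⟩
  · rw [Metric.isOpen_iff]
    intro z hz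
    obtain ⟨r, hr, hrb⟩ := Metric.isOpen_iff.1 h1.isOpen_compl z (hOE hz)
    refine ⟨r, hr, fun w hw => JoinedIn.trans (joined_segment ?_) hz⟩
    exact ((convex_ball z r).segment_subset hw (Metric.mem_ball_self hr)).trans hrb
  · intro z
    constructor
    · intro hz
      have h3 := joined_translate hz (E' := E1ᶜ) (c := -(N:ℂ)) (fun w hw hw' => hw (by
        rw [← sub_eq_add_neg] at hw'
        have := (hper1 _).2 hw'
        simpa using this))
      have h4 : t + -(N:ℂ) ∈ E2 := by rw [← hper2]; simpa using ht
      rw [add_neg_cancel_right] at h3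
      exact h3.trans (hE2O h4)
    · intro hz
      have h3 := joined_translate hz (E' := E1ᶜ) (c := (N:ℂ)) (fun w hw hw' => hw
        ((hper1 _).1 hw'))
      exact h3.trans (hE2O ((hper2 t).2 ht))
  · intro z hz
    by_cases hzE : z ∈ E1
    · have hni : z ∉ interior E1 := by
        intro hi
        obtain ⟨w, hw1, hw2⟩ := mem_closure_iff.1 hz _ isOpen_interior hi
        exact hOE hw2 (interior_subset hw1)
      have hFz : F.symm z ∉ E1 := fun h => hni (by simpa using hF1 _ h)
      refine hnear _ ?_ hFz
      have : MapsTo F.symm O O := hFO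
      exact this.closure F.symm.continuous hz
    · exact hFO z (hnear z hz hzE)
  · intro z hz
    have h3 : JoinedIn E1ᶜ z ((s * M : ℝ) * Complex.I) :=
      halfplane_joined (s := s) (M := M) hup hz (by simp [← mul_assoc, hss])
    exact h3.trans htj.symm
  · intro z hz hzO
    have h3 : JoinedIn E1ᶜ z ((s * M : ℝ) * Complex.I) := JoinedIn.trans hzO htj
    obtain ⟨x, hx, hx'⟩ := hb1.sgn hs h3 hz (by simp [← mul_assoc, hss])
    exact hx hx'

theorem separation (F : ℂ ≃ₜ ℂ) {N : ℝ} (hN : 0 < N) {E1 E2 : Set ℂ} (h1 : IsClosed E1)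
    (h2 : IsClosed E2) (hne1 : E1.Nonempty) (hne2 : E2.Nonempty)
    (hd : Disjoint E1 E2)
    (hper1 : ∀ z : ℂ, z + N ∈ E1 ↔ z ∈ E1) (hper2 : ∀ z : ℂ, z + N ∈ E2 ↔ z ∈ E2)
    (hpc1 : ∀ x ∈ E1, ∀ y ∈ E1, JoinedIn E1 x y) (hpc2 : ∀ x ∈ E2, ∀ y ∈ E2, JoinedIn E2 x y)
    (hF1 : ∀ z ∈ E1, F z ∈ interior E1) (hF2 : ∀ z ∈ E2, F.symm z ∈ E2) :
    ∃ O : Set ℂ, IsOpen O ∧ (∀ z : ℂ, z + N ∈ O ↔ z ∈ O) ∧ (∀ z ∈ closure O, F.symm z ∈ O) ∧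
      ∃ s : ℝ, (s = 1 ∨ s = -1) ∧ ∃ M : ℝ,
      (∀ z : ℂ, M ≤ s * z.im → z ∈ O) ∧ (∀ z : ℂ, s * z.im ≤ -M → z ∉ O) := by
  obtain ⟨M1, -, hM1⟩ := barrier hN hne1 hper1 hpc1
  obtain ⟨M2, -, hM2⟩ := barrier hN hne2 hper2 hpc2
  set M := max M1 M2
  have hb1 : Barrier E1 M := hM1 M (le_max_left _ _)
  have hb2 : Barrier E2 M := hM2 M (le_max_right _ _)
  have fin := fun {s : ℝ} (hs : s = 1 ∨ s = -1) {t : ℂ} (ht : t ∈ E2)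
      (htj : JoinedIn E1ᶜ t ((s * M : ℝ) * Complex.I))
      {b : ℂ} (hb : b ∈ E1) (hbj : JoinedIn E2ᶜ b ((-s * M : ℝ) * Complex.I)) =>
      sep_aux F h1 hd hper1 hper2 hpc1 hpc2 hF1 hF2 hb1 hb2 hs ht htj hb hbj
  have hE12 : E1 ⊆ E2ᶜ := fun z h h' => Set.disjoint_left.1 hd h h'
  have hE21 : E2 ⊆ E1ᶜ := fun z h h' => Set.disjoint_left.1 hd h' h
  rcases top_or h1 h2 hd hb1 (Or.inl rfl : (1:ℝ) = 1 ∨ (1:ℝ) = -1) with ⟨t, ht, htj⟩ | ⟨t, ht, htj⟩ <;>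
  rcases top_or h1 h2 hd hb1 (Or.inr rfl : (-1:ℝ) = 1 ∨ (-1:ℝ) = -1) with ⟨b, hb, hbj⟩ | ⟨b, hb, hbj⟩
  · exfalso
    have hj := hbj.symm.trans (((hpc2 b hb t ht).mono hE21).trans htj)
    obtain ⟨x, hx, hx'⟩ := hb1 _ _ _ hj (by simp) (by simp)
    exact hx hx'
  · obtain ⟨O, a1, a2, a3, a4, a5⟩ := fin (Or.inl rfl) ht htj hb hbj
    exact ⟨O, a1, a2, a3, 1, Or.inl rfl, M, a4, a5⟩
  · obtain ⟨O, a1, a2, a3, a4, a5⟩ := fin (Or.inr rfl) hb hbj ht (by simpa using htj)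
    exact ⟨O, a1, a2, a3, -1, Or.inr rfl, M, a4, a5⟩
  · exfalso
    have hj := hbj.symm.trans (((hpc1 b hb t ht).mono hE12).trans htj)
    obtain ⟨x, hx, hx'⟩ := hb2 _ _ _ hj (by simp) (by simp)
    exact hx hx'

end PB

open Filter Set Topology MeasureTheory

namespace PB

structure BrickSys (N : ℝ) (ι : Type*) where
  C : ι → Set ℂ
  B : ι → Set ℂ
  S : Equiv.Perm ι
  lf : LocallyFinite C
  cov : ∀ x, ∃ c, x ∈ C c
  closedC : ∀ c, IsClosed (C c)
  CB : ∀ c, C c ⊆ B c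
  Bcell : ∀ c, ∀ x ∈ B c, ∃ c', x ∈ C c' ∧ B c' = B c
  Bne : ∀ c, (B c).Nonempty
  Bjoin : ∀ c, ∀ x ∈ B c, ∀ y ∈ B c, JoinedIn (B c) x y
  BS : ∀ c (z : ℂ), z + N ∈ B (S c) ↔ z ∈ B c

inductive InA {ι : Type*} {N : ℝ} (b : BrickSys N ι) (F : ℂ → ℂ) (c0 : ι) : ι → Prop
  | base : InA b F c0 c0
  | shift (c : ι) : InA b F c0 c → InA b F c0 (b.S c)
  | unshift (c : ι) : InA b F c0 c → InA b F c0 (b.S.symm c)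
  | step (c d : ι) : InA b F c0 c → BRel F b.B c d → InA b F c0 d
  | cls (c d : ι) : InA b F c0 c → b.B c = b.B d → InA b F c0 d

section
variable {ι : Type*} {N : ℝ} (b : BrickSys N ι)

def Aset (F : ℂ → ℂ) (c0 : ι) : Set ℂ := {x | ∃ c, InA b F c0 c ∧ x ∈ b.C c}

variable {b} {F : ℂ → ℂ} {c0 : ι}

theorem B_sub_Aset {c : ι} (hc : InA b F c0 c) : b.B c ⊆ Aset b F c0 := by
  intro x hx
  obtain ⟨c', h1, h2⟩ := b.Bcell c x hx
  exact ⟨c', hc.cls _ _ h2.symm, h1⟩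

theorem Aset_closed : IsClosed (Aset b F c0) := by
  have : Aset b F c0 = ⋃ c : {c // InA b F c0 c}, b.C c := by
    ext x; simp [Aset]
  rw [this]
  exact (b.lf.comp_injective Subtype.val_injective).isClosed_iUnion fun c => b.closedC c

theorem Aset_map {x : ℂ} (hx : x ∈ Aset b F c0) : F x ∈ interior (Aset b F c0) := by
  obtain ⟨d, hd, hxd⟩ := hx
  have hcl : IsClosed (⋃ c : {c // ¬ InA b F c0 c}, b.C c) :=
    (b.lf.comp_injective Subtype.val_injective).isClosed_iUnion fun c => b.closedC c
  refine mem_interior.2 ⟨_, ?_, hcl.isOpen_compl, ?_⟩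
  · intro y hy
    obtain ⟨c, hc⟩ := b.cov y
    refine ⟨c, ?_, hc⟩
    by_contra h
    exact hy (mem_iUnion.2 ⟨⟨c, h⟩, hc⟩)
  · intro hmem
    obtain ⟨⟨c, hc⟩, hxc⟩ := mem_iUnion.1 hmem
    exact hc (hd.step _ _ ⟨x, b.CB _ hxd, b.CB _ hxc⟩)

theorem BS' (c : ι) (z : ℂ) : z ∈ b.B (b.S.symm c) ↔ z + N ∈ b.B c := by
  rw [← b.BS, Equiv.apply_symm_apply]

theorem Aset_shift {x : ℂ} : x + N ∈ Aset b F c0 ↔ x ∈ Aset b F c0 := by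
  constructor
  · rintro ⟨c, hc, hx⟩
    exact B_sub_Aset hc.unshift ((BS' c x).2 (b.CB _ hx))
  · rintro ⟨c, hc, hx⟩
    exact B_sub_Aset hc.shift ((b.BS c x).2 (b.CB _ hx))

theorem InA_of_reach {c : ι} (h : Relation.ReflTransGen (BRel F b.B) c0 c) : InA b F c0 c := by
  induction h with
  | refl => exact InA.base
  | tail _ h ih => exact ih.step _ _ h

theorem Aset_pc (hc : Continuous F)
    {d0 : ι} (hs1 : BRel F b.B c0 d0) (hs2 : (b.B d0 ∩ b.B c0).Nonempty)
    (hdrift : Relation.ReflTransGen (BRel F b.B) c0 (b.S c0) ∨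
      Relation.ReflTransGen (BRel F b.B) c0 (b.S.symm c0)) :
    ∀ x ∈ Aset b F c0, ∀ y ∈ Aset b F c0, JoinedIn (Aset b F c0) x y := by
  obtain ⟨x0, hx0⟩ := b.Bne c0
  set A := Aset b F c0 with hA
  have hFA : ∀ {x y}, JoinedIn A x y → JoinedIn A (F x) (F y) := by
    rintro x y ⟨p, hp⟩
    exact ⟨p.map hc, fun t => interior_subset (Aset_map (hp t))⟩
  have hB : ∀ {c x y}, InA b F c0 c → x ∈ b.B c → y ∈ b.B c → JoinedIn A x y :=
    fun {c x y} h hx hy => (b.Bjoin c x hx y hy).mono (B_sub_Aset h)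
  have h0 : JoinedIn A (F x0) x0 := by
    obtain ⟨w, hw1, hw2⟩ := hs1
    obtain ⟨v, hv1, hv2⟩ := hs2
    have hd0 : InA b F c0 d0 := InA.base.step _ _ ⟨w, hw1, hw2⟩
    exact (hFA (hB InA.base hx0 hw1)).trans ((hB hd0 hw2 hv1).trans (hB InA.base hv2 hx0))
  have hstep : ∀ c d, InA b F c0 c → BRel F b.B c d → (∀ y ∈ b.B c, JoinedIn A y x0) →
      ∀ y ∈ b.B d, JoinedIn A y x0 := by
    rintro c d hcA ⟨w, hw1, hw2⟩ ih y hy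
    have hdA : InA b F c0 d := hcA.step _ _ ⟨w, hw1, hw2⟩
    exact (hB hdA hy hw2).trans ((hFA (ih w hw1)).trans h0)
  have hreach : ∀ c, Relation.ReflTransGen (BRel F b.B) c0 c → ∀ y ∈ b.B c, JoinedIn A y x0 := by
    intro c h
    induction h with
    | refl => exact fun y hy => hB InA.base hy hx0
    | tail h1 h2 ih => exact hstep _ _ (InA_of_reach h1) h2 ih
  have hup : ∀ {x y}, JoinedIn A x y → JoinedIn A (x + N) (y + N) := fun h =>
    joined_translate h fun z hz => Aset_shift.2 hz
  have hdown : ∀ {x y}, JoinedIn A x y → JoinedIn A (x - N) (y - N) := fun h => by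
    simp only [sub_eq_add_neg]
    refine joined_translate h fun z hz => Aset_shift.1 ?_
    rwa [neg_add_cancel_right]
  have hx0N : JoinedIn A (x0 + N) x0 := by
    rcases hdrift with h | h
    · exact hreach _ h _ ((b.BS _ _).2 hx0)
    · have h3 : JoinedIn A (x0 - N) x0 := hreach _ h _ ((BS' _ _).2 (by simpa using hx0))
      have h4 := hup h3
      rw [sub_add_cancel] at h4
      exact h4.symm
  have hx0N' : JoinedIn A (x0 - N) x0 := by
    have := hdown hx0N
    rw [add_sub_cancel_right] at this
    exact this.symm
  have hall : ∀ c, InA b F c0 c → ∀ y ∈ b.B c, JoinedIn A y x0 := by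
    intro c h
    induction h with
    | base => exact fun y hy => hB InA.base hy hx0
    | shift c h ih =>
      intro y hy
      have h1 : y - N ∈ b.B c := by rw [← b.BS]; simpa using hy
      have h2 := hup (ih _ h1)
      rw [sub_add_cancel] at h2
      exact h2.trans hx0N
    | unshift c h ih =>
      intro y hy
      have h2 := hdown (ih _ ((BS' _ _).1 hy))
      rw [add_sub_cancel_right] at h2
      exact h2.trans hx0N'
    | step c d h1 h2 ih => exact hstep c d h1 h2 ih
    | cls c d h1 h2 ih => intro y hy; exact ih y (h2 ▸ hy)
  rintro x ⟨c, hc, hxc⟩ y ⟨d, hd, hyd⟩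
  exact (hall c hc x (b.CB _ hxc)).trans (hall d hd y (b.CB _ hyd)).symm

theorem BRel_shift (hFN : ∀ z, F (z + N) = F z + N) {c d : ι} :
    BRel F b.B (b.S c) (b.S d) ↔ BRel F b.B c d := by
  constructor
  · rintro ⟨x, h1, h2⟩
    refine ⟨x - N, ?_, ?_⟩
    · rw [← b.BS]; simpa using h1
    · rw [← b.BS, ← hFN]; simpa using h2
  · rintro ⟨x, h1, h2⟩
    exact ⟨x + N, (b.BS _ _).2 h1, by rw [hFN]; exact (b.BS _ _).2 h2⟩

theorem reach_shift (hFN : ∀ z, F (z + N) = F z + N) {c d : ι}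
    (h : Relation.ReflTransGen (BRel F b.B) c d) :
    Relation.ReflTransGen (BRel F b.B) (b.S c) (b.S d) :=
  h.lift b.S fun _ _ h => (BRel_shift hFN).2 h

theorem reach_unshift (hFN : ∀ z, F (z + N) = F z + N) {c d : ι}
    (h : Relation.ReflTransGen (BRel F b.B) c d) :
    Relation.ReflTransGen (BRel F b.B) (b.S.symm c) (b.S.symm d) :=
  h.lift b.S.symm fun _ _ h => (BRel_shift hFN).1 (by simpa using h)

theorem InA_reach (hFN : ∀ z, F (z + N) = F z + N) {c : ι} (h : InA b F c0 c) :
    ∃ (j : ℤ) (c' : ι), Relation.ReflTransGen (BRel F b.B) ((b.S ^ j) c0) c' ∧ b.B c' = b.B c := by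
  induction h with
  | base => exact ⟨0, c0, by simpa using Relation.ReflTransGen.refl, rfl⟩
  | shift c h ih =>
    obtain ⟨j, c', h1, h2⟩ := ih
    refine ⟨1 + j, b.S c', ?_, ?_⟩
    · rw [zpow_add, zpow_one]; exact reach_shift hFN h1
    · ext z
      have e1 := b.BS c' (z - N)
      have e2 := b.BS c (z - N)
      rw [sub_add_cancel] at e1 e2
      rw [e1, e2, h2]
  | unshift c h ih =>
    obtain ⟨j, c', h1, h2⟩ := ih
    refine ⟨-1 + j, b.S.symm c', ?_, ?_⟩
    · rw [zpow_add, zpow_neg_one]; exact reach_unshift hFN h1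
    · ext z; rw [BS', BS', h2]
  | step c d h1 h2 ih =>
    obtain ⟨j, c', h3, h4⟩ := ih
    refine ⟨j, d, h3.tail ?_, rfl⟩
    obtain ⟨x, hx1, hx2⟩ := h2
    exact ⟨x, h4 ▸ hx1, hx2⟩
  | cls c d h1 h2 ih =>
    obtain ⟨j, c', h3, h4⟩ := ih
    exact ⟨j, c', h3, h4.trans h2⟩

end

theorem BRel_symm {ι : Type*} {F : ℂ ≃ₜ ℂ} {B : ι → Set ℂ} {i j : ι} :
    BRel F.symm B i j ↔ BRel F B j i := by
  constructor
  · rintro ⟨x, h1, h2⟩; exact ⟨F.symm x, h2, by simpa using h1⟩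
  · rintro ⟨x, h1, h2⟩; exact ⟨F x, h2, by simpa using h1⟩

theorem reach_symm {ι : Type*} {F : ℂ ≃ₜ ℂ} {B : ι → Set ℂ} {i j : ι} :
    Relation.ReflTransGen (BRel F.symm B) i j ↔ Relation.ReflTransGen (BRel F B) j i := by
  rw [← Relation.reflTransGen_swap]
  have : Function.swap (BRel F.symm B) = BRel F B := by
    ext i j; exact BRel_symm
  rw [this]

theorem bricks_to_O {ι : Type*} {N : ℝ} (hN : 0 < N) (b : BrickSys N ι) (F : ℂ ≃ₜ ℂ)
    (hFN : ∀ z, F (z + N) = F z + N) (c0 c1 : ι)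
    {d0 : ι} (hs1 : BRel F b.B c0 d0) (hs2 : (b.B d0 ∩ b.B c0).Nonempty)
    (hdrift : Relation.ReflTransGen (BRel F b.B) c0 (b.S c0) ∨
      Relation.ReflTransGen (BRel F b.B) c0 (b.S.symm c0))
    {d1 : ι} (hp1 : BRel F b.B d1 c1) (hp2 : (b.B d1 ∩ b.B c1).Nonempty)
    (hdrift' : Relation.ReflTransGen (BRel F b.B) (b.S c1) c1 ∨
      Relation.ReflTransGen (BRel F b.B) (b.S.symm c1) c1)
    (hno : ∀ j j' : ℤ, ¬ Relation.ReflTransGen (BRel F b.B) ((b.S ^ j) c0) ((b.S ^ j') c1)) :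
    ∃ O : Set ℂ, IsOpen O ∧ (∀ z : ℂ, z + N ∈ O ↔ z ∈ O) ∧ (∀ z ∈ closure O, F.symm z ∈ O) ∧
      ∃ s : ℝ, (s = 1 ∨ s = -1) ∧ ∃ M : ℝ,
      (∀ z : ℂ, M ≤ s * z.im → z ∈ O) ∧ (∀ z : ℂ, s * z.im ≤ -M → z ∉ O) := by
  have hFN' : ∀ z, F.symm (z + N) = F.symm z + N := by
    intro z; rw [Homeomorph.symm_apply_eq, hFN, Homeomorph.apply_symm_apply]
  have hpcA := Aset_pc (b := b) F.continuous hs1 hs2 hdrift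
  have hpcA' := Aset_pc (b := b) (F := F.symm) (c0 := c1) F.symm.continuous (BRel_symm.2 hp1) hp2
    (by simpa only [reach_symm] using hdrift')
  have hne : ∀ (G : ℂ → ℂ) c, (Aset b G c).Nonempty := fun G c =>
    (b.Bne c).mono (B_sub_Aset InA.base)
  refine separation F hN (E1 := F '' Aset b F c0) (E2 := Aset b F.symm c1) ?_ Aset_closed
    ((hne _ _).image _) (hne _ _) ?_ ?_ (fun z => Aset_shift) ?_ hpcA' ?_ ?_
  · exact F.isClosedMap _ Aset_closed
  · rw [Set.disjoint_left]
    rintro _ ⟨x, ⟨c, hc, hxc⟩, rfl⟩ ⟨d, hd, hxd⟩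
    obtain ⟨j, c', h1, h2⟩ := InA_reach hFN hc
    obtain ⟨j', d', h3, h4⟩ := InA_reach hFN' hd
    rw [reach_symm] at h3
    have h5 : BRel F b.B c' d' := ⟨x, h2 ▸ b.CB _ hxc, h4 ▸ b.CB _ hxd⟩
    exact hno j j' (h1.trans (Relation.ReflTransGen.head h5 h3))
  · intro z
    constructor
    · rintro ⟨x, hx, hxz⟩
      refine ⟨x - N, Aset_shift.1 (by simpa using hx), ?_⟩
      have := hFN (x - N)
      rw [sub_add_cancel, hxz] at this
      exact (add_right_cancel this).symm
    · rintro ⟨x, hx, rfl⟩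
      exact ⟨x + N, Aset_shift.2 hx, hFN x⟩
  · rintro _ ⟨x, hx, rfl⟩ _ ⟨y, hy, rfl⟩
    obtain ⟨p, hp⟩ := hpcA x hx y hy
    exact ⟨p.map F.continuous, fun t => ⟨p t, hp t, rfl⟩⟩
  · rintro _ ⟨x, hx, rfl⟩
    rw [← F.image_interior]
    exact ⟨_, Aset_map hx, rfl⟩
  · intro z hz
    exact interior_subset (Aset_map hz)

end PB

open Filter Set Topology MeasureTheory

namespace PB

structure Grid (ι : Type) where
  C : ι → Set ℂ
  T : Equiv.Perm ι
  lf : LocallyFinite C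
  cov : ∀ x, ∃ c, x ∈ C c
  cpt : ∀ c, IsCompact (C c)
  cvx : ∀ c, Convex ℝ (C c)
  ne : ∀ c, (C c).Nonempty
  cl : ∀ c, C c ⊆ closure (interior (C c))
  disj : ∀ c d, c ≠ d → Disjoint (interior (C c)) (interior (C d))
  CT : ∀ c (z : ℂ), z + 1 ∈ C (T c) ↔ z ∈ C c

namespace Grid
variable {ι : Type} (G : Grid ι)

def U (K : Set ℂ) : Set ℂ := {x | ∃ c, x ∈ G.C c ∧ (G.C c ∩ K).Nonempty}

variable {G} {K : Set ℂ}

theorem sub_U {c : ι} (h : (G.C c ∩ K).Nonempty) : G.C c ⊆ G.U K := fun _ hx => ⟨c, hx, h⟩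

theorem K_sub_int : K ⊆ interior (G.U K) := by
  intro x hxK
  have hcl : IsClosed (⋃ c : {c // ¬ (G.C c ∩ K).Nonempty}, G.C c) :=
    (G.lf.comp_injective Subtype.val_injective).isClosed_iUnion fun c => (G.cpt c).isClosed
  refine mem_interior.2 ⟨_, ?_, hcl.isOpen_compl, ?_⟩
  · intro y hy
    obtain ⟨c, hc⟩ := G.cov y
    refine ⟨c, hc, ?_⟩
    by_contra h
    exact hy (mem_iUnion.2 ⟨⟨c, h⟩, hc⟩)
  · intro hmem
    obtain ⟨⟨c, hc⟩, hxc⟩ := mem_iUnion.1 hmem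
    exact hc ⟨x, hxc, hxK⟩

theorem fin_meet {R : ℝ} {z : ℂ} (hK : K ⊆ Metric.closedBall z R) :
    {c | (G.C c ∩ K).Nonempty}.Finite := by
  refine (G.lf.finite_nonempty_inter_compact (isCompact_closedBall z R)).subset ?_
  rintro c ⟨x, h1, h2⟩
  exact ⟨x, h1, hK h2⟩

theorem U_eq : G.U K = ⋃ c ∈ {c | (G.C c ∩ K).Nonempty}, G.C c := by
  ext x; simp only [U, mem_iUnion, exists_prop]
  constructor
  · rintro ⟨c, h1, h2⟩; exact ⟨c, h2, h1⟩
  · rintro ⟨c, h1, h2⟩; exact ⟨c, h2, h1⟩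

theorem U_compact {R : ℝ} {z : ℂ} (hK : K ⊆ Metric.closedBall z R) : IsCompact (G.U K) := by
  rw [U_eq]
  exact (fin_meet hK).isCompact_biUnion fun c _ => G.cpt c

theorem U_cl : G.U K ⊆ closure (interior (G.U K)) := by
  rintro x ⟨c, h1, h2⟩
  exact closure_mono (interior_mono (sub_U h2)) (G.cl c h1)

theorem U_int_conn {z : ℂ} (hs : StarConvex ℝ z K) (hz : z ∈ K) :
    IsPreconnected (interior (G.U K)) := by
  have hKc : IsPreconnected K := (hs.isPathConnected hz).isConnected.isPreconnected
  have hW : ∀ c : {c // (G.C c ∩ K).Nonempty}, ∃ W : Set ℂ, IsPreconnected W ∧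
      interior (G.C c) ⊆ W ∧ W ⊆ interior (G.U K) ∧ (K ∩ W).Nonempty := by
    rintro ⟨c, x, hx1, hx2⟩
    refine ⟨insert x (interior (G.C c)), ?_, subset_insert _ _, ?_, x, hx2, mem_insert _ _⟩
    · exact (G.cvx c).interior.isPreconnected.subset_closure (subset_insert _ _)
        (insert_subset (G.cl c hx1) subset_closure)
    · exact insert_subset (K_sub_int hx2) (interior_mono (sub_U ⟨x, hx1, hx2⟩))
  choose W hW1 hW2 hW3 hW4 using hW
  have hV : IsPreconnected (K ∪ ⋃ c, (K ∪ W c)) := by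
    by_cases hemp : IsEmpty {c // (G.C c ∩ K).Nonempty}
    · simpa using hKc
    · have : Nonempty {c // (G.C c ∩ K).Nonempty} := not_isEmpty_iff.1 hemp
      have h1 : IsPreconnected (⋃ c, (K ∪ W c)) := by
        refine isPreconnected_iUnion ⟨z, mem_iInter.2 fun c => Or.inl hz⟩ fun c => ?_
        obtain ⟨x, hx1, hx2⟩ := hW4 c
        exact hKc.union x hx1 hx2 (hW1 c)
      have c0 := this.some
      exact hKc.union z hz (mem_iUnion.2 ⟨c0, Or.inl hz⟩) h1
  refine hV.subset_closure ?_ ?_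
  · refine union_subset K_sub_int (iUnion_subset fun c => union_subset K_sub_int (hW3 c))
  · intro x hx
    obtain ⟨c, h1, h2⟩ := interior_subset hx
    have h3 : interior (G.C c) ⊆ K ∪ ⋃ c, (K ∪ W c) := fun y hy =>
      Or.inr (mem_iUnion.2 ⟨⟨c, h2⟩, Or.inr (hW2 ⟨c, h2⟩ hy)⟩)
    exact closure_mono h3 (G.cl c h1)

theorem U_joined {z : ℂ} (hs : StarConvex ℝ z K) {x y : ℂ} (hx : x ∈ G.U K)
    (hy : y ∈ G.U K) : JoinedIn (G.U K) x y := by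
  have key : ∀ x ∈ G.U K, JoinedIn (G.U K) x z := by
    rintro x ⟨c, h1, w, h2, h3⟩
    have hsub : G.C c ⊆ G.U K := sub_U ⟨w, h2, h3⟩
    refine (joined_segment (((G.cvx c).segment_subset h1 h2).trans hsub)).trans ?_
    refine (joined_segment ?_).symm
    exact (starConvex_iff_segment_subset.1 hs h3).trans (K_sub_int.trans interior_subset)
  exact (key x hx).trans (key y hy).symm

end Grid

theorem sep_delta {F : ℂ → ℂ} (hF : Continuous F) {X Y : Set ℂ} (hX : IsCompact X)
    (hY : IsCompact Y) (h : ∀ a ∈ X, F a ∉ Y) :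
    ∃ δ > 0, ∀ a ∈ Metric.cthickening δ X, F a ∉ Metric.cthickening δ Y := by
  have hd : Disjoint (F '' X) Y := by
    rw [Set.disjoint_left]; rintro _ ⟨a, ha, rfl⟩; exact h a ha
  obtain ⟨δ1, h1, h1'⟩ := hd.exists_cthickenings (hX.image hF) hY.isClosed
  obtain ⟨δ2, h2, h2'⟩ := hX.exists_cthickening_subset_open
    ((Metric.isClosed_cthickening (δ := δ1) (E := Y)).isOpen_compl.preimage hF) (by
      intro a ha hmem
      exact Set.disjoint_left.1 h1' (Metric.self_subset_cthickening _ ⟨a, ha, rfl⟩) hmem)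
  refine ⟨min δ1 δ2, lt_min h1 h2, fun a ha hmem => ?_⟩
  exact h2' (Metric.cthickening_mono (min_le_right _ _) _ ha)
    (Metric.cthickening_mono (min_le_left _ _) _ hmem)

theorem succ_brick {F : ℂ ≃ₜ ℂ} (hF : OP F) (hfpf : ∀ z, F z ≠ z) (z : ℂ) :
    ∃ R > 0, ∃ δ > 0, ∀ (ι : Type) (G : Grid ι),
      (∀ c, ∀ x ∈ G.C c, ∀ y ∈ G.C c, ‖x - z‖ ≤ R → ‖x - y‖ ≤ δ) →
      ∃ K, StarConvex ℝ z K ∧ z ∈ K ∧ K ⊆ Metric.closedBall z R ∧ Free F (G.U K) ∧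
        ∃ x ∈ G.U K, ∃ e, F x ∈ G.C e ∧ (G.C e ∩ G.U K).Nonempty := by
  obtain ⟨u, r, hr, -, hu, hv, hmin⟩ := minball F hfpf z
  set v := F u with hvdef
  have key : ∀ {a}, a ∈ segment ℝ z u ∪ segment ℝ z v → F a ∈ segment ℝ z u ∪ segment ℝ z v →
      a = u := fun ha hFa => seg_key hF hfpf hu hv hmin ha hFa
  have hvA : v ∉ segment ℝ z u := fun h => hfpf u (seg_norm_eq h (hv.trans hu.symm))
  have huB : u ∉ segment ℝ z v := fun h => hfpf u (seg_norm_eq h (hu.trans hv.symm)).symm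
  have hSc : IsCompact (segment ℝ z u ∪ segment ℝ z v) := (isCompact_seg z u).union (isCompact_seg z v)
  obtain ⟨δ1, hδ1, h1⟩ := sep_delta F.continuous hSc (isCompact_seg z u) (by
    intro a ha hFa
    have := key ha (Or.inl hFa)
    subst this; exact hvA hFa)
  obtain ⟨δ2, hδ2, h2⟩ := sep_delta F.continuous (isCompact_seg z v) hSc (by
    intro a ha hFa
    have := key (Or.inr ha) hFa
    subst this; exact huB ha)
  refine ⟨r, hr, min δ1 δ2, lt_min hδ1 hδ2, fun ι G hG => ?_⟩
  have hAr : segment ℝ z u ⊆ Metric.closedBall z r := fun x hx => by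
    rw [mem_closedBall_iff_norm, ← hu]; exact seg_norm_le hx
  have hBr : segment ℝ z v ⊆ Metric.closedBall z r := fun x hx => by
    rw [mem_closedBall_iff_norm, ← hv]; exact seg_norm_le hx
  have thick : ∀ {c : ι} {X : Set ℂ} {δ : ℝ}, min δ1 δ2 ≤ δ → X ⊆ Metric.closedBall z r →
      (G.C c ∩ X).Nonempty → G.C c ⊆ Metric.cthickening δ X := by
    rintro c X δ hδ hX ⟨x, hxc, hxX⟩ y hy
    refine Metric.mem_cthickening_of_dist_le y x δ X hxX ?_
    rw [dist_comm, dist_eq_norm]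
    exact (hG c x hxc y hy (mem_closedBall_iff_norm.1 (hX hxX))).trans hδ
  have hSr := union_subset hAr hBr
  -- the two exclusion facts
  have ex1 : ∀ {d e : ι}, (G.C d ∩ (segment ℝ z u ∪ segment ℝ z v)).Nonempty →
      BRel F G.C d e → ¬ (G.C e ∩ segment ℝ z u).Nonempty := by
    rintro d e hd ⟨x, hx1, hx2⟩ he
    exact h1 x (thick (min_le_left _ _) hSr hd hx1) (thick (min_le_left _ _) hAr he hx2)
  have ex2 : ∀ {d e : ι}, (G.C e ∩ (segment ℝ z u ∪ segment ℝ z v)).Nonempty →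
      BRel F G.C d e → ¬ (G.C d ∩ segment ℝ z v).Nonempty := by
    rintro d e he ⟨x, hx1, hx2⟩ hd
    exact h2 x (thick (min_le_right _ _) hBr hd hx1) (thick (min_le_right _ _) hSr he hx2)
  let g : ℝ → ℂ := fun t => z + t • (v - z)
  have hg : Continuous g := by fun_prop
  have hgseg : ∀ {t}, 0 ≤ t → t ≤ 1 → g t ∈ segment ℝ z v := fun h0 h1 => by
    rw [segment_eq_image']; exact ⟨_, ⟨h0, h1⟩, rfl⟩
  let E : Set ι := {e | (G.C e ∩ segment ℝ z v).Nonempty ∧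
    ∃ d, (G.C d ∩ segment ℝ z u).Nonempty ∧ BRel F G.C d e}
  have hEfin : E.Finite := (Grid.fin_meet (G := G) hBr).subset fun e he => he.1
  let Ts : Set ℝ := Icc 0 1 ∩ ⋃ e ∈ E, g ⁻¹' (G.C e)
  have hTsc : IsCompact Ts := isCompact_Icc.inter_right
    (hEfin.isClosed_biUnion fun e _ => (G.cpt e).isClosed.preimage hg)
  have hTsne : Ts.Nonempty := by
    obtain ⟨d, hd⟩ := G.cov u
    obtain ⟨e, he⟩ := G.cov v
    refine ⟨1, ⟨zero_le_one, le_rfl⟩, mem_iUnion₂.2 ⟨e, ⟨⟨v, he, right_mem_segment ℝ z v⟩, d,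
      ⟨u, hd, right_mem_segment ℝ z u⟩, u, hd, he⟩, ?_⟩⟩
    change z + (1:ℝ) • (v - z) ∈ G.C e
    simpa using he
  obtain ⟨ts, hts, hleast⟩ := hTsc.exists_isLeast hTsne
  obtain ⟨⟨hts0, hts1⟩, htsm⟩ := hts
  obtain ⟨e, heE, heC⟩ := mem_iUnion₂.1 htsm
  obtain ⟨he1, d, hd1, hde⟩ := heE
  have htspos : 0 < ts := by
    rcases hts0.lt_or_eq with h | h
    · exact h
    · exfalso
      refine ex1 (hd1.mono (inter_subset_inter_right _ subset_union_left)) hde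
        ⟨z, ?_, left_mem_segment ℝ z u⟩
      have : g ts = z := by rw [← h]; simp [g]
      rw [← this]; exact heC
  let K : Set ℂ := segment ℝ z u ∪ g '' Ico 0 ts
  have hgK : ∀ t, 0 ≤ t → t < ts → g t ∈ K := fun t h0 h1 => Or.inr ⟨t, ⟨h0, h1⟩, rfl⟩
  have hKS : K ⊆ segment ℝ z u ∪ segment ℝ z v := by
    refine union_subset_union_right _ ?_
    rintro _ ⟨t, ⟨h0, h1⟩, rfl⟩
    exact hgseg h0 (h1.le.trans hts1)
  have hKr : K ⊆ Metric.closedBall z r := hKS.trans hSr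
  refine ⟨K, ?_, Or.inl (left_mem_segment ℝ z u), hKr, ?_, ?_⟩
  · rw [starConvex_iff_segment_subset]
    rintro y (hy | ⟨t, ⟨h0, h1⟩, rfl⟩)
    · exact ((convex_segment z u).segment_subset (left_mem_segment ℝ z u) hy).trans subset_union_left
    · rw [segment_eq_image']
      rintro _ ⟨θ, ⟨hθ0, hθ1⟩, rfl⟩
      have : z + θ • (g t - z) = g (θ * t) := by
        simp only [g, add_sub_cancel_left, smul_smul]
      change z + θ • (g t - z) ∈ K
      rw [this]
      exact hgK _ (by positivity) (by nlinarith)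
  · rintro a ⟨d', had, hdK⟩ ⟨e', hae, heK⟩
    have hrel : BRel F G.C d' e' := ⟨a, had, hae⟩
    have hdS := hdK.mono (inter_subset_inter_right (G.C d') hKS)
    have heS := heK.mono (inter_subset_inter_right (G.C e') hKS)
    have n1 := ex1 hdS hrel
    have n2 := ex2 heS hrel
    obtain ⟨x, hx1, hx2 | ⟨t, ⟨h0, h1⟩, rfl⟩⟩ := heK
    · exact n1 ⟨x, hx1, hx2⟩
    · have hdA : (G.C d' ∩ segment ℝ z u).Nonempty := by
        obtain ⟨y, hy1, hy2 | hy2⟩ := hdS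
        · exact ⟨y, hy1, hy2⟩
        · exact absurd ⟨y, hy1, hy2⟩ n2
      have : t ∈ Ts := ⟨⟨h0, h1.le.trans hts1⟩, mem_iUnion₂.2 ⟨e', ⟨⟨g t, hx1,
        hgseg h0 (h1.le.trans hts1)⟩, d', hdA, hrel⟩, hx1⟩⟩
      exact absurd (hleast this) (not_le.2 h1)
  · obtain ⟨x, hx1, hx2⟩ := hde
    refine ⟨x, Grid.sub_U (hd1.mono (inter_subset_inter_right _ subset_union_left)) hx1, e, hx2,
      g ts, heC, ?_⟩
    have hcl : IsClosed (G.U K) := (Grid.U_compact hKr).isClosed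
    rw [← hcl.closure_eq]
    refine map_mem_closure hg (s := Ico 0 ts) ?_ fun t ht =>
      interior_subset (Grid.K_sub_int (hgK t ht.1 ht.2))
    rw [closure_Ico htspos.ne]
    exact ⟨htspos.le, le_rfl⟩

end PB

open Filter Set Topology MeasureTheory

namespace PB

def gridCell (θ : ℝ) (n : ℤ → ℕ) (t : ℤ × ℤ × ℤ) : Set ℂ :=
  Icc (θ + t.2.1 / n t.1) (θ + (t.2.1 + 1) / n t.1) ×ℂ Icc (θ + t.2.2 / n t.1) (θ + (t.2.2 + 1) / n t.1)

theorem mem_gridCell {θ : ℝ} {n : ℤ → ℕ} {k i j : ℤ} (hn : 0 < (n k : ℝ)) {z : ℂ} :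
    z ∈ gridCell θ n (k, i, j) ↔ ((i : ℝ) ≤ n k * (z.re - θ) ∧ n k * (z.re - θ) ≤ i + 1) ∧
      ((j : ℝ) ≤ n k * (z.im - θ) ∧ n k * (z.im - θ) ≤ j + 1) := by
  simp only [gridCell, Complex.mem_reProdIm, mem_Icc]
  have e1 : ∀ a x : ℝ, θ + a / n k ≤ x ↔ a ≤ n k * (x - θ) := fun a x => by
    rw [← le_sub_iff_add_le', div_le_iff₀' hn]
  have e2 : ∀ a x : ℝ, x ≤ θ + a / n k ↔ n k * (x - θ) ≤ a := fun a x => by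
    rw [← sub_le_iff_le_add', le_div_iff₀' hn]
  rw [e1, e2, e1, e2]

theorem mem_int_gridCell {θ : ℝ} {n : ℤ → ℕ} {k i j : ℤ} (hn : 0 < (n k : ℝ)) {z : ℂ} :
    z ∈ interior (gridCell θ n (k, i, j)) ↔
      ((i : ℝ) < n k * (z.re - θ) ∧ n k * (z.re - θ) < i + 1) ∧
      ((j : ℝ) < n k * (z.im - θ) ∧ n k * (z.im - θ) < j + 1) := by
  simp only [gridCell, Complex.interior_reProdIm, interior_Icc, Complex.mem_reProdIm, mem_Ioo]
  have e1 : ∀ a x : ℝ, θ + a / n k < x ↔ a < n k * (x - θ) := fun a x => by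
    rw [← lt_sub_iff_add_lt', div_lt_iff₀' hn]
  have e2 : ∀ a x : ℝ, x < θ + a / n k ↔ n k * (x - θ) < a := fun a x => by
    rw [← sub_lt_iff_lt_add', lt_div_iff₀' hn]
  rw [e1, e2, e1, e2]

theorem grid_exists (δ : ℕ → ℝ) (hδ : ∀ k, 0 < δ k) (z1 z2 : ℂ) :
    ∃ (ι : Type) (G : Grid ι),
      (∀ c, ∀ x ∈ G.C c, ∀ y ∈ G.C c, ‖x - y‖ ≤ δ ⌈|x.im|⌉₊) ∧
      (∃ c, z1 ∈ interior (G.C c)) ∧ (∃ c, z2 ∈ interior (G.C c)) := by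
  have hn : ∀ k : ℤ, ∃ n : ℕ, 0 < n ∧ ∀ i ∈ Finset.range (k.natAbs + 4), 2 / (n : ℝ) ≤ δ i := by
    intro k
    have h1 : ∀ᶠ n : ℕ in atTop, ∀ i ∈ Finset.range (k.natAbs + 4), 2 / (n : ℝ) ≤ δ i := by
      rw [Finset.eventually_all]
      intro i _
      exact (tendsto_const_div_atTop_nhds_zero_nat 2).eventually (Iic_mem_nhds (hδ i))
    obtain ⟨n, h2, h3⟩ := (h1.and (eventually_gt_atTop 0)).exists
    exact ⟨n, h3, h2⟩
  choose n hn0 hnδ using hn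
  have hnR : ∀ k, 0 < (n k : ℝ) := fun k => by exact_mod_cast hn0 k
  obtain ⟨θ, ⟨hθ0, hθ1⟩, hθ⟩ : ∃ θ ∈ Ioo (0:ℝ) 1, ∀ r : ℚ, z1.re - θ ≠ r ∧ z1.im - θ ≠ r ∧
      z2.re - θ ≠ r ∧ z2.im - θ ≠ r := by
    let s : Set ℝ := ⋃ r : ℚ, {z1.re - r, z1.im - r, z2.re - r, z2.im - r}
    have hs : s.Countable := countable_iUnion fun r => (Set.toFinite _).countable
    obtain ⟨θ, h1, h2⟩ := (hs.dense_compl ℝ).exists_mem_open isOpen_Ioo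
      (nonempty_Ioo.2 (zero_lt_one (α := ℝ)))
    refine ⟨θ, h2, fun r => ?_⟩
    have h3 : ¬ _ := fun h => h1 (mem_iUnion.2 ⟨r, h⟩)
    simp only [mem_insert_iff, mem_singleton_iff, not_or] at h3
    obtain ⟨a, b, c, d⟩ := h3
    refine ⟨fun h => a ?_, fun h => b ?_, fun h => c ?_, fun h => d ?_⟩ <;> linarith
  let ι := {t : ℤ × ℤ × ℤ // t.1 * n t.1 ≤ t.2.2 ∧ t.2.2 < (t.1 + 1) * n t.1}
  let C : ι → Set ℂ := fun t => gridCell θ n t.1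
  have hcov : ∀ x : ℂ, ∃ h, x ∈ gridCell θ n (⟨(⌊x.im - θ⌋, ⌊n ⌊x.im - θ⌋ * (x.re - θ)⌋,
      ⌊n ⌊x.im - θ⌋ * (x.im - θ)⌋), h⟩ : ι).1 := by
    intro x
    have hk1 := Int.floor_le (x.im - θ)
    have hk2 := Int.lt_floor_add_one (x.im - θ)
    set k := ⌊x.im - θ⌋ with hk
    refine ⟨⟨?_, ?_⟩, ?_⟩
    · rw [Int.le_floor]; push_cast; nlinarith [hnR k]
    · rw [Int.floor_lt]; push_cast; nlinarith [hnR k]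
    · exact (mem_gridCell (hnR k)).2 ⟨⟨Int.floor_le _, (Int.lt_floor_add_one _).le⟩,
        ⟨Int.floor_le _, (Int.lt_floor_add_one _).le⟩⟩
  have hrow : ∀ (c : ι) (x : ℂ), x ∈ C c → (c.1.1 : ℝ) ≤ x.im - θ ∧ x.im - θ ≤ c.1.1 + 1 := by
    rintro ⟨⟨k, i, j⟩, h1, h2⟩ x hx
    obtain ⟨-, h3, h4⟩ := (mem_gridCell (hnR k)).1 hx
    simp only at h1 h2 ⊢
    have h1' : (k : ℝ) * n k ≤ j := by exact_mod_cast h1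
    have h2' : (j : ℝ) + 1 ≤ (k + 1) * n k := by exact_mod_cast h2
    constructor
    · nlinarith [hnR k]
    · nlinarith [hnR k]
  let T : Equiv.Perm ι :=
    { toFun := fun t => ⟨(t.1.1, t.1.2.1 + n t.1.1, t.1.2.2), t.2⟩
      invFun := fun t => ⟨(t.1.1, t.1.2.1 - n t.1.1, t.1.2.2), t.2⟩
      left_inv := by rintro ⟨⟨k, i, j⟩, h⟩; simp
      right_inv := by rintro ⟨⟨k, i, j⟩, h⟩; simp }
  have hlf : LocallyFinite C := by
    intro x
    refine ⟨Metric.ball x 1, Metric.ball_mem_nhds x one_pos, ?_⟩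
    have hbig : (⋃ k ∈ Icc ⌊x.im - θ - 3⌋ ⌈x.im - θ + 3⌉, ({k} : Set ℤ) ×ˢ
      (Icc ⌊n k * (x.re - θ - 1) - 1⌋ ⌈n k * (x.re - θ + 1)⌉ ×ˢ
       Icc ⌊n k * (x.im - θ - 1) - 1⌋ ⌈n k * (x.im - θ + 1)⌉)).Finite :=
      (finite_Icc _ _).biUnion fun k _ => (finite_singleton k).prod
        ((finite_Icc _ _).prod (finite_Icc _ _))
    refine (hbig.preimage (f := (Subtype.val : ι → ℤ × ℤ × ℤ))
      Subtype.val_injective.injOn).subset ?_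
    rintro c ⟨y, hy1, hy2⟩
    have hr := hrow c y hy1
    rw [mem_ball_iff_norm] at hy2
    have hre : |(y - x).re| < 1 := (Complex.abs_re_le_norm _).trans_lt hy2
    have him : |(y - x).im| < 1 := (Complex.abs_im_le_norm _).trans_lt hy2
    rw [abs_lt, Complex.sub_re] at hre
    rw [abs_lt, Complex.sub_im] at him
    obtain ⟨⟨k, i, j⟩, h1, h2⟩ := c
    obtain ⟨⟨h3, h4⟩, h5, h6⟩ := (mem_gridCell (hnR k)).1 hy1
    simp only at hr
    refine mem_iUnion₂.2 ⟨k, ⟨?_, ?_⟩, rfl, ⟨?_, ?_⟩, ?_, ?_⟩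
    · exact Int.cast_le (R := ℝ).1 ((Int.floor_le _).trans (by linarith))
    · exact Int.cast_le (R := ℝ).1 (le_trans (by linarith) (Int.le_ceil _))
    · exact Int.cast_le (R := ℝ).1 ((Int.floor_le _).trans (by simp only; nlinarith [hnR k]))
    · exact Int.cast_le (R := ℝ).1 (le_trans (by simp only; nlinarith [hnR k]) (Int.le_ceil _))
    · exact Int.cast_le (R := ℝ).1 ((Int.floor_le _).trans (by simp only; nlinarith [hnR k]))
    · exact Int.cast_le (R := ℝ).1 (le_trans (by simp only; nlinarith [hnR k]) (Int.le_ceil _))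
  have hlt : ∀ (t : ℤ × ℤ × ℤ) (a : ℤ), θ + a / n t.1 < θ + (a + 1) / n t.1 := by
    intro t a
    have := div_lt_div_of_pos_right (lt_add_one (a : ℝ)) (hnR t.1)
    linarith
  let G : Grid ι :=
    { C := C
      T := T
      lf := hlf
      cov := fun x => ⟨_, (hcov x).2⟩
      cpt := fun c => isCompact_Icc.reProdIm isCompact_Icc
      cvx := fun c => by
        rw [convex_iff_segment_subset]
        intro x hx y hy
        rw [segment_eq_image]
        rintro _ ⟨t, ⟨ht0, ht1⟩, rfl⟩
        have h1 : ∀ {s : Set ℝ}, Convex ℝ s → ∀ {a b : ℝ}, a ∈ s → b ∈ s →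
            (1 - t) * a + t * b ∈ s := fun hs a b ha hb => by
          simpa using hs ha hb (sub_nonneg.2 ht1) ht0 (by ring)
        refine ⟨?_, ?_⟩
        · simpa using h1 (convex_Icc _ _) hx.1 hy.1
        · simpa using h1 (convex_Icc _ _) hx.2 hy.2
      ne := fun c => Complex.reProdIm_nonempty.2 ⟨nonempty_Icc.2 (hlt c.1 _).le,
        nonempty_Icc.2 (hlt c.1 _).le⟩
      cl := fun c => by
        simp only [C, gridCell, Complex.interior_reProdIm, interior_Icc, Complex.closure_reProdIm]
        rw [closure_Ioo (hlt c.1 _).ne, closure_Ioo (hlt c.1 _).ne]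
      disj := by
        intro c d hcd
        rw [Set.disjoint_left]
        intro x hx hy
        apply hcd
        have h1 := hrow c x (interior_subset hx)
        obtain ⟨⟨k, i, j⟩, hc1, hc2⟩ := c
        obtain ⟨⟨k', i', j'⟩, hd1, hd2⟩ := d
        have u1 := (mem_int_gridCell (hnR k)).1 hx
        have u2 := (mem_int_gridCell (hnR k')).1 hy
        simp only at hc1 hc2 hd1 hd2 h1
        have e1 : ∀ {k j : ℤ}, k * n k ≤ j → j < (k + 1) * n k → (j : ℝ) < n k * (x.im - θ) →
            n k * (x.im - θ) < j + 1 → k = ⌊x.im - θ⌋ := by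
          intro k j h1 h2 h3 h4
          symm
          rw [Int.floor_eq_iff]
          have h1' : (k : ℝ) * n k ≤ j := by exact_mod_cast h1
          have h2' : (j : ℝ) + 1 ≤ (k + 1) * n k := by exact_mod_cast h2
          constructor
          · nlinarith [hnR k]
          · nlinarith [hnR k]
        have hkk : k = k' := (e1 hc1 hc2 u1.2.1 u1.2.2).trans (e1 hd1 hd2 u2.2.1 u2.2.2).symm
        subst hkk
        have e2 : ∀ {i i' : ℤ} {X : ℝ}, (i : ℝ) < X → X < i + 1 → (i' : ℝ) < X → X < i' + 1 →
            i = i' := by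
          intro i i' X a b c d
          exact (Int.floor_eq_iff.2 ⟨a.le, b⟩).symm.trans (Int.floor_eq_iff.2 ⟨c.le, d⟩)
        have hi := e2 u1.1.1 u1.1.2 u2.1.1 u2.1.2
        have hj := e2 u1.2.1 u1.2.2 u2.2.1 u2.2.2
        subst hi; subst hj; rfl
      CT := by
        rintro ⟨⟨k, i, j⟩, hc⟩ z
        change z + 1 ∈ gridCell θ n (k, i + n k, j) ↔ z ∈ gridCell θ n (k, i, j)
        rw [mem_gridCell (hnR k), mem_gridCell (hnR k)]
        simp only [Complex.add_re, Complex.one_re, Complex.add_im, Complex.one_im, add_zero]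
        push_cast
        constructor
        · rintro ⟨⟨a, b⟩, c, d⟩; exact ⟨⟨by linarith, by linarith⟩, c, d⟩
        · rintro ⟨⟨a, b⟩, c, d⟩; exact ⟨⟨by linarith, by linarith⟩, c, d⟩ }
  have hgen : ∀ x : ℂ, (∀ r : ℚ, x.re - θ ≠ r ∧ x.im - θ ≠ r) → ∃ c, x ∈ interior (G.C c) := by
    intro x hx
    obtain ⟨h, hxc⟩ := hcov x
    refine ⟨⟨_, h⟩, ?_⟩
    change x ∈ interior (gridCell θ n _)
    set k := ⌊x.im - θ⌋
    obtain ⟨⟨h3, h4⟩, h5, h6⟩ := (mem_gridCell (hnR k)).1 hxc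
    have hne : ∀ a : ℤ, (a : ℝ) ≠ n k * (x.re - θ) ∧ (a : ℝ) ≠ n k * (x.im - θ) := by
      intro a
      have := hx ((a : ℚ) / n k)
      push_cast at this
      have hnk := (hnR k).ne'
      constructor
      · intro h; apply this.1; rw [h]; field_simp
      · intro h; apply this.2; rw [h]; field_simp
    rw [mem_int_gridCell (hnR k)]
    refine ⟨⟨h3.lt_of_ne (hne _).1, h4.lt_of_ne ?_⟩, h5.lt_of_ne (hne _).2, h6.lt_of_ne ?_⟩
    · have := (hne (⌊n k * (x.re - θ)⌋ + 1)).1; push_cast at this; exact this.symm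
    · have := (hne (⌊n k * (x.im - θ)⌋ + 1)).2; push_cast at this; exact this.symm
  refine ⟨ι, G, ?_, hgen z1 fun r => ⟨(hθ r).1, (hθ r).2.1⟩,
    hgen z2 fun r => ⟨(hθ r).2.2.1, (hθ r).2.2.2⟩⟩
  intro c x hx y hy
  have hr := hrow c x hx
  obtain ⟨⟨k, i, j⟩, hc1, hc2⟩ := c
  obtain ⟨⟨h3, h4⟩, h5, h6⟩ := (mem_gridCell (hnR k)).1 hx
  obtain ⟨⟨h3', h4'⟩, h5', h6'⟩ := (mem_gridCell (hnR k)).1 hy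
  simp only at hr
  have hk := hnδ k ⌈|x.im|⌉₊ (by
    have h7 : ((k.natAbs : ℕ) : ℝ) = |(k : ℝ)| := by rw [Nat.cast_natAbs, Int.cast_abs]
    have h8 : ⌈|x.im|⌉₊ ≤ k.natAbs + 3 := by
      rw [Nat.ceil_le]
      push_cast
      rw [h7, abs_le]
      constructor
      · linarith [neg_abs_le (k : ℝ)]
      · linarith [le_abs_self (k : ℝ)]
    exact Finset.mem_range.2 (by lia))
  refine le_trans ?_ hk
  refine (Complex.norm_le_abs_re_add_abs_im _).trans ?_
  have e : ∀ {a b : ℝ}, n k * a ≤ n k * b + 1 → n k * b ≤ n k * a + 1 → |a - b| ≤ 1 / n k := by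
    intro a b h1 h2
    have h3 : |(a - b) * n k| ≤ 1 := by rw [abs_le]; constructor <;> nlinarith
    rwa [abs_mul, abs_of_pos (hnR k), ← le_div_iff₀ (hnR k)] at h3
  have e1 := e (a := x.re) (b := y.re) (by nlinarith) (by nlinarith)
  have e2 := e (a := x.im) (b := y.im) (by nlinarith) (by nlinarith)
  rw [Complex.sub_re, Complex.sub_im]
  calc _ ≤ 1 / (n k : ℝ) + 1 / n k := add_le_add e1 e2
    _ = _ := by ring

end PB

open Filter Set Topology MeasureTheory

namespace PB

theorem comm_int {Φ : ℂ → ℂ} (h : ∀ z, Φ (z + 1) = Φ z + 1) (m : ℤ) (z : ℂ) :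
    Φ (z + m) = Φ z + m := by
  induction m using Int.induction_on generalizing z with
  | zero => simp
  | succ i ih =>
    push_cast at ih ⊢
    rw [← add_assoc, h, ih, add_assoc]
  | pred i ih =>
    push_cast at ih ⊢
    have := h (z + (-(i:ℂ) - 1))
    rw [show z + (-(i:ℂ) - 1) + 1 = z + -(i:ℂ) by ring, ih] at this
    rw [← sub_eq_iff_eq_add] at this
    rw [← this]; ring

theorem comm_iter {Φ : ℂ → ℂ} (h : ∀ z, Φ (z + 1) = Φ z + 1) (n : ℕ) (z : ℂ) :
    Φ^[n] (z + 1) = Φ^[n] z + 1 := by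
  induction n generalizing z with
  | zero => simp
  | succ n ih => rw [Function.iterate_succ_apply, h, ih, Function.iterate_succ_apply]

namespace Grid
variable {ι : Type} (G : Grid ι)

theorem CTz (n : ℤ) (c : ι) (z : ℂ) : z + n ∈ G.C ((G.T ^ n) c) ↔ z ∈ G.C c := by
  induction n using Int.induction_on generalizing z with
  | zero => simp
  | succ i ih =>
    rw [add_comm (i : ℤ) 1, zpow_add, zpow_one, Equiv.Perm.mul_apply]
    push_cast at ih ⊢
    rw [add_comm (1:ℂ), ← add_assoc, G.CT, ih]
  | pred i ih =>
    rw [← ih]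
    have : G.T ^ (-(i:ℤ)) = G.T * G.T ^ (-(i:ℤ) - 1) := by rw [← zpow_one_add]; congr 1; ring
    rw [this, Equiv.Perm.mul_apply, ← G.CT]
    push_cast
    rw [show z + (-(i:ℂ) - 1) + 1 = z + -(i:ℂ) by ring]

theorem CTz' (n : ℤ) (c : ι) (z : ℂ) : z ∈ G.C ((G.T ^ n) c) ↔ z - n ∈ G.C c := by
  rw [← G.CTz n c]; simp

variable {G}

theorem U_trans (n : ℤ) (K : Set ℂ) (x : ℂ) : x ∈ G.U {y | y - n ∈ K} ↔ x - n ∈ G.U K := by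
  constructor
  · rintro ⟨c, h1, y, h2, h3⟩
    refine ⟨(G.T ^ (-n)) c, ?_, y - n, ?_, h3⟩
    · rw [G.CTz']; simpa using h1
    · rw [G.CTz']; simpa using h2
  · rintro ⟨c, h1, y, h2, h3⟩
    refine ⟨(G.T ^ n) c, ?_, y + n, ?_, by simpa using h3⟩
    · rwa [G.CTz']
    · rwa [G.CTz]

variable (G)

def Bset (K : ℤ → Set ℂ) (c : ι) : Set ℂ :=
  {x | x ∈ G.C c ∨ ∃ j, (G.C c ∩ K j).Nonempty ∧ x ∈ G.U (K j)}

variable {G}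

theorem C_sub_Bset {K : ℤ → Set ℂ} {c : ι} : G.C c ⊆ G.Bset K c := fun _ h => Or.inl h

theorem Bset_meet {K : ℤ → Set ℂ} (hd : ∀ i j, i ≠ j → Disjoint (G.U (K i)) (G.U (K j)))
    {c : ι} {j : ℤ} (h : (G.C c ∩ K j).Nonempty) : G.Bset K c = G.U (K j) := by
  ext x
  constructor
  · rintro (h1 | ⟨i, h1, h2⟩)
    · exact sub_U h h1
    · rcases eq_or_ne i j with rfl | hij
      · exact h2
      · obtain ⟨y, hy⟩ := G.ne c
        exact (Set.disjoint_left.1 (hd i j hij) (sub_U h1 hy) (sub_U h hy)).elim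
  · intro hx
    exact Or.inr ⟨j, h, hx⟩

theorem Bset_not {K : ℤ → Set ℂ} {c : ι} (h : ∀ j, ¬ (G.C c ∩ K j).Nonempty) :
    G.Bset K c = G.C c := by
  ext x
  constructor
  · rintro (h1 | ⟨i, h1, h2⟩)
    · exact h1
    · exact (h i h1).elim
  · exact Or.inl

theorem Bset_cases {K : ℤ → Set ℂ} (hd : ∀ i j, i ≠ j → Disjoint (G.U (K i)) (G.U (K j)))
    (c : ι) : (∃ j, (G.C c ∩ K j).Nonempty ∧ G.Bset K c = G.U (K j)) ∨
      ((∀ j, ¬ (G.C c ∩ K j).Nonempty) ∧ G.Bset K c = G.C c) := by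
  by_cases h : ∃ j, (G.C c ∩ K j).Nonempty
  · obtain ⟨j, hj⟩ := h
    exact Or.inl ⟨j, hj, Bset_meet hd hj⟩
  · push Not at h
    have h' : ∀ j, ¬ (G.C c ∩ K j).Nonempty := fun j => by rw [h j]; simp
    exact Or.inr ⟨h', Bset_not h'⟩

noncomputable def bricks (G : Grid ι) (K : ℤ → Set ℂ) (zc : ℤ → ℂ)
    (hs : ∀ j, StarConvex ℝ (zc j) (K j)) 
    (hd : ∀ i j, i ≠ j → Disjoint (G.U (K i)) (G.U (K j))) (N : ℤ) (N' : ℝ) (hNN : N' = N)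
    (hshift : ∀ j, K (j + 4) = {y : ℂ | y - N ∈ K j}) : BrickSys N' ι where
  C := G.C
  B := G.Bset K
  S := G.T ^ N
  lf := G.lf
  cov := G.cov
  closedC c := (G.cpt c).isClosed
  CB c := C_sub_Bset
  Bcell := by
    intro c x hx
    rcases Bset_cases hd c with ⟨j, h1, h2⟩ | ⟨h1, h2⟩
    · rw [h2] at hx
      obtain ⟨d, h3, h4⟩ := hx
      exact ⟨d, h3, by rw [h2, Bset_meet hd h4]⟩
    · rw [h2] at hx
      exact ⟨c, hx, rfl⟩
  Bne c := (G.ne c).mono C_sub_Bset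
  Bjoin := by
    intro c x hx y hy
    rcases Bset_cases hd c with ⟨j, h1, h2⟩ | ⟨h1, h2⟩
    · rw [h2] at hx hy ⊢
      exact U_joined (hs j) hx hy
    · rw [h2] at hx hy ⊢
      exact joined_segment ((G.cvx c).segment_subset hx hy)
  BS := by
    intro c z
    subst hNN
    have e1 : (((N : ℝ)) : ℂ) = (N : ℂ) := by push_cast; rfl
    rw [e1]
    have hm : ∀ j, (G.C ((G.T ^ N) c) ∩ K (j + 4)).Nonempty ↔ (G.C c ∩ K j).Nonempty := by
      intro j
      rw [hshift]
      constructor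
      · rintro ⟨y, h1, h2⟩
        exact ⟨y - N, (G.CTz' _ _ _).1 h1, h2⟩
      · rintro ⟨y, h1, h2⟩
        exact ⟨y + N, (G.CTz _ _ _).2 h1, by simpa using h2⟩
    simp only [Bset, mem_ofPred_eq]
    rw [G.CTz]
    refine or_congr Iff.rfl ?_
    constructor
    · rintro ⟨j, h1, h2⟩
      have hj : j = (j - 4) + 4 := by ring
      rw [hj] at h1 h2
      refine ⟨j - 4, (hm _).1 h1, ?_⟩
      rw [hshift, U_trans] at h2
      simpa using h2
    · rintro ⟨j, h1, h2⟩
      refine ⟨j + 4, (hm _).2 h1, ?_⟩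
      rw [hshift, U_trans]
      simpa using h2

theorem orbit_reach {Φ : ℂ → ℂ} {B : ι → Set ℂ} (hB : ∀ c, G.C c ⊆ B c) (n : ℕ) :
    ∀ {c d : ι} {w : ℂ}, w ∈ G.C c → Φ^[n + 1] w ∈ G.C d → Relation.TransGen (BRel Φ B) c d := by
  induction n with
  | zero => 
    intro c d w h1 h2
    exact Relation.TransGen.single ⟨w, hB _ h1, hB _ h2⟩
  | succ n ih =>
    intro c d w h1 h2
    obtain ⟨e, he⟩ := G.cov (Φ w)
    rw [Function.iterate_succ_apply] at h2
    exact Relation.TransGen.head ⟨w, hB _ h1, hB _ he⟩ (ih he h2)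

end Grid

end PB

open Filter Set Topology MeasureTheory

namespace PB

def Ends (O : Set ℂ) : Prop := ∃ s : ℝ, (s = 1 ∨ s = -1) ∧ ∃ M : ℝ,
  (∀ z : ℂ, M ≤ s * z.im → z ∈ O) ∧ (∀ z : ℂ, s * z.im ≤ -M → z ∉ O)

theorem bricks_final {ι : Type} (G : Grid ι) {Φ : ℂ ≃ₜ ℂ} (hcomm : ∀ z, Φ (z + 1) = Φ z + 1)
    (hOP : OP Φ) (hfpf : ∀ z, Φ z ≠ z) (hfreeC : ∀ c, Free Φ (G.C c))
    (K : ℤ → Set ℂ) (zc : ℤ → ℂ) (hK4 : ∀ j, K (j + 4) = K j)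
    (hs : ∀ j, StarConvex ℝ (zc j) (K j)) (hz : ∀ j, zc j ∈ K j)
    (hfree : ∀ j, Free Φ (G.U (K j))) (M : ℝ) (hM : ∀ j, ∀ x ∈ G.U (K j), ‖x‖ ≤ M)
    (hcpt : ∀ j, IsCompact (G.U (K j)))
    {z1 z2 : ℂ} {c1 c2 : ι} (hz1 : z1 ∈ interior (G.C c1)) (hz2 : z2 ∈ interior (G.C c2))
    (hzc0 : zc 0 = z1) (hzc1 : zc 1 = z1) (hzc2 : zc 2 = z2) (hzc3 : zc 3 = z2)
    (hs0 : ∃ x ∈ G.U (K 0), ∃ e, Φ x ∈ G.C e ∧ (G.C e ∩ G.U (K 0)).Nonempty)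
    (hp1 : ∃ x ∈ G.U (K 1), ∃ e, Φ.symm x ∈ G.C e ∧ (G.C e ∩ G.U (K 1)).Nonempty)
    (hs2 : ∃ x ∈ G.U (K 2), ∃ e, Φ x ∈ G.C e ∧ (G.C e ∩ G.U (K 2)).Nonempty)
    (hp3 : ∃ x ∈ G.U (K 3), ∃ e, Φ.symm x ∈ G.C e ∧ (G.C e ∩ G.U (K 3)).Nonempty)
    (hr1 : ∀ U ∈ 𝓝 z1, ∃ w ∈ U, ∃ n : ℕ, ∃ a : ℕ, 1 ≤ n ∧ 1 ≤ a ∧ Φ^[n] w + a ∈ U)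
    (hr2 : ∀ U ∈ 𝓝 z2, ∃ w ∈ U, ∃ n : ℕ, ∃ a : ℕ, 1 ≤ n ∧ 1 ≤ a ∧ Φ^[n] w - a ∈ U) :
    ∃ N : ℕ, 0 < N ∧ ∃ O : Set ℂ, IsOpen O ∧ (∀ z : ℂ, z + N ∈ O ↔ z ∈ O) ∧
      (∀ z ∈ closure O, Φ.symm z ∈ O) ∧ Ends O := by
  obtain ⟨w1, hw1, n1, a, hn1, ha, hwa⟩ := hr1 _ (mem_interior_iff_mem_nhds.1 hz1)
  obtain ⟨w2, hw2, n2, b, hn2, hb, hwb⟩ := hr2 _ (mem_interior_iff_mem_nhds.1 hz2)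
  obtain ⟨L, hL⟩ := exists_nat_gt (max 1 (2 * M))
  have hL1 : 1 ≤ L := by
    have : (1:ℝ) < L := (le_max_left _ _).trans_lt hL
    exact_mod_cast this.le
  have hLM : 2 * M < L := (le_max_right _ _).trans_lt hL
  set P : ℕ := a * b * L with hP
  have hab : 1 ≤ a * b := Nat.mul_pos ha hb
  have hPL : L ≤ P := by rw [hP]; exact Nat.le_mul_of_pos_left L hab
  have hP1 : 1 ≤ P := hL1.trans hPL
  have hPM : 2 * M < P := hLM.trans_le (by exact_mod_cast hPL)
  -- translated family
  let K' : ℤ → Set ℂ := fun j => {y : ℂ | y - ((j * P : ℤ) : ℂ) ∈ K j}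
  have hUK' : ∀ j x, x ∈ G.U (K' j) ↔ x - ((j * P : ℤ) : ℂ) ∈ G.U (K j) := fun j x =>
    Grid.U_trans _ _ _
  have hd : ∀ i j, i ≠ j → Disjoint (G.U (K' i)) (G.U (K' j)) := by
    intro i j hij
    rw [Set.disjoint_left]
    intro x h1 h2
    have e1 := hM i _ ((hUK' _ _).1 h1)
    have e2 := hM j _ ((hUK' _ _).1 h2)
    have e3 : ‖((((j - i) * P : ℤ) : ℝ) : ℂ)‖ ≤ 2 * M := by
      calc _ = ‖(x - ((i * P : ℤ) : ℂ)) - (x - ((j * P : ℤ) : ℂ))‖ := by congr 1; push_cast; ring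
        _ ≤ _ := norm_sub_le _ _
        _ ≤ _ := by linarith
    rw [Complex.norm_real, Real.norm_eq_abs] at e3
    have e4 : (1:ℝ) ≤ |((j - i : ℤ) : ℝ)| := by
      rw [← Int.cast_abs]
      exact_mod_cast Int.one_le_abs (sub_ne_zero.2 hij.symm)
    push_cast at e3 e4
    rw [abs_mul, Nat.abs_cast] at e3
    nlinarith
  have hshift : ∀ j, K' (j + 4) = {y : ℂ | y - ((4 * P : ℤ) : ℂ) ∈ K' j} := by
    intro j
    ext y
    change y - (((j + 4) * P : ℤ) : ℂ) ∈ K (j + 4) ↔ y - ((4 * P : ℤ) : ℂ) - ((j * P : ℤ) : ℂ) ∈ K j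
    rw [hK4]
    have : y - (((j + 4) * P : ℤ) : ℂ) = y - ((4 * P : ℤ) : ℂ) - ((j * P : ℤ) : ℂ) := by
      push_cast; ring
    rw [this]
  have hs' : ∀ j, StarConvex ℝ (zc j + ((j * P : ℤ) : ℂ)) (K' j) := by
    intro j
    rw [starConvex_iff_segment_subset]
    intro y hy w hw
    have h1 := starConvex_iff_segment_subset.1 (hs j) hy
    apply h1
    rw [segment_eq_image'] at hw ⊢
    obtain ⟨t, ht, rfl⟩ := hw
    refine ⟨t, ht, ?_⟩
    simp only [Complex.real_smul]
    ring
  have hz' : ∀ j, zc j + ((j * P : ℤ) : ℂ) ∈ K' j := fun j => by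
    change _ - _ ∈ K j; simpa using hz j
  let Nr : ℝ := ((4 * P : ℕ) : ℝ)
  have hNr : Nr = ((4 * P : ℤ) : ℝ) := by simp [Nr]
  let b' : BrickSys Nr ι := G.bricks K' _ hs' hd (4 * P) Nr hNr hshift
  have hB : b'.B = G.Bset K' := rfl
  have hS : b'.S = G.T ^ ((4 * P : ℕ) : ℤ) := rfl
  have hSz : ∀ (j : ℤ) c, (b'.S ^ j) c = (G.T ^ (P * (4 * j) : ℤ)) c := by
    intro j c; rw [hS, ← zpow_mul]; congr 2; push_cast; ring
  have hNc : ((Nr : ℝ) : ℂ) = ((4 * P : ℤ) : ℂ) := by rw [hNr]; push_cast; rfl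
  have hcommz := comm_int hcomm
  have hcommN : ∀ z : ℂ, Φ (z + Nr) = Φ z + Nr := fun z => by rw [hNc]; exact hcommz _ _
  have hfreeU : ∀ j, Free Φ (G.U (K' j)) := by
    intro j x h1 h2
    rw [hUK'] at h1 h2
    refine hfree j _ h1 ?_
    have := hcommz (-(j * P)) x
    push_cast at this h2 ⊢
    rw [sub_eq_add_neg, this, ← sub_eq_add_neg]
    exact h2
  have hcptU : ∀ j, IsCompact (G.U (K' j)) := by
    intro j
    have : G.U (K' j) = (fun x => x + ((j * P : ℤ) : ℂ)) '' G.U (K j) := by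
      ext x
      rw [hUK']
      constructor
      · intro h; exact ⟨_, h, by simp⟩
      · rintro ⟨y, hy, rfl⟩; simpa using hy
    rw [this]
    exact (hcpt j).image (by fun_prop)
  -- Franks
  have hfranks : ∀ c, ¬ Relation.TransGen (BRel Φ b'.B) c c := by
    intro c
    rw [hB]
    refine franks hOP hfpf (G.Bset K') ?_ ?_ ?_ ?_ ?_ c
    · intro d
      rcases Grid.Bset_cases hd d with ⟨j, h1, h2⟩ | ⟨h1, h2⟩ <;> rw [h2]
      · exact hcptU j
      · exact G.cpt d
    · intro d
      rcases Grid.Bset_cases hd d with ⟨j, h1, h2⟩ | ⟨h1, h2⟩ <;> rw [h2]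
      · exact Grid.U_cl
      · exact G.cl d
    · intro d
      rcases Grid.Bset_cases hd d with ⟨j, h1, h2⟩ | ⟨h1, h2⟩ <;> rw [h2]
      · exact Grid.U_int_conn (hs' j) (hz' j)
      · exact (G.cvx d).interior.isPreconnected
    · intro d e
      have aux : ∀ {d : ι} {j : ℤ}, (∀ j, ¬ (G.C d ∩ K' j).Nonempty) → 
          Disjoint (interior (G.C d)) (interior (G.U (K' j))) := by
        intro d j h1
        rw [Set.disjoint_left]
        intro x hx hx'
        obtain ⟨e, he, hej⟩ := interior_subset hx'
        have hne : d ≠ e := by rintro rfl; exact h1 _ hej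
        have h3 := G.cl e he
        rw [mem_closure_iff] at h3
        obtain ⟨y, hy1, hy2⟩ := h3 _ isOpen_interior hx
        exact Set.disjoint_left.1 (G.disj d e hne) hy1 hy2
      rcases Grid.Bset_cases hd d with ⟨j, h1, h2⟩ | ⟨h1, h2⟩ <;>
        rcases Grid.Bset_cases hd e with ⟨j', h1', h2'⟩ | ⟨h1', h2'⟩ <;> rw [h2, h2']
      · rcases eq_or_ne j j' with rfl | h
        · exact Or.inl rfl
        · exact Or.inr ((hd _ _ h).mono interior_subset interior_subset)
      · exact Or.inr (aux h1').symm
      · exact Or.inr (aux h1)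
      · rcases eq_or_ne d e with rfl | h
        · exact Or.inl rfl
        · exact Or.inr (G.disj _ _ h)
    · intro d
      rcases Grid.Bset_cases hd d with ⟨j, h1, h2⟩ | ⟨h1, h2⟩ <;> rw [h2]
      · exact hfreeU j
      · exact hfreeC d
  have hCB : ∀ c, G.C c ⊆ b'.B c := b'.CB
  -- drift
  have hitz : ∀ (n : ℕ) (m : ℤ) (z : ℂ), Φ^[n] (z + m) = Φ^[n] z + m := fun n =>
    comm_int (comm_iter hcomm n)
  have d1 : ∀ k : ℤ, Relation.TransGen (BRel Φ b'.B) ((G.T ^ k) c1) ((G.T ^ (k - a)) c1) := by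
    intro k
    obtain ⟨m, rfl⟩ : ∃ m, n1 = m + 1 := ⟨n1 - 1, by lia⟩
    refine Grid.orbit_reach hCB m (w := w1 + k) ((G.CTz _ _ _).2 hw1) ?_
    rw [hitz, G.CTz']
    convert hwa using 1
    push_cast; ring
  have d2 : ∀ k : ℤ, Relation.TransGen (BRel Φ b'.B) ((G.T ^ k) c2) ((G.T ^ (k + b)) c2) := by
    intro k
    obtain ⟨m, rfl⟩ : ∃ m, n2 = m + 1 := ⟨n2 - 1, by lia⟩
    refine Grid.orbit_reach hCB m (w := w2 + k) ((G.CTz _ _ _).2 hw2) ?_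
    rw [hitz, G.CTz']
    convert hwb using 1
    push_cast; ring
  have d1' : ∀ (t : ℕ) (k : ℤ),
      Relation.TransGen (BRel Φ b'.B) ((G.T ^ k) c1) ((G.T ^ (k - a * (t + 1))) c1) := by
    intro t
    induction t with
    | zero => intro k; simpa using d1 k
    | succ t ih =>
      intro k
      have := (ih k).trans (d1 _)
      convert this using 3
      push_cast; ring
  have d2' : ∀ (t : ℕ) (k : ℤ),
      Relation.TransGen (BRel Φ b'.B) ((G.T ^ k) c2) ((G.T ^ (k + b * (t + 1))) c2) := by
    intro t
    induction t with
    | zero => intro k; simpa using d2 k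
    | succ t ih =>
      intro k
      have := (ih k).trans (d2 _)
      convert this using 3
      push_cast; ring
  have D1 : ∀ i j : ℤ, j < i → Relation.TransGen (BRel Φ b'.B) ((G.T ^ (P * i : ℤ)) c1)
      ((G.T ^ (P * j : ℤ)) c1) := by
    intro i j hij
    have hpos : 0 < (b * L : ℤ) * (i - j) := by
      have h1 : (0:ℤ) < b := by exact_mod_cast hb
      have h2 : (0:ℤ) < L := by exact_mod_cast hL1
      have h3 : 0 < i - j := sub_pos.2 hij
      positivity
    obtain ⟨t, ht⟩ := Int.eq_ofNat_of_zero_le (Int.le_sub_one_of_lt hpos)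
    have := d1' t (P * i)
    convert this using 3
    have ht' : (t : ℤ) + 1 = b * L * (i - j) := by rw [← ht]; ring
    rw [ht', hP]; push_cast; ring
  have D2 : ∀ i j : ℤ, i < j → Relation.TransGen (BRel Φ b'.B) ((G.T ^ (P * i : ℤ)) c2)
      ((G.T ^ (P * j : ℤ)) c2) := by
    intro i j hij
    have hpos : 0 < (a * L : ℤ) * (j - i) := by
      have h1 : (0:ℤ) < a := by exact_mod_cast ha
      have h2 : (0:ℤ) < L := by exact_mod_cast hL1
      have h3 : 0 < j - i := sub_pos.2 hij
      positivity
    obtain ⟨t, ht⟩ := Int.eq_ofNat_of_zero_le (Int.le_sub_one_of_lt hpos)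
    have := d2' t (P * i)
    convert this using 3
    have ht' : (t : ℤ) + 1 = a * L * (j - i) := by rw [← ht]; ring
    rw [ht', hP]; push_cast; ring
  -- shift of reachability
  have hsh : ∀ (m : ℕ) {c d}, Relation.ReflTransGen (BRel Φ b'.B) c d →
      Relation.ReflTransGen (BRel Φ b'.B) ((b'.S ^ (m : ℤ)) c) ((b'.S ^ (m : ℤ)) d) := by
    intro m c d h
    induction m with
    | zero => simpa using h
    | succ m ih =>
      have := reach_shift hcommN ih
      push_cast
      rw [add_comm (m : ℤ) 1, zpow_add, zpow_one]
      exact this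
  have meets : ∀ (j : ℤ) (c : ι) (z : ℂ), z ∈ G.C c → zc j = z →
      G.Bset K' ((G.T ^ (P * j : ℤ)) c) = G.U (K' j) := by
    intro j c z hzc h
    refine Grid.Bset_meet hd ⟨_, ?_, hz' j⟩
    rw [G.CTz', h]
    convert hzc using 1
    push_cast; ring
  have hNpos : 0 < Nr := by
    have : 0 < 4 * P := by lia
    exact Nat.cast_pos.2 this
  have hintg := fun {c z} (h : z ∈ interior (G.C c)) => interior_subset h
  have succ_data : ∀ (j : ℤ) (c : ι) (z : ℂ), z ∈ G.C c → zc j = z →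
      (∃ x ∈ G.U (K j), ∃ e, Φ x ∈ G.C e ∧ (G.C e ∩ G.U (K j)).Nonempty) →
      ∃ d, BRel Φ b'.B ((G.T ^ (P * j : ℤ)) c) d ∧
        (b'.B d ∩ b'.B ((G.T ^ (P * j : ℤ)) c)).Nonempty := by
    rintro j c z hzc h ⟨x, hx, e, hxe, y, hy1, hy2⟩
    refine ⟨(G.T ^ (P * j : ℤ)) e, ⟨x + ((P * j : ℤ) : ℂ), ?_, ?_⟩, y + ((P * j : ℤ) : ℂ), ?_, ?_⟩
    · rw [hB, meets j c z hzc h, hUK']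
      convert hx using 1; push_cast; ring
    · rw [hcommz]; exact hCB _ ((G.CTz _ _ _).2 hxe)
    · exact hCB _ ((G.CTz _ _ _).2 hy1)
    · rw [hB, meets j c z hzc h, hUK']
      convert hy2 using 1; push_cast; ring
  have pred_data : ∀ (j : ℤ) (c : ι) (z : ℂ), z ∈ G.C c → zc j = z →
      (∃ x ∈ G.U (K j), ∃ e, Φ.symm x ∈ G.C e ∧ (G.C e ∩ G.U (K j)).Nonempty) →
      ∃ d, BRel Φ b'.B d ((G.T ^ (P * j : ℤ)) c) ∧
        (b'.B d ∩ b'.B ((G.T ^ (P * j : ℤ)) c)).Nonempty := by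
    rintro j c z hzc h ⟨x, hx, e, hxe, y, hy1, hy2⟩
    refine ⟨(G.T ^ (P * j : ℤ)) e, ⟨Φ.symm x + ((P * j : ℤ) : ℂ), ?_, ?_⟩,
      y + ((P * j : ℤ) : ℂ), ?_, ?_⟩
    · exact hCB _ ((G.CTz _ _ _).2 hxe)
    · rw [hcommz, Φ.apply_symm_apply, hB, meets j c z hzc h, hUK']
      convert hx using 1; push_cast; ring
    · exact hCB _ ((G.CTz _ _ _).2 hy1)
    · rw [hB, meets j c z hzc h, hUK']
      convert hy2 using 1; push_cast; ring
  have hSc : ∀ (i : ℤ) c, b'.S ((G.T ^ (P * i : ℤ)) c) = (G.T ^ (P * (i + 4) : ℤ)) c := by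
    intro i c
    rw [hS, ← Equiv.Perm.mul_apply, ← zpow_add]
    congr 2; push_cast; ring
  have hSc' : ∀ (i : ℤ) c, b'.S.symm ((G.T ^ (P * i : ℤ)) c) = (G.T ^ (P * (i - 4) : ℤ)) c := by
    intro i c
    rw [Equiv.symm_apply_eq, hSc]; congr 3; ring
  have hSzz : ∀ (j i : ℤ) c, (b'.S ^ j) ((G.T ^ (P * i : ℤ)) c) = (G.T ^ (P * (i + 4 * j) : ℤ)) c := by
    intro j i c
    rw [hSz, ← Equiv.Perm.mul_apply, ← zpow_add]; congr 2; ring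
  have fin : (∃ O : Set ℂ, IsOpen O ∧ (∀ z : ℂ, z + Nr ∈ O ↔ z ∈ O) ∧
      (∀ z ∈ closure O, Φ.symm z ∈ O) ∧ Ends O) := by
    by_cases h12 : ∃ i j : ℤ, Relation.ReflTransGen (BRel Φ b'.B) ((G.T ^ (P * i : ℤ)) c1)
        ((G.T ^ (P * j : ℤ)) c2)
    · have h21 : ∀ i j : ℤ, ¬ Relation.ReflTransGen (BRel Φ b'.B) ((G.T ^ (P * i : ℤ)) c2)
        ((G.T ^ (P * j : ℤ)) c1) := by
        intro i' j' h21
        obtain ⟨i, j, h12⟩ := h12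
        obtain ⟨t, ht⟩ : ∃ t : ℕ, j < i' + 4 * t ∧ i < j' + 4 * t := by
          refine ⟨(j - i').natAbs + (i - j').natAbs + 1, ?_, ?_⟩ <;> lia
        have h3 := hsh t h21
        rw [hSzz, hSzz] at h3
        exact hfranks _ (((D2 _ _ ht.1).trans_left h3).trans (D1 _ _ ht.2) |>.trans_left h12)
      obtain ⟨d0, e1, e2⟩ := succ_data 2 c2 z2 (hintg hz2) hzc2 hs2
      obtain ⟨d1, e3, e4⟩ := pred_data 1 c1 z1 (hintg hz1) hzc1 hp1
      refine bricks_to_O hNpos b' Φ hcommN _ _ e1 e2 (Or.inl ?_) e3 e4 (Or.inl ?_) ?_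
      · rw [hSc]; exact (D2 _ _ (by lia)).to_reflTransGen
      · rw [hSc]; exact (D1 _ _ (by lia)).to_reflTransGen
      · intro j j'
        rw [hSzz, hSzz]
        exact h21 _ _
    · push Not at h12
      obtain ⟨d0, e1, e2⟩ := succ_data 0 c1 z1 (hintg hz1) hzc0 hs0
      obtain ⟨d1, e3, e4⟩ := pred_data 3 c2 z2 (hintg hz2) hzc3 hp3
      refine bricks_to_O hNpos b' Φ hcommN _ _ e1 e2 (Or.inr ?_) e3 e4 (Or.inr ?_) ?_
      · rw [hSc']; exact (D1 _ _ (by lia)).to_reflTransGen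
      · rw [hSc']; exact (D2 _ _ (by lia)).to_reflTransGen
      · intro j j'
        rw [hSzz, hSzz]
        exact h12 _ _
  obtain ⟨O, h1, h2, h3, h4⟩ := fin
  refine ⟨4 * P, by lia, O, h1, fun z => ?_, h3, h4⟩
  have := h2 z
  simpa [Nr] using this

end PB

open Filter Set Topology MeasureTheory

namespace PB

theorem comm_symm {Φ : ℂ ≃ₜ ℂ} (h : ∀ z, Φ (z + 1) = Φ z + 1) (z : ℂ) :
    Φ.symm (z + 1) = Φ.symm z + 1 := by
  rw [Homeomorph.symm_apply_eq, h, Homeomorph.apply_symm_apply]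

theorem periodize {Φ : ℂ ≃ₜ ℂ} (hcomm : ∀ z, Φ (z + 1) = Φ z + 1) {N : ℕ} (hN : 0 < N)
    {O : Set ℂ} (hO : IsOpen O) (hper : ∀ z : ℂ, z + N ∈ O ↔ z ∈ O)
    (hinv : ∀ z ∈ closure O, Φ.symm z ∈ O) (hE : Ends O) :
    ∃ O : Set ℂ, IsOpen O ∧ (∀ z : ℂ, z + 1 ∈ O ↔ z ∈ O) ∧
      (∀ z ∈ closure O, Φ.symm z ∈ O) ∧ Ends O := by
  let O' : Set ℂ := ⋂ i ∈ Finset.range N, (fun z : ℂ => z + (i : ℕ)) ⁻¹' O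
  have hmem : ∀ z, z ∈ O' ↔ ∀ i < N, z + (i : ℕ) ∈ O := fun z => by simp [O']
  refine ⟨O', ?_, ?_, ?_, ?_⟩
  · exact isOpen_biInter_finset fun i _ => hO.preimage (by fun_prop)
  · intro z
    rw [hmem, hmem]
    constructor
    · intro h i hi
      rcases i with _ | i
      · have := h (N - 1) (by lia)
        rw [← hper]
        convert this using 1
        have : (N : ℂ) = ((N - 1 : ℕ) : ℂ) + 1 := by
          have : N = (N - 1) + 1 := by lia
          exact_mod_cast this
        rw [this]; push_cast; ring
      · have := h i (by lia)
        convert this using 1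
        push_cast; ring
    · intro h i hi
      rcases Nat.lt_or_ge (i + 1) N with h1 | h1
      · have := h (i + 1) h1
        convert this using 1
        push_cast; ring
      · have h2 : N = i + 1 := by lia
        have h0 := (hper z).2 (by simpa using h 0 hN)
        convert h0 using 1
        rw [h2]; push_cast; ring
  · intro z hz
    rw [hmem]
    intro i hi
    have h1 : z + (i : ℕ) ∈ closure O :=
      map_mem_closure (f := fun z : ℂ => z + (i : ℕ)) (by fun_prop) hz fun w hw =>
        (hmem w).1 hw i hi
    have h2 := hinv _ h1
    have h3 := comm_int (comm_symm hcomm) i z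
    push_cast at h3
    rwa [h3] at h2
  · obtain ⟨s, hs, M, h1, h2⟩ := hE
    refine ⟨s, hs, M, fun z hz => (hmem z).2 fun i _ => h1 _ ?_, fun z hz h => ?_⟩
    · simpa using hz
    · have := (hmem z).1 h 0 hN
      exact h2 z hz (by simpa using this)

theorem disp_bound {Φ : ℂ ≃ₜ ℂ} (hcomm : ∀ z, Φ (z + 1) = Φ z + 1) (hfpf : ∀ z, Φ z ≠ z)
    (m : ℕ) : ∃ d > 0, ∀ z : ℂ, |z.im| ≤ m → d ≤ ‖Φ z - z‖ := by
  have hc : IsCompact (Icc (0:ℝ) 1 ×ℂ Icc (-(m:ℝ)) m) := isCompact_Icc.reProdIm isCompact_Icc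
  obtain ⟨z0, -, hmin⟩ := hc.exists_isMinOn (f := fun z => ‖Φ z - z‖)
    ⟨0, by simp [Complex.mem_reProdIm]⟩ (by have := Φ.continuous; fun_prop)
  refine ⟨‖Φ z0 - z0‖, norm_pos_iff.2 (sub_ne_zero.2 (hfpf z0)), fun z hz => ?_⟩
  have h1 := hmin (a := z + ((-⌊z.re⌋ : ℤ) : ℂ)) (by
    rw [Complex.mem_reProdIm]
    refine ⟨?_, by simpa using abs_le.1 hz⟩
    simp only [Complex.add_re, Complex.intCast_re]
    push_cast
    exact ⟨by linarith [Int.floor_le z.re], by linarith [Int.lt_floor_add_one z.re]⟩)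
  have h2 := comm_int hcomm (-⌊z.re⌋) z
  change ‖Φ z0 - z0‖ ≤ ‖Φ _ - _‖ at h1
  rw [h2, add_sub_add_right_eq_sub] at h1
  exact h1

theorem Free.symm {F : ℂ ≃ₜ ℂ} {K : Set ℂ} (h : Free F.symm K) : Free F K := fun z hz hFz =>
  h (F z) hFz (by simpa using hz)

theorem plane_main {Φ : ℂ ≃ₜ ℂ} (hcomm : ∀ z, Φ (z + 1) = Φ z + 1)
    (hOP : OP Φ) (hfpf : ∀ z, Φ z ≠ z) {z1 z2 : ℂ}
    (hr1 : ∀ U ∈ 𝓝 z1, ∃ w ∈ U, ∃ n : ℕ, ∃ a : ℕ, 1 ≤ n ∧ 1 ≤ a ∧ Φ^[n] w + a ∈ U)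
    (hr2 : ∀ U ∈ 𝓝 z2, ∃ w ∈ U, ∃ n : ℕ, ∃ a : ℕ, 1 ≤ n ∧ 1 ≤ a ∧ Φ^[n] w - a ∈ U) :
    ∃ O : Set ℂ, IsOpen O ∧ (∀ z : ℂ, z + 1 ∈ O ↔ z ∈ O) ∧
      (∀ z ∈ closure O, Φ.symm z ∈ O) ∧ Ends O := by
  have hOP' : OP Φ.symm := hOP.symm
  have hfpf' : ∀ z, Φ.symm z ≠ z := fun z h => hfpf z (by
    conv_lhs => rw [← h]
    simp)
  choose d hd0 hd using disp_bound hcomm hfpf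
  obtain ⟨R0, hR0, δ0, hδ0, H0⟩ := succ_brick hOP hfpf z1
  obtain ⟨R1, hR1, δ1, hδ1, H1⟩ := succ_brick hOP' hfpf' z1
  obtain ⟨R2, hR2, δ2, hδ2, H2⟩ := succ_brick hOP hfpf z2
  obtain ⟨R3, hR3, δ3, hδ3, H3⟩ := succ_brick hOP' hfpf' z2
  let δm : ℝ := min (min δ0 δ1) (min δ2 δ3)
  have hδm : 0 < δm := lt_min (lt_min hδ0 hδ1) (lt_min hδ2 hδ3)
  obtain ⟨ι, G, hG, ⟨c1, hc1⟩, ⟨c2, hc2⟩⟩ := grid_exists (fun m => min δm (d m / 2))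
    (fun m => lt_min hδm (half_pos (hd0 m))) z1 z2
  have hGδ : ∀ c, ∀ x ∈ G.C c, ∀ y ∈ G.C c, ‖x - y‖ ≤ δm := fun c x hx y hy =>
    (hG c x hx y hy).trans (min_le_left _ _)
  obtain ⟨K0, s0, m0, b0, f0, x0⟩ := H0 ι G fun c x hx y hy _ => (hGδ c x hx y hy).trans
    ((min_le_left _ _).trans (min_le_left _ _))
  obtain ⟨K1, s1, m1, b1, f1, x1⟩ := H1 ι G fun c x hx y hy _ => (hGδ c x hx y hy).trans
    ((min_le_left _ _).trans (min_le_right _ _))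
  obtain ⟨K2, s2, m2, b2, f2, x2⟩ := H2 ι G fun c x hx y hy _ => (hGδ c x hx y hy).trans
    ((min_le_right _ _).trans (min_le_left _ _))
  obtain ⟨K3, s3, m3, b3, f3, x3⟩ := H3 ι G fun c x hx y hy _ => (hGδ c x hx y hy).trans
    ((min_le_right _ _).trans (min_le_right _ _))
  have hfreeC : ∀ c, Free Φ (G.C c) := by
    intro c x hx hFx
    have h1 := (hG c x hx _ hFx).trans (min_le_right _ _)
    have h2 := hd _ x (Nat.le_ceil |x.im|)
    rw [norm_sub_rev] at h1
    linarith [hd0 ⌈|x.im|⌉₊]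
  have k0 := Grid.U_compact (G := G) b0
  have k1 := Grid.U_compact (G := G) b1
  have k2 := Grid.U_compact (G := G) b2
  have k3 := Grid.U_compact (G := G) b3
  obtain ⟨M, hM⟩ := ((k0.union k1).union (k2.union k3)).isBounded.exists_norm_le
  let K : ℤ → Set ℂ := fun j => if j % 4 = 0 then K0 else if j % 4 = 1 then K1 else
    if j % 4 = 2 then K2 else K3
  let zc : ℤ → ℂ := fun j => if j % 4 = 0 then z1 else if j % 4 = 1 then z1 else z2
  have hall : ∀ j, StarConvex ℝ (zc j) (K j) ∧ zc j ∈ K j ∧ Free Φ (G.U (K j)) ∧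
      (∀ x ∈ G.U (K j), ‖x‖ ≤ M) ∧ IsCompact (G.U (K j)) := by
    intro j
    simp only [K, zc]
    split_ifs
    · exact ⟨s0, m0, f0, fun x hx => hM x (Or.inl (Or.inl hx)), k0⟩
    · exact ⟨s1, m1, f1.symm, fun x hx => hM x (Or.inl (Or.inr hx)), k1⟩
    · exact ⟨s2, m2, f2, fun x hx => hM x (Or.inr (Or.inl hx)), k2⟩
    · exact ⟨s3, m3, f3.symm, fun x hx => hM x (Or.inr (Or.inr hx)), k3⟩
  obtain ⟨N, hN, O, hO, hper, hinv, hE⟩ := bricks_final G hcomm hOP hfpf hfreeC K zc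
    (fun j => by simp [K]) (fun j => (hall j).1) (fun j => (hall j).2.1)
    (fun j => (hall j).2.2.1) M (fun j => (hall j).2.2.2.1) (fun j => (hall j).2.2.2.2)
    hc1 hc2 (by simp [zc]) (by simp [zc]) (by simp [zc]) (by simp [zc])
    (by simpa [K] using x0) (by simpa [K] using x1) (by simpa [K] using x2)
    (by simpa [K] using x3) hr1 hr2
  exact periodize hcomm hN hO hper hinv hE

end PB

open Filter Set Topology MeasureTheory

namespace PB

theorem coloring {κ : Type*} [DecidableEq κ] (c : ℕ → κ) (k : ℕ → ℝ) (D : ℝ) (hD : 0 ≤ D)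
    (hstep : ∀ n, k n - D ≤ k (n + 1)) (hsame : ∀ m n, m ≤ n → c m = c n → k m ≤ k n)
    (S : Finset κ) : ∀ s n, s ≤ n → (∀ i, s ≤ i → i ≤ n → c i ∈ S) → k s - S.card * D ≤ k n := by
  induction S using Finset.strongInduction with
  | H S ih =>
    intro s n hsn hS
    classical
    -- last time with colour c s
    let P : ℕ → Prop := fun i => s ≤ i ∧ c i = c s
    have hP : P s := ⟨le_rfl, rfl⟩
    set t := Nat.findGreatest P n with ht
    have hPt : P t := Nat.findGreatest_spec hsn hP
    have htn : t ≤ n := Nat.findGreatest_le n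
    have h1 : k s ≤ k t := hsame s t hPt.1 hPt.2.symm
    rcases htn.eq_or_lt with h | h
    · rw [← h]
      have : 0 ≤ (S.card : ℝ) * D := by positivity
      linarith
    · have hcs : c s ∈ S := hS s le_rfl hsn
      have h2 := ih (S.erase (c s)) (Finset.erase_ssubset hcs) (t + 1) n h (by
        intro i hi1 hi2
        refine Finset.mem_erase.2 ⟨fun hc => ?_, hS i (by have := hPt.1; lia) hi2⟩
        have : i ≤ t := Nat.le_findGreatest hi2 ⟨by have := hPt.1; lia, hc⟩
        lia)
      rw [Finset.card_erase_of_mem hcs] at h2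
      have h3 : ((S.card - 1 : ℕ) : ℝ) = S.card - 1 := by
        rw [Nat.cast_sub (Finset.card_pos.2 ⟨_, hcs⟩)]; simp
      rw [h3] at h2
      have h4 := hstep t
      nlinarith

variable {I : Set ℝ}

theorem strip_int {G : StripT I → StripT I}
    (h : ∀ z : StripT I, G (z.1 + 1, z.2) = ((G z).1 + 1, (G z).2)) (m : ℤ) (z : StripT I) :
    G (z.1 + m, z.2) = ((G z).1 + m, (G z).2) := by
  induction m using Int.induction_on generalizing z with
  | zero => simp
  | succ i ih =>
    have h1 := h (z.1 + (i : ℤ), z.2)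
    rw [ih] at h1
    push_cast at h1 ⊢
    rw [← add_assoc, h1, add_assoc]
  | pred i ih =>
    have h1 := h (z.1 + ((-i - 1 : ℤ) : ℝ), z.2)
    have h2 := ih z
    push_cast at h1 h2 ⊢
    rw [show z.1 + (-(i:ℝ) - 1) + 1 = z.1 + -(i:ℝ) by ring, h2] at h1
    have h3 := congrArg Prod.fst h1
    have h4 := congrArg Prod.snd h1
    simp only at h3 h4
    refine Prod.ext ?_ h4.symm
    simp only
    linarith

theorem strip_iter {G : StripT I → StripT I}
    (h : ∀ z : StripT I, G (z.1 + 1, z.2) = ((G z).1 + 1, (G z).2)) (n : ℕ) (z : StripT I) :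
    G^[n] (z.1 + 1, z.2) = ((G^[n] z).1 + 1, (G^[n] z).2) := by
  induction n generalizing z with
  | zero => simp
  | succ n ih => rw [Function.iterate_succ_apply, h, ih, Function.iterate_succ_apply]

theorem proj_iter {g : AnnulusT I → AnnulusT I} {G : StripT I → StripT I}
    (hlift : ∀ z, projT I (G z) = g (projT I z)) (n : ℕ) (z : StripT I) :
    projT I (G^[n] z) = g^[n] (projT I z) := by
  induction n generalizing z with
  | zero => rfl
  | succ n ih => rw [Function.iterate_succ_apply, ih, hlift, Function.iterate_succ_apply]

theorem proj_surj (a : AnnulusT I) : ∃ z, projT I z = a := by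
  obtain ⟨x, hx⟩ := QuotientAddGroup.mk_surjective a.1
  exact ⟨(x, a.2), Prod.ext hx rfl⟩

theorem continuous_projT : Continuous (projT I) := by
  unfold projT
  exact ((AddCircle.continuous_mk' 1).comp continuous_fst).prodMk continuous_snd

theorem proj_int (z : StripT I) (m : ℤ) : projT I (z.1 + m, z.2) = projT I z := by
  refine Prod.ext ?_ rfl
  change ((z.1 + m : ℝ) : AddCircle (1:ℝ)) = (z.1 : AddCircle (1:ℝ))
  have := AddCircle.coe_add_period (1:ℝ)
  rw [AddCircle.coe_add]
  have h0 : ((m : ℝ) : AddCircle (1:ℝ)) = 0 := by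
    rw [AddCircle.coe_eq_zero_iff]; exact ⟨m, by simp⟩
  rw [h0, add_zero]

theorem birk {g : AnnulusT I → AnnulusT I} {G : StripT I → StripT I}
    (hlift : ∀ z, projT I (G z) = g (projT I z)) {φ : AnnulusT I → ℝ}
    (hφ : ∀ z : StripT I, φ (projT I z) = (G z).1 - z.1) (n : ℕ) (z : StripT I) :
    (G^[n] z).1 - z.1 = ∑ j ∈ Finset.range n, φ (g^[j] (projT I z)) := by
  induction n with
  | zero => simp
  | succ n ih =>
    rw [Finset.sum_range_succ, ← ih, ← proj_iter hlift, hφ, Function.iterate_succ_apply']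
    ring

theorem drift {g : AnnulusT I → AnnulusT I} {G : StripT I → StripT I}
    (hlift : ∀ z, projT I (G z) = g (projT I z))
    (hcomm : ∀ z : StripT I, G (z.1 + 1, z.2) = ((G z).1 + 1, (G z).2))
    {φ : AnnulusT I → ℝ} (hφc : Continuous φ)
    (hφ : ∀ z : StripT I, φ (projT I z) = (G z).1 - z.1)
    (μ : Measure (AnnulusT I)) [IsProbabilityMeasure μ] (hmp : MeasurePreserving g μ μ)
    (hK : ∃ K : Set (AnnulusT I), IsCompact K ∧ μ Kᶜ = 0) (ε : ℤ) (hε : ε = 1 ∨ ε = -1)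
    (hintg : (ε : ℝ) * ∫ z, φ z ∂μ < 0) :
    ∃ z : StripT I, ∀ U ∈ 𝓝 z, ∃ w ∈ U, ∃ n a : ℕ, 1 ≤ n ∧ 1 ≤ a ∧
      ((G^[n] w).1 + ((ε * a : ℤ) : ℝ), (G^[n] w).2) ∈ U := by
  classical
  by_contra hno
  push Not at hno
  obtain ⟨K, hKc, hKμ⟩ := hK
  choose U hU hUno using hno
  let Kt : Set (StripT I) := {z | z.1 ∈ Icc (0:ℝ) 1 ∧ projT I z ∈ K}
  have hKt : IsCompact Kt := by
    refine (isCompact_Icc (a := (0:ℝ)) (b := 1) |>.prod (hKc.image continuous_snd)).of_isClosed_subset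
      ?_ ?_
    · exact (isClosed_Icc.preimage continuous_fst).inter (hKc.isClosed.preimage continuous_projT)
    · rintro z ⟨h1, h2⟩
      exact ⟨h1, _, h2, rfl⟩
  obtain ⟨t, -, ht⟩ := hKt.elim_nhds_subcover U fun z _ => hU z
  obtain ⟨D, hD⟩ := hKc.exists_bound_of_continuousOn hφc.continuousOn
  have hD0 : 0 ≤ max D 0 + 1 := by positivity
  have hε2 : (ε : ℝ) * ε = 1 := by rcases hε with rfl | rfl <;> norm_num
  have hεa : |(ε : ℝ)| = 1 := by rcases hε with rfl | rfl <;> norm_num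
  -- pointwise bound
  have hpt : ∀ z : StripT I, (∀ n, g^[n] (projT I z) ∈ K) → ∀ n,
      -(t.card * (max D 0 + 1) + 1) ≤ ε * ((G^[n] z).1 - z.1) := by
    intro z hz n
    let w : ℕ → StripT I := fun i => G^[i] z
    let k : ℕ → ℤ := fun i => ⌊(w i).1⌋
    have hmem : ∀ i, ((w i).1 + ((-k i : ℤ) : ℝ), (w i).2) ∈ Kt := by
      intro i
      refine ⟨?_, ?_⟩
      · simp only [k]; push_cast
        exact ⟨by linarith [Int.floor_le (w i).1], by linarith [Int.lt_floor_add_one (w i).1]⟩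
      · rw [proj_int, proj_iter hlift]; exact hz i
    have hcol : ∀ i, ∃ c ∈ t, ((w i).1 + ((-k i : ℤ) : ℝ), (w i).2) ∈ U c := fun i => by
      simpa using ht (hmem i)
    choose c hct hcU using hcol
    have hstep : ∀ i, (ε * k i : ℝ) - (max D 0 + 1) ≤ ε * k (i + 1) := by
      intro i
      have h1 : |(w (i + 1)).1 - (w i).1| ≤ max D 0 := by
        have := hD _ (hz i)
        rw [← proj_iter hlift, hφ, Real.norm_eq_abs] at this
        simp only [w]
        rw [Function.iterate_succ_apply']
        exact this.trans (le_max_left _ _)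
      have h2 := Int.floor_le (w i).1
      have h3 := Int.lt_floor_add_one (w i).1
      have h4 := Int.floor_le (w (i+1)).1
      have h5 := Int.lt_floor_add_one (w (i+1)).1
      have h6 : |(ε : ℝ) * (k (i + 1) - k i)| ≤ max D 0 + 1 := by
        rw [abs_mul, hεa, one_mul, abs_le]
        rw [abs_le] at h1
        simp only [k]
        constructor <;> linarith [h1.1, h1.2]
      have := (abs_le.1 h6).1
      linarith
    have hsame : ∀ m i, m ≤ i → c m = c i → (ε * k m : ℝ) ≤ ε * k i := by
      intro m i hmi hc
      by_contra hlt
      push Not at hlt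
      have hlt' : ε * k i < ε * k m := by exact_mod_cast hlt
      have hne : m ≠ i := by rintro rfl; exact lt_irrefl _ hlt
      obtain ⟨a, ha⟩ := Int.eq_ofNat_of_zero_le (sub_nonneg.2 hlt'.le)
      have ha1 : 1 ≤ a := by
        rcases Nat.eq_zero_or_pos a with h0 | h0
        · subst h0; simp at ha; lia
        · exact h0
      refine hUno (c m) _ (hcU m) (i - m) a (by lia) ha1 ?_
      have h7 := strip_int (strip_iter hcomm (i - m)) (-k m) (w m)
      have h8 : G^[i - m] (w m) = w i := by
        simp only [w]; rw [← Function.iterate_add_apply]; congr 2; lia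
      rw [h7, h8, hc]
      have h9 : ε * (a : ℤ) = k m - k i := by
        have h10 : ε * ε = 1 := by rcases hε with rfl | rfl <;> norm_num
        have : (a : ℤ) = ε * k m - ε * k i := by simpa using ha.symm
        rw [this, mul_sub, ← mul_assoc, ← mul_assoc, h10]; ring
      rw [h9]
      have := hcU i
      convert this using 2
      push_cast; ring
    have hfin := coloring c (fun i => (ε * k i : ℝ)) _ hD0 hstep hsame t 0 n (Nat.zero_le _)
      (fun i _ _ => hct i)
    have h2 := Int.floor_le (w 0).1
    have h3 := Int.lt_floor_add_one (w 0).1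
    have h4 := Int.floor_le (w n).1
    have h5 := Int.lt_floor_add_one (w n).1
    have h0 : (w 0).1 = z.1 := rfl
    have hn : (w n).1 = (G^[n] z).1 := rfl
    simp only [k] at hfin
    rw [← h0, ← hn]
    rcases hε with rfl | rfl
    · push_cast at hfin ⊢; linarith
    · push_cast at hfin ⊢; linarith
  have hae : ∀ᵐ x ∂μ, ∀ n, g^[n] x ∈ K := by
    rw [ae_all_iff]
    intro n
    exact (hmp.iterate n).quasiMeasurePreserving.ae (p := fun x => x ∈ K) (mem_ae_iff.2 hKμ)
  have hφi : Integrable φ μ := by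
    refine Integrable.of_bound hφc.aestronglyMeasurable D ?_
    filter_upwards [hae] with x hx
    exact hD x (hx 0)
  have hφin : ∀ j, Integrable (fun x => φ (g^[j] x)) μ := fun j =>
    (hmp.iterate j).integrable_comp_of_integrable hφi
  have hφinn : ∀ j, ∫ x, φ (g^[j] x) ∂μ = ∫ x, φ x ∂μ := by
    intro j
    have h := (hmp.iterate j)
    have h2 := integral_map (μ := μ) (φ := g^[j]) h.measurable.aemeasurable (f := φ)
      hφc.aestronglyMeasurable
    rw [h.map_eq] at h2
    exact h2.symm
  have hbound : ∀ n : ℕ, -(t.card * (max D 0 + 1) + 1) ≤ ε * (n * ∫ x, φ x ∂μ) := by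
    intro n
    have h1 : (n : ℝ) * ∫ x, φ x ∂μ = ∫ x, ∑ j ∈ Finset.range n, φ (g^[j] x) ∂μ := by
      rw [integral_finset_sum _ fun j _ => hφin j]
      simp [hφinn]
    rw [h1, ← integral_const_mul]
    have h2 : ∫ _x : AnnulusT I, -((t.card : ℝ) * (max D 0 + 1) + 1) ∂μ =
      -((t.card : ℝ) * (max D 0 + 1) + 1) := by simp
    rw [← h2]
    refine integral_mono_ae (integrable_const _)
      ((integrable_finset_sum _ fun j _ => hφin j).const_mul _) ?_
    filter_upwards [hae] with x hx
    obtain ⟨z, rfl⟩ := proj_surj x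
    have := hpt z hx n
    rw [birk hlift hφ] at this
    exact this
  obtain ⟨n, hn⟩ := exists_nat_gt ((t.card * (max D 0 + 1) + 1) / (-(ε * ∫ x, φ x ∂μ)))
  rw [div_lt_iff₀ (by linarith)] at hn
  have := hbound n
  nlinarith

end PB

open Filter Set Topology MeasureTheory

namespace PB

theorem ratio_slit {D w : ℂ} (h : (0 < D.re ∧ 0 < w.re) ∨ (D.re < 0 ∧ w.re < 0) ∨
    (0 < D.im ∧ 0 < w.im) ∨ (D.im < 0 ∧ w.im < 0)) : D / w ∈ Complex.slitPlane := by
  have hw : w ≠ 0 := by rintro rfl; simp at h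
  by_contra hn
  rw [Complex.mem_slitPlane_iff_not_le_zero, not_not, Complex.le_def] at hn
  obtain ⟨h1, h2⟩ := hn
  have hD : D = ((D / w).re : ℂ) * w := by
    have : ((D / w).re : ℂ) = D / w := Complex.ext (by simp) (by simp [h2])
    rw [this, div_mul_cancel₀ _ hw]
  simp only [Complex.zero_re] at h1
  have hre : D.re = (D / w).re * w.re := by
    conv_lhs => rw [hD]
    simp
  have him : D.im = (D / w).re * w.im := by
    conv_lhs => rw [hD]
    simp
  rcases h with h | h | h | h <;> nlinarith [h.1, h.2]

/-- horizontal displacement is bounded on bounded bands -/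
theorem disp_bdd {Φ : ℂ → ℂ} (hc : Continuous Φ) (hcomm : ∀ z, Φ (z + 1) = Φ z + 1) (Y : ℝ) :
    ∃ C, ∀ z : ℂ, |z.im| ≤ Y → ‖Φ z - z‖ ≤ C := by
  have hK : IsCompact (Icc (0:ℝ) 1 ×ℂ Icc (-Y) Y) := isCompact_Icc.reProdIm isCompact_Icc
  obtain ⟨C, hC⟩ := hK.exists_bound_of_continuousOn (f := fun z => Φ z - z) (by fun_prop)
  refine ⟨C, fun z hz => ?_⟩
  have := hC (z + ((-⌊z.re⌋ : ℤ) : ℂ)) (by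
    rw [Complex.mem_reProdIm]
    simp only [Complex.add_re, Complex.intCast_re, Complex.add_im, Complex.intCast_im, add_zero]
    push_cast
    refine ⟨⟨?_, ?_⟩, abs_le.1 hz⟩
    · linarith [Int.floor_le z.re]
    · linarith [Int.lt_floor_add_one z.re])
  simp only [comm_int hcomm] at this
  rwa [add_sub_add_right_eq_sub] at this

theorem op_of_ends {Φ : ℂ → ℂ} (hc : Continuous Φ) (hi : Function.Injective Φ)
    (hcomm : ∀ z, Φ (z + 1) = Φ z + 1)
    (htop : ∀ B : ℝ, ∃ M : ℝ, ∀ z : ℂ, M ≤ z.im → B ≤ (Φ z).im)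
    (hbot : ∀ B : ℝ, ∃ M : ℝ, ∀ z : ℂ, z.im ≤ M → (Φ z).im ≤ B) : OP Φ := by
  obtain ⟨Λ, hΛ, hΛ'⟩ := exp_lift (X := ℂ × ℂ)
    (fun p => Φ (p.1 + Complex.exp p.2) - Φ p.1) (by fun_prop)
    (fun p => sub_ne_zero.2 fun h => by simpa using hi h)
  set τ : ℂ := 2 * Real.pi * Complex.I with hτ
  have hexpτ : ∀ ζ, Complex.exp (ζ + τ) = Complex.exp ζ := fun ζ => Complex.exp_periodic ζ
  have hk : ∀ p q : ℂ × ℂ, Λ (p.1, p.2 + τ) - Λ p = Λ (q.1, q.2 + τ) - Λ q := by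
    intro p q
    refine exp_const (g := fun p : ℂ × ℂ => Λ (p.1, p.2 + τ) - Λ p) (by fun_prop) ?_ q p
    intro p
    rw [Complex.exp_sub, hΛ', hΛ', hexpτ]
    exact div_self (sub_ne_zero.2 fun h => by simpa using hi h)
  -- the box
  obtain ⟨M1, hM1⟩ := htop ((Φ 0).im + 1)
  obtain ⟨M2, hM2⟩ := hbot ((Φ 0).im - 1)
  set Y : ℝ := max 1 (max M1 (-M2)) with hY
  have hY1 : 1 ≤ Y := le_max_left _ _
  have hYM1 : M1 ≤ Y := (le_max_left _ _).trans (le_max_right _ _)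
  have hYM2 : -M2 ≤ Y := (le_max_right _ _).trans (le_max_right _ _)
  obtain ⟨C, hC⟩ := disp_bdd hc hcomm Y
  set X : ℝ := max 1 (C + |(Φ 0).re| + 1) with hX
  have hX1 : 1 ≤ X := le_max_left _ _
  have hXC : C + |(Φ 0).re| + 1 ≤ X := le_max_right _ _
  have hbox : ∀ w : ℂ, max (|w.re| / X) (|w.im| / Y) = 1 →
      (Φ w - Φ 0) / w ∈ Complex.slitPlane := by
    intro w hw
    have hX0 : 0 < X := by linarith
    have hY0 : 0 < Y := by linarith
    have h1 : |w.re| ≤ X := by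
      have := (le_max_left _ _).trans_eq hw; rwa [div_le_one hX0] at this
    have h2 : |w.im| ≤ Y := by
      have := (le_max_right _ _).trans_eq hw; rwa [div_le_one hY0] at this
    apply ratio_slit
    have hd := (Complex.abs_re_le_norm _).trans (hC w h2)
    rw [Complex.sub_re, abs_le] at hd
    have h0 := abs_le.1 (le_refl |(Φ 0).re|)
    simp only [Complex.sub_re, Complex.sub_im]
    rcases max_choice (|w.re| / X) (|w.im| / Y) with h | h
    · rw [h, div_eq_one_iff_eq hX0.ne'] at hw
      rcases abs_choice w.re with h' | h' <;> rw [h'] at hw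
      · left; constructor <;> linarith
      · right; left; constructor <;> linarith
    · rw [h, div_eq_one_iff_eq hY0.ne'] at hw
      rcases abs_choice w.im with h' | h' <;> rw [h'] at hw
      · right; right; left
        have := hM1 w (by linarith)
        constructor <;> linarith
      · right; right; right
        have := hM2 w (by linarith)
        constructor <;> linarith
  -- the curve
  set m : ℝ → ℝ := fun φ => max (|Real.cos φ| / X) (|Real.sin φ| / Y) with hm
  have hX0 : 0 < X := by linarith
  have hY0 : 0 < Y := by linarith
  have hm0 : ∀ φ, 0 < m φ := by
    intro φ
    by_cases h : Real.cos φ = 0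
    · have : Real.sin φ ≠ 0 := by
        intro h'; have := Real.sin_sq_add_cos_sq φ; rw [h, h'] at this; norm_num at this
      exact lt_max_of_lt_right (by positivity)
    · exact lt_max_of_lt_left (by positivity)
  have hmc : Continuous m := by
    rw [hm]; fun_prop
  set ζ : ℝ → ℂ := fun φ => ((-Real.log (m φ) : ℝ) : ℂ) + φ * Complex.I with hζ
  have hζc : Continuous ζ := by
    have : Continuous fun φ => Real.log (m φ) := hmc.log fun φ => (hm0 φ).ne'
    rw [hζ]; fun_prop
  have hζe : ∀ φ, Complex.exp (ζ φ) = ((m φ)⁻¹ : ℝ) * (Real.cos φ + Real.sin φ * Complex.I) := by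
    intro φ
    rw [hζ]
    simp only
    rw [Complex.exp_add, Complex.exp_mul_I, ← Complex.ofReal_exp, Real.exp_neg,
      Real.exp_log (hm0 φ)]
    simp
  have hslit : ∀ φ, (Φ (Complex.exp (ζ φ)) - Φ 0) / Complex.exp (ζ φ) ∈ Complex.slitPlane := by
    intro φ
    apply hbox
    have hre : (Complex.exp (ζ φ)).re = (m φ)⁻¹ * Real.cos φ := by
      rw [hζe, Complex.re_ofReal_mul]
      simp [-Complex.ofReal_cos, -Complex.ofReal_sin]
    have him : (Complex.exp (ζ φ)).im = (m φ)⁻¹ * Real.sin φ := by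
      rw [hζe, Complex.im_ofReal_mul]
      simp [-Complex.ofReal_cos, -Complex.ofReal_sin]
    rw [hre, him, abs_mul, abs_mul, abs_of_pos (inv_pos.2 (hm0 φ)), mul_div_assoc, mul_div_assoc,
      ← mul_max_of_nonneg _ _ (inv_pos.2 (hm0 φ)).le]
    exact inv_mul_cancel₀ (hm0 φ).ne'
  have hconst := exp_const (X := ℝ) (g := fun φ => Λ (0, ζ φ) - ζ φ -
      Complex.log ((Φ (Complex.exp (ζ φ)) - Φ 0) / Complex.exp (ζ φ))) (by
        refine Continuous.sub (by fun_prop) (Continuous.clog ?_ hslit)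
        exact Continuous.div (by fun_prop) (by fun_prop) fun φ => Complex.exp_ne_zero _) (by
        intro φ
        have hne := Complex.slitPlane_ne_zero (hslit φ)
        rw [Complex.exp_sub, Complex.exp_sub, hΛ', Complex.exp_log hne]
        simp only [zero_add]
        exact div_self hne) 0 (2 * Real.pi)
  have hζ2 : ζ (2 * Real.pi) = ζ 0 + τ := by
    simp [hζ, hm, hτ]
  have hone : ∀ p : ℂ × ℂ, Λ (p.1, p.2 + τ) = Λ p + τ := by
    intro p
    have h1 := hk p (0, ζ 0)
    simp only [hζ2, hexpτ] at hconst h1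
    linear_combination h1 + hconst
  have hper : ∀ z, Function.Periodic (fun ζ => Λ (z, ζ) - ζ) τ := by
    intro z ζ
    have := hone (z, ζ)
    simp only at this ⊢
    rw [this]; ring
  have hwd : ∀ z a b, Complex.exp a = Complex.exp b → Λ (z, a) - a = Λ (z, b) - b := by
    intro z a b h
    obtain ⟨n, rfl⟩ := Complex.exp_eq_exp_iff_exists_int.1 h
    exact (hper z).int_mul n b
  refine ⟨fun p => Λ (p.2, Complex.log (p.1 - p.2)) - Complex.log (p.1 - p.2), ?_, ?_⟩
  · intro p hp
    apply ContinuousAt.continuousWithinAt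
    have hne : p.1 - p.2 ≠ 0 := sub_ne_zero.2 hp
    by_cases hs : p.1 - p.2 ∈ Complex.slitPlane
    · have : ContinuousAt (fun p : ℂ × ℂ => Complex.log (p.1 - p.2)) p :=
        ContinuousAt.clog (by fun_prop) hs
      refine ContinuousAt.sub ?_ this
      exact hΛ.continuousAt.comp (continuousAt_snd.prodMk this)
    · have hs' : -(p.1 - p.2) ∈ Complex.slitPlane := by
        rw [Complex.mem_slitPlane_iff] at hs ⊢
        push Not at hs
        left
        have : (p.1 - p.2).re ≠ 0 := fun h => hne (Complex.ext h hs.2)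
        rw [Complex.neg_re]
        have := lt_of_le_of_ne hs.1 this
        linarith
      have : ContinuousAt (fun p : ℂ × ℂ => Complex.log (-(p.1 - p.2)) + Real.pi * Complex.I) p :=
        ContinuousAt.add (ContinuousAt.clog (f := fun p : ℂ × ℂ => -(p.1 - p.2))
          (by fun_prop) hs') continuousAt_const
      have h2 : ContinuousAt (fun p : ℂ × ℂ =>
          Λ (p.2, Complex.log (-(p.1 - p.2)) + Real.pi * Complex.I) -
          (Complex.log (-(p.1 - p.2)) + Real.pi * Complex.I)) p :=
        ContinuousAt.sub (hΛ.continuousAt.comp (continuousAt_snd.prodMk this)) this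
      refine h2.congr ?_
      filter_upwards [isOpen_Conf.mem_nhds hp] with q hq
      have hne : q.1 - q.2 ≠ 0 := sub_ne_zero.2 hq
      apply hwd
      rw [Complex.exp_add, Complex.exp_log (neg_ne_zero.2 hne), Complex.exp_log hne,
        Complex.exp_pi_mul_I]
      ring
  · intro p hp
    have hne : p.1 - p.2 ≠ 0 := sub_ne_zero.2 hp
    rw [Complex.exp_sub, hΛ', Complex.exp_log hne, div_mul_cancel₀ _ hne]
    simp

end PB

open Filter Set Topology MeasureTheory

namespace PB

structure Coord (I : Set ℝ) (σ : I → ℝ) (c : ℝ → I) : Prop where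
  sm : StrictMono σ
  sc : Continuous σ
  cm : Monotone c
  cc : Continuous c
  cs : ∀ y, c (σ y) = y
  tri : ∀ t, σ (c t) = t ∨ (t < σ (c t) ∧ IsBot (c t)) ∨ (σ (c t) < t ∧ IsTop (c t))

theorem half_top (I : Set ℝ) (hne : I.Nonempty) : ∃ R : I → ℝ, Monotone R ∧ Continuous R ∧ (∀ y, 0 ≤ R y) ∧
    ((¬ ∃ y : I, IsTop y) → ∀ B, ∃ y, B ≤ R y) := by
  by_cases ht : ∃ y : I, IsTop y
  · exact ⟨fun _ => 0, monotone_const, continuous_const, fun _ => le_rfl, fun h => absurd ht h⟩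
  by_cases hb : BddAbove I
  · have hlt : ∀ y : I, 0 < sSup I - y := by
      intro y
      have h1 := le_csSup hb y.2
      rcases h1.lt_or_eq with h | h
      · linarith
      · exact absurd ⟨y, fun z => Subtype.coe_le_coe.1 (by rw [h]; exact le_csSup hb z.2)⟩ ht
    refine ⟨fun y => (sSup I - y)⁻¹, ?_, ?_, fun y => (inv_pos.2 (hlt y)).le, ?_⟩
    · intro a b hab
      have : (a:ℝ) ≤ b := hab
      exact inv_anti₀ (hlt b) (by linarith)
    · exact Continuous.inv₀ (by fun_prop) fun y => (hlt y).ne'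
    · intro _ B
      obtain ⟨y, hy, hy'⟩ := exists_lt_of_lt_csSup hne
        (show sSup I - (max B 1)⁻¹ < sSup I by
          have : 0 < (max B 1)⁻¹ := inv_pos.2 (lt_max_of_lt_right one_pos)
          linarith)
      refine ⟨⟨y, hy⟩, (le_max_left B 1).trans ?_⟩
      rw [le_inv_comm₀ (lt_max_of_lt_right one_pos) (hlt ⟨y, hy⟩)]
      simp only
      linarith
  · refine ⟨fun y => max y 0, ?_, by fun_prop, fun y => le_max_right _ _, ?_⟩
    · intro a b hab
      exact max_le_max hab le_rfl
    · intro _ B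
      rw [not_bddAbove_iff] at hb
      obtain ⟨y, hy, h⟩ := hb B
      exact ⟨⟨y, hy⟩, h.le.trans (le_max_left _ _)⟩

theorem half_bot (I : Set ℝ) (hne : I.Nonempty) : ∃ L : I → ℝ, Antitone L ∧ Continuous L ∧
    (∀ y, 0 ≤ L y) ∧ ((¬ ∃ y : I, IsBot y) → ∀ B, ∃ y, B ≤ L y) := by
  obtain ⟨y0, hy0⟩ := hne
  obtain ⟨R, hR, hRc, hR0, hR1⟩ := half_top {x : ℝ | -x ∈ I} ⟨-y0, by simpa using hy0⟩
  refine ⟨fun y => R ⟨-y, by simp⟩, ?_, ?_, fun y => hR0 _, ?_⟩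
  · intro a b hab
    apply hR
    exact Subtype.coe_le_coe.1 (neg_le_neg (Subtype.coe_le_coe.2 hab))
  · exact hRc.comp (by fun_prop)
  · intro h B
    obtain ⟨y, hy⟩ := hR1 (by
      rintro ⟨y, hy⟩
      refine h ⟨⟨-y, y.2⟩, fun z => ?_⟩
      have : (-z : ℝ) ≤ y := hy ⟨-z, by simp⟩
      exact Subtype.coe_le_coe.1 (by simp only; linarith)) B
    refine ⟨⟨-y, y.2⟩, ?_⟩
    simpa using hy

theorem exists_coord (I : Set ℝ) [hI : I.OrdConnected] (hne : I.Nonempty) :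
    ∃ σ c, Coord I σ c := by
  obtain ⟨R, hR, hRc, hR0, hR1⟩ := half_top I hne
  obtain ⟨L, hL, hLc, hL0, hL1⟩ := half_bot I hne
  set σ : I → ℝ := fun y => y + R y - L y with hσ
  have hsm : StrictMono σ := by
    intro a b hab
    have h1 : (a:ℝ) < b := hab
    have h2 := hR hab.le
    have h3 := hL hab.le
    simp only [hσ]
    linarith
  have hsc : Continuous σ := by simp only [hσ]; fun_prop
  have htop : (¬ ∃ y : I, IsTop y) → ∀ B, ∃ y, B ≤ σ y := by
    intro h B
    obtain ⟨y0, hy0⟩ := hne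
    obtain ⟨y, hy⟩ := hR1 h (B - y0 + L ⟨y0, hy0⟩)
    refine ⟨max y ⟨y0, hy0⟩, ?_⟩
    have h1 := hR (le_max_left y ⟨y0, hy0⟩)
    have h2 := hL (le_max_right y ⟨y0, hy0⟩)
    have h3 : y0 ≤ ((max y ⟨y0, hy0⟩ : I) : ℝ) :=
      Subtype.coe_le_coe.2 (le_max_right y ⟨y0, hy0⟩)
    simp only [hσ]
    linarith
  have hbot : (¬ ∃ y : I, IsBot y) → ∀ B, ∃ y, σ y ≤ B := by
    intro h B
    obtain ⟨y0, hy0⟩ := hne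
    obtain ⟨y, hy⟩ := hL1 h (-B + y0 + R ⟨y0, hy0⟩)
    refine ⟨min y ⟨y0, hy0⟩, ?_⟩
    have h1 := hL (min_le_left y ⟨y0, hy0⟩)
    have h2 := hR (min_le_right y ⟨y0, hy0⟩)
    have h3 : ((min y ⟨y0, hy0⟩ : I) : ℝ) ≤ y0 :=
      Subtype.coe_le_coe.2 (min_le_right y ⟨y0, hy0⟩)
    simp only [hσ]
    linarith
  have hpre : PreconnectedSpace I := isPreconnected_iff_preconnectedSpace.1 hI.isPreconnected
  have hex : ∀ t : ℝ, ∃ y : I, σ y = t ∨ (t < σ y ∧ IsBot y) ∨ (σ y < t ∧ IsTop y) := by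
    intro t
    by_cases h1 : ∃ y, t ≤ σ y
    · by_cases h2 : ∃ y, σ y ≤ t
      · obtain ⟨y, hy⟩ := mem_range_of_exists_le_of_exists_ge hsc h2 h1
        exact ⟨y, Or.inl hy⟩
      · have : ∃ y : I, IsBot y := by by_contra h; exact h2 (hbot h t)
        push Not at h2
        obtain ⟨y, hy⟩ := this
        exact ⟨y, Or.inr (Or.inl ⟨h2 y, hy⟩)⟩
    · have : ∃ y : I, IsTop y := by by_contra h; exact h1 (htop h t)
      push Not at h1
      obtain ⟨y, hy⟩ := this
      exact ⟨y, Or.inr (Or.inr ⟨h1 y, hy⟩)⟩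
  choose c hc using hex
  have hcs : ∀ y, c (σ y) = y := by
    intro y
    rcases hc (σ y) with h | ⟨h, h'⟩ | ⟨h, h'⟩
    · exact hsm.injective h
    · exact absurd (hsm.lt_iff_lt.1 h) (not_lt.2 (h' y))
    · exact absurd (hsm.lt_iff_lt.1 h) (not_lt.2 (h' y))
  have hcm : Monotone c := by
    intro t t' htt
    by_contra hlt
    rw [not_le] at hlt
    have h0 := hsm hlt
    have h1 : σ (c t) ≤ t := by
      rcases hc t with h | ⟨_, h'⟩ | ⟨h, _⟩
      · exact h.le
      · exact absurd hlt (not_lt.2 (h' _))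
      · exact h.le
    have h2 : t' ≤ σ (c t') := by
      rcases hc t' with h | ⟨h, _⟩ | ⟨_, h'⟩
      · exact h.ge
      · exact h.le
      · exact absurd hlt (not_lt.2 (h' _))
    linarith
  exact ⟨σ, c, hsm, hsc, hcm, hcm.continuous_of_surjective fun y => ⟨σ y, hcs y⟩, hcs, hc⟩

noncomputable def mkC (a b : ℝ) : ℂ := a + b * Complex.I

@[simp] theorem mkC_re (a b : ℝ) : (mkC a b).re = a := by simp [mkC]
@[simp] theorem mkC_im (a b : ℝ) : (mkC a b).im = b := by simp [mkC]

variable {I : Set ℝ} {σ : I → ℝ} {c : ℝ → I}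

def rr (c : ℝ → I) (z : ℂ) : StripT I := (z.re, c z.im)

noncomputable def ext (σ : I → ℝ) (c : ℝ → I) (F : StripT I → StripT I) (z : ℂ) : ℂ :=
  mkC (F (rr c z)).1 (σ (F (rr c z)).2 + z.im - σ (c z.im))

/-- boundary preserving -/
def BP (F : StripT I → StripT I) : Prop :=
  ∀ z : StripT I, IsTop z.2 ∨ IsBot z.2 → (F z).2 = z.2

theorem Coord.eq_or (h : Coord I σ c) (t : ℝ) :
    σ (c t) = t ∨ (IsTop (c t) ∨ IsBot (c t)) := by
  rcases h.tri t with h | h | h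
  · exact Or.inl h
  · exact Or.inr (Or.inr h.2)
  · exact Or.inr (Or.inl h.2)

theorem ext_rr (h : Coord I σ c) {F : StripT I → StripT I} (hF : BP F) (z : ℂ) :
    rr c (ext σ c F z) = F (rr c z) := by
  refine Prod.ext (by simp [rr, ext]) ?_
  simp only [ext, rr, mkC_im]
  rcases h.eq_or z.im with h1 | h1
  · rw [h1, add_sub_cancel_right, h.cs]
  · have := hF (z.re, c z.im) h1
    simp only at this
    rw [this, add_sub_cancel_left]

theorem ext_inv (h : Coord I σ c) {F G : StripT I → StripT I} (hF : BP F)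
    (hGF : ∀ z, G (F z) = z) (z : ℂ) : ext σ c G (ext σ c F z) = z := by
  have h1 := ext_rr h hF z
  have h2 : c (ext σ c F z).im = (F (rr c z)).2 := congrArg Prod.snd h1
  have h3 : ext σ c G (ext σ c F z) = mkC (G (F (rr c z))).1
    (σ (G (F (rr c z))).2 + (ext σ c F z).im - σ (F (rr c z)).2) := by
    rw [ext, h1, h2]
  rw [h3, hGF]
  apply Complex.ext
  · simp [rr]
  · simp [rr, ext]

theorem ext_continuous (h : Coord I σ c) {F : StripT I → StripT I} (hF : Continuous F) :
    Continuous (ext σ c F) := by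
  have := h.sc
  have := h.cc
  have : Continuous (rr c) := by unfold rr; fun_prop
  unfold ext mkC
  fun_prop

theorem ext_collar {F : StripT I → StripT I} (hF : BP F) (z : ℂ)
    (hz : IsTop (c z.im) ∨ IsBot (c z.im)) : (ext σ c F z).im = z.im := by
  have := hF (rr c z) hz
  rw [ext, mkC_im, this]
  exact add_sub_cancel_left _ _

theorem top_ends (F : StripT I → StripT I) (hne : Nonempty I)
    (hend : Tendsto (fun z : StripT I => (F z).2)
      (Filter.comap (Prod.snd : StripT I → I) atTop) atTop) (b : I) :
    ∃ a : I, ∀ z : StripT I, a ≤ z.2 → b ≤ (F z).2 := by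
  have := hend (Ici_mem_atTop b)
  rw [Filter.mem_map, Filter.mem_comap] at this
  obtain ⟨t, ht, hts⟩ := this
  obtain ⟨a, ha⟩ := mem_atTop_sets.1 ht
  exact ⟨a, fun z hz => hts (show z.2 ∈ t from ha _ hz)⟩

theorem bot_ends (F : StripT I → StripT I) (hne : Nonempty I)
    (hend : Tendsto (fun z : StripT I => (F z).2)
      (Filter.comap (Prod.snd : StripT I → I) atBot) atBot) (b : I) :
    ∃ a : I, ∀ z : StripT I, z.2 ≤ a → (F z).2 ≤ b := by
  have := hend (Iic_mem_atBot b)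
  rw [Filter.mem_map, Filter.mem_comap] at this
  obtain ⟨t, ht, hts⟩ := this
  obtain ⟨a, ha⟩ := mem_atBot_sets.1 ht
  exact ⟨a, fun z hz => hts (show z.2 ∈ t from ha _ hz)⟩

theorem BP_of_ends {F : StripT I → StripT I}
    (h1 : ∀ b : I, ∃ a : I, ∀ z : StripT I, a ≤ z.2 → b ≤ (F z).2)
    (h2 : ∀ b : I, ∃ a : I, ∀ z : StripT I, z.2 ≤ a → (F z).2 ≤ b) : BP F := by
  rintro z (hz | hz)
  · obtain ⟨a, ha⟩ := h1 z.2
    exact le_antisymm (hz _) (ha z (hz a))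
  · obtain ⟨a, ha⟩ := h2 z.2
    exact le_antisymm (ha z (hz a)) (hz _)

theorem BP_symm {F : StripT I ≃ₜ StripT I} (hF : BP F)
    (hcomm : ∀ z : StripT I, F (z.1 + 1, z.2) = ((F z).1 + 1, (F z).2)) : BP F.symm := by
  intro z hz
  have hintg := fun m : ℤ => strip_int (I := I) (G := F) hcomm m (0, z.2)
  have hc : Continuous fun x : ℝ => (F (x, z.2)).1 := by fun_prop
  have : ∃ x, (F (x, z.2)).1 = z.1 := by
    apply mem_range_of_exists_le_of_exists_ge hc
    · refine ⟨((⌊z.1 - (F (0, z.2)).1⌋ : ℤ) : ℝ), ?_⟩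
      have := hintg ⌊z.1 - (F (0, z.2)).1⌋
      simp only [zero_add] at this
      rw [this]
      simp only
      linarith [Int.floor_le (z.1 - (F (0, z.2)).1)]
    · refine ⟨((⌈z.1 - (F (0, z.2)).1⌉ : ℤ) : ℝ), ?_⟩
      have := hintg ⌈z.1 - (F (0, z.2)).1⌉
      simp only [zero_add] at this
      rw [this]
      simp only
      linarith [Int.le_ceil (z.1 - (F (0, z.2)).1)]
  obtain ⟨x, hx⟩ := this
  have : F (x, z.2) = z := Prod.ext hx (hF (x, z.2) hz)
  have h' : F.symm z = (x, z.2) := by rw [← F.symm_apply_apply (x, z.2), this]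
  rw [h']

theorem exists_ext (h : Coord I σ c) (F : StripT I ≃ₜ StripT I)
    (hcomm : ∀ z : StripT I, F (z.1 + 1, z.2) = ((F z).1 + 1, (F z).2))
    (h1 : ∀ b : I, ∃ a : I, ∀ z : StripT I, a ≤ z.2 → b ≤ (F z).2)
    (h2 : ∀ b : I, ∃ a : I, ∀ z : StripT I, z.2 ≤ a → (F z).2 ≤ b) :
    ∃ Φ : ℂ ≃ₜ ℂ, (∀ z, rr c (Φ z) = F (rr c z)) ∧ (∀ z, Φ (z + 1) = Φ z + 1) ∧ OP Φ ∧
      (∀ x y, Φ (mkC x (σ y)) = mkC (F (x, y)).1 (σ (F (x, y)).2)) ∧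
      (∀ z, IsTop (c z.im) ∨ IsBot (c z.im) → (Φ z).im = z.im) ∧
      (∀ z, IsTop (c z.im) ∨ IsBot (c z.im) → (Φ.symm z).im = z.im) ∧
      (∀ B : ℝ, ∃ M : ℝ, ∀ z : ℂ, M ≤ z.im → B ≤ (Φ z).im) ∧
      (∀ B : ℝ, ∃ M : ℝ, ∀ z : ℂ, z.im ≤ M → (Φ z).im ≤ B) := by
  have hF := BP_of_ends h1 h2
  have hF' := BP_symm hF hcomm
  let Φ : ℂ ≃ₜ ℂ :=
    { toFun := ext σ c F
      invFun := ext σ c F.symm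
      left_inv := ext_inv h hF F.symm_apply_apply
      right_inv := ext_inv h hF' F.apply_symm_apply
      continuous_toFun := ext_continuous h F.continuous
      continuous_invFun := ext_continuous h F.symm.continuous }
  have hΦ : ∀ z, Φ z = ext σ c F z := fun _ => rfl
  have hΦs : ∀ z, Φ.symm z = ext σ c F.symm z := fun _ => rfl
  have hcm : ∀ z, Φ (z + 1) = Φ z + 1 := by
    intro z
    have hr : rr c (z + 1) = ((rr c z).1 + 1, (rr c z).2) := by simp [rr]
    rw [hΦ, hΦ, ext, ext, hr, hcomm]
    apply Complex.ext <;> simp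
  have htop : ∀ B : ℝ, ∃ M : ℝ, ∀ z : ℂ, M ≤ z.im → B ≤ (Φ z).im := by
    intro B
    by_cases ht : ∃ y : I, IsTop y
    · obtain ⟨y, hy⟩ := ht
      refine ⟨max B (σ y), fun z hz => ?_⟩
      rw [hΦ, ext_collar hF z]
      · exact (le_max_left _ _).trans hz
      · left
        have := h.cm ((le_max_right _ _).trans hz)
        rw [h.cs] at this
        exact fun w => (hy w).trans this
    · push Not at ht
      obtain ⟨a, ha⟩ := h1 (c B)
      have hlt := ht a
      simp only [IsTop, not_forall, not_le] at hlt
      obtain ⟨a', ha'⟩ := hlt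
      refine ⟨σ a', fun z hz => ?_⟩
      have hz' := h.cm hz
      rw [h.cs] at hz'
      have h3 : σ (c z.im) = z.im := by
        rcases h.tri z.im with h | ⟨_, h⟩ | ⟨_, h⟩
        · exact h
        · exact absurd (h a) (not_le.2 (ha'.trans_le hz'))
        · exact absurd h (ht _)
      have h4 : B ≤ σ (c B) := by
        rcases h.tri B with h | ⟨h, _⟩ | ⟨_, h⟩
        · exact h.ge
        · exact h.le
        · exact absurd h (ht _)
      have h5 := ha (rr c z) (ha'.le.trans hz')
      rw [hΦ, ext, mkC_im, h3, add_sub_cancel_right]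
      exact h4.trans (h.sm.monotone h5)
  have hbot : ∀ B : ℝ, ∃ M : ℝ, ∀ z : ℂ, z.im ≤ M → (Φ z).im ≤ B := by
    intro B
    by_cases ht : ∃ y : I, IsBot y
    · obtain ⟨y, hy⟩ := ht
      refine ⟨min B (σ y), fun z hz => ?_⟩
      rw [hΦ, ext_collar hF z]
      · exact hz.trans (min_le_left _ _)
      · right
        have := h.cm (hz.trans (min_le_right _ _))
        rw [h.cs] at this
        exact fun w => this.trans (hy w)
    · push Not at ht
      obtain ⟨a, ha⟩ := h2 (c B)
      have hlt := ht a
      simp only [IsBot, not_forall, not_le] at hlt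
      obtain ⟨a', ha'⟩ := hlt
      refine ⟨σ a', fun z hz => ?_⟩
      have hz' := h.cm hz
      rw [h.cs] at hz'
      have h3 : σ (c z.im) = z.im := by
        rcases h.tri z.im with h | ⟨_, h⟩ | ⟨_, h⟩
        · exact h
        · exact absurd h (ht _)
        · exact absurd (h a) (not_le.2 (hz'.trans_lt ha'))
      have h4 : σ (c B) ≤ B := by
        rcases h.tri B with h | ⟨_, h⟩ | ⟨h, _⟩
        · exact h.le
        · exact absurd h (ht _)
        · exact h.le
      have h5 := ha (rr c z) (hz'.trans ha'.le)
      rw [hΦ, ext, mkC_im, h3, add_sub_cancel_right]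
      exact (h.sm.monotone h5).trans h4
  refine ⟨Φ, fun z => ext_rr h hF z, hcm, op_of_ends Φ.continuous Φ.injective hcm htop hbot, ?_,
    fun z hz => ext_collar hF z hz, fun z hz => ext_collar hF' z hz, htop, hbot⟩
  intro x y
  have hr : rr c (mkC x (σ y)) = (x, y) := by simp [rr, h.cs]
  rw [hΦ, ext, hr, mkC_im, h.cs, add_sub_cancel_right]

end PB

open Filter Set Topology MeasureTheory

namespace PB

theorem infDist_per {P : Set ℂ} (hP : ∀ z : ℂ, z + 1 ∈ P ↔ z ∈ P) (z : ℂ) :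
    Metric.infDist (z + 1) P = Metric.infDist z P := by
  have h1 : (fun z : ℂ => z + 1) '' P = P := by
    ext w
    constructor
    · rintro ⟨v, hv, rfl⟩; exact (hP v).2 hv
    · intro hw
      exact ⟨w - 1, (hP _).1 (by simpa using hw), by simp⟩
  have h2 : Isometry (fun z : ℂ => z + 1) := isometry_add_right 1
  have := Metric.infDist_image (t := P) (x := z) h2
  rwa [h1] at this

theorem per_ury {P Q : Set ℂ} (hPc : IsClosed P) (hQc : IsClosed Q) (hPQ : Disjoint P Q)
    (hPn : P.Nonempty) (hQn : Q.Nonempty) (hP : ∀ z : ℂ, z + 1 ∈ P ↔ z ∈ P)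
    (hQ : ∀ z : ℂ, z + 1 ∈ Q ↔ z ∈ Q) :
    ∃ u : ℂ → ℝ, Continuous u ∧ (∀ z, u (z + 1) = u z) ∧ (∀ z ∈ P, u z = 0) ∧
      (∀ z ∈ Q, u z = 1) ∧ (∀ z, u z ≤ 1) := by
  have hpos : ∀ z, 0 < Metric.infDist z P + Metric.infDist z Q := by
    intro z
    have h1 : 0 ≤ Metric.infDist z P := Metric.infDist_nonneg
    have h2 : 0 ≤ Metric.infDist z Q := Metric.infDist_nonneg
    by_contra h
    have e1 : Metric.infDist z P = 0 := by linarith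
    have e2 : Metric.infDist z Q = 0 := by linarith
    exact Set.disjoint_left.1 hPQ ((hPc.mem_iff_infDist_zero hPn).2 e1)
      ((hQc.mem_iff_infDist_zero hQn).2 e2)
  refine ⟨fun z => Metric.infDist z P / (Metric.infDist z P + Metric.infDist z Q), ?_, ?_, ?_, ?_,
    ?_⟩
  · have h1 := Metric.continuous_infDist_pt P
    have h2 := Metric.continuous_infDist_pt Q
    exact h1.div (h1.add h2) fun z => (hpos z).ne'
  · intro z
    simp only [infDist_per hP, infDist_per hQ]
  · intro z hz
    simp [(hPc.mem_iff_infDist_zero hPn).1 hz]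
  · intro z hz
    have := hpos z
    have h0 := (hQc.mem_iff_infDist_zero hQn).1 hz
    simp only [h0, add_zero] at this ⊢
    exact div_self this.ne'
  · intro z
    rw [div_le_one (hpos z)]
    linarith [Metric.infDist_nonneg (x := z) (s := Q)]

theorem closure_per {O : Set ℂ} (hO : ∀ z : ℂ, z + 1 ∈ O ↔ z ∈ O) (z : ℂ) :
    z + 1 ∈ closure O ↔ z ∈ closure O := by
  have h := (Homeomorph.addRight (1:ℂ)).preimage_closure O
  have h2 : (Homeomorph.addRight (1:ℂ)) ⁻¹' O = O := by
    ext w; exact hO w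
  rw [h2] at h
  exact (Set.ext_iff.1 h z)

/-- control of the ends by iterates -/
theorem ends_iter {Φ : ℂ → ℂ} {s : ℝ}
    (h : ∀ B : ℝ, ∃ M : ℝ, ∀ z : ℂ, M ≤ s * z.im → B ≤ s * (Φ z).im) (n : ℕ) :
    ∀ B : ℝ, ∃ M : ℝ, ∀ z : ℂ, M ≤ s * z.im → ∀ k ≤ n, B ≤ s * (Φ^[k] z).im := by
  induction n with
  | zero =>
    intro B
    refine ⟨B, fun z hz k hk => ?_⟩
    obtain rfl : k = 0 := by omega
    exact hz
  | succ n ih =>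
    intro B
    obtain ⟨M, hM⟩ := ih B
    obtain ⟨M', hM'⟩ := h M
    refine ⟨max B M', fun z hz k hk => ?_⟩
    cases k with
    | zero => exact (le_max_left _ _).trans hz
    | succ k =>
      rw [Function.iterate_succ_apply]
      exact hM _ (hM' _ ((le_max_right _ _).trans hz)) k (by omega)

theorem root {Φ : ℂ → ℂ} (hc : Continuous Φ) (hcomm : ∀ z, Φ (z + 1) = Φ z + 1)
    (htop : ∀ B : ℝ, ∃ M : ℝ, ∀ z : ℂ, M ≤ z.im → B ≤ (Φ z).im)
    (hbot : ∀ B : ℝ, ∃ M : ℝ, ∀ z : ℂ, z.im ≤ M → (Φ z).im ≤ B)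
    {q : ℕ} (hq : 1 ≤ q) {O : Set ℂ} (hO : IsOpen O) (hOp : ∀ z : ℂ, z + 1 ∈ O ↔ z ∈ O)
    (hOq : ∀ z, Φ^[q] z ∈ closure O → z ∈ O) (hE : Ends O) :
    ∃ V : Set ℂ, IsOpen V ∧ (∀ z : ℂ, z + 1 ∈ V ↔ z ∈ V) ∧
      (∀ z, Φ z ∈ closure V → z ∈ V) ∧ Ends V := by
  obtain ⟨s, hs, M, hM1, hM2⟩ := hE
  have hs2 : s * s = 1 := by rcases hs with rfl | rfl <;> norm_num
  have hE1 : ∀ B : ℝ, ∃ M : ℝ, ∀ z : ℂ, M ≤ s * z.im → B ≤ s * (Φ z).im := by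
    intro B
    rcases hs with rfl | rfl
    · simpa using htop B
    · obtain ⟨M, hM⟩ := hbot (-B)
      exact ⟨-M, fun z hz => by have := hM z (by linarith); linarith⟩
  have hE2 : ∀ B : ℝ, ∃ M : ℝ, ∀ z : ℂ, M ≤ (-s) * z.im → B ≤ (-s) * (Φ z).im := by
    intro B
    rcases hs with rfl | rfl
    · obtain ⟨M, hM⟩ := hbot (-B)
      exact ⟨-M, fun z hz => by have := hM z (by linarith); linarith⟩
    · simpa using htop B
  have hitc : ∀ n, Continuous Φ^[n] := fun n => hc.iterate n
  set P : Set ℂ := Φ^[q] ⁻¹' closure O with hP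
  have hPc : IsClosed P := isClosed_closure.preimage (hitc q)
  have hPp : ∀ z : ℂ, z + 1 ∈ P ↔ z ∈ P := by
    intro z
    rw [hP, mem_preimage, mem_preimage, comm_iter hcomm]
    exact closure_per hOp _
  obtain ⟨N1, hN1⟩ := ends_iter hE1 (2 * q) M
  obtain ⟨N2, hN2⟩ := ends_iter hE2 q M
  have hbig : ∀ z : ℂ, N1 ≤ s * z.im → ∀ j < q, Φ^[j] z ∈ P := by
    intro z hz j hj
    rw [hP, mem_preimage, ← Function.iterate_add_apply]
    exact subset_closure (hM1 _ (hN1 z hz _ (by omega)))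
  have hpt : ∀ t : ℝ, s * (mkC 0 (s * t)).im = t := by
    intro t; rw [mkC_im, ← mul_assoc, hs2, one_mul]
  obtain ⟨φ, hφc, hφp, hφP, hφQ, hφ1⟩ := per_ury (P := P) (Q := Oᶜ) hPc hO.isClosed_compl
    (Set.disjoint_left.2 fun z hz hz' => hz' (hOq z hz))
    ⟨mkC 0 (s * N1), hbig _ (hpt N1).ge 0 (by omega)⟩
    ⟨mkC 0 (s * (-M)), hM2 _ (hpt _).le⟩ hPp (fun z => not_congr (hOp z))
  have hq0 : (0:ℝ) < q := by exact_mod_cast hq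
  refine ⟨{z | ∀ j ∈ Finset.range q, φ (Φ^[j] z) < (j + 1) / q}, ?_, ?_, ?_, s, hs, max N1 N2, ?_, ?_⟩
  · have : {z | ∀ j ∈ Finset.range q, φ (Φ^[j] z) < (j + 1) / q} =
        ⋂ j ∈ Finset.range q, {z | φ (Φ^[j] z) < (j + 1) / q} := by
      ext z; simp
    rw [this]
    refine isOpen_biInter_finset fun j _ => ?_
    exact isOpen_lt (hφc.comp (hitc j)) continuous_const
  · intro z
    change (∀ j ∈ Finset.range q, φ (Φ^[j] (z + 1)) < (j + 1) / q) ↔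
      ∀ j ∈ Finset.range q, φ (Φ^[j] z) < (j + 1) / q
    simp only [comm_iter hcomm, hφp]
  · intro z hz
    have h1 : ∀ j ∈ Finset.range q, φ (Φ^[j] (Φ z)) ≤ (j + 1) / q := by
      intro j hj
      have : closure {z | ∀ j ∈ Finset.range q, φ (Φ^[j] z) < (j + 1) / q} ⊆
          {z | φ (Φ^[j] z) ≤ (j + 1) / q} :=
        closure_minimal (fun w hw => (hw j hj).le)
          (isClosed_le (hφc.comp (hitc j)) continuous_const)
      exact this hz
    have h2 : Φ^[q - 1] (Φ z) ∈ closure O := by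
      have : closure {z | ∀ j ∈ Finset.range q, φ (Φ^[j] z) < (j + 1) / q} ⊆
          Φ^[q - 1] ⁻¹' closure O := by
        refine closure_minimal (fun w hw => subset_closure ?_)
          (isClosed_closure.preimage (hitc _))
        have := hw (q - 1) (by simp; omega)
        have e : ((q - 1 : ℕ) : ℝ) + 1 = q := by exact_mod_cast Nat.sub_add_cancel hq
        rw [e, div_self hq0.ne'] at this
        by_contra h
        rw [hφQ _ h] at this
        exact lt_irrefl _ this
      exact this hz
    rw [← Function.iterate_succ_apply, Nat.succ_eq_add_one, Nat.sub_add_cancel hq] at h2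
    intro j hj
    cases j with
    | zero =>
      rw [Function.iterate_zero, id, hφP z h2]
      positivity
    | succ i =>
      rw [Function.iterate_succ_apply]
      refine (h1 i (by simp at hj ⊢; omega)).trans_lt ?_
      gcongr
      simp
  · intro z hz j hj
    rw [hφP _ (hbig z ((le_max_left _ _).trans hz) j (by simpa using hj))]
    positivity
  · intro z hz h
    have := h (q - 1) (by simp; omega)
    have e : ((q - 1 : ℕ) : ℝ) + 1 = q := by exact_mod_cast Nat.sub_add_cancel hq
    rw [e, div_self hq0.ne'] at this
    have h3 := hN2 z (by have := le_max_right N1 N2; linarith) (q - 1) (by omega)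
    rw [hφQ _ (hM2 _ (by linarith))] at this
    exact lt_irrefl _ this

theorem clopen_lines {X : Set ℂ} (hX : IsClosed X) (hXp : ∀ z : ℂ, z + 1 ∈ X ↔ z ∈ X)
    {J : Set ℝ} (hJ : IsPreconnected J)
    (h : ∀ t ∈ J, (∀ x, mkC x t ∈ X) → ∀ x, mkC x t ∈ interior X)
    {t0 : ℝ} (ht0 : t0 ∈ J) (h0 : ∀ x, mkC x t0 ∈ X) : ∀ t ∈ J, ∀ x, mkC x t ∈ X := by
  have hmk : Continuous fun p : ℝ × ℝ => mkC p.1 p.2 := by unfold mkC; fun_prop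
  set B : Set ℝ := {t | ∀ x ∈ Icc (0:ℝ) 1, mkC x t ∈ interior X} with hB
  set A : Set ℝ := {t | ∀ x, mkC x t ∈ X} with hA
  have hperZ : ∀ (n : ℤ) (z : ℂ), z + n ∈ X ↔ z ∈ X := by
    intro n
    induction n using Int.induction_on with
    | zero => simp
    | succ i ih => intro z; rw [← ih z, ← hXp (z + (i:ℤ))]; push_cast; rw [add_assoc]
    | pred i ih => intro z; rw [← ih z, ← hXp (z + ((-i - 1 : ℤ) : ℂ))]; push_cast; ring_nf
  have hBA : B ⊆ A := by
    intro t ht x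
    have h1 := interior_subset (ht (x - ⌊x⌋) ⟨by linarith [Int.floor_le x],
      by linarith [Int.lt_floor_add_one x]⟩)
    rw [← hperZ ⌊x⌋] at h1
    convert h1 using 1
    apply Complex.ext <;> simp
  have hBo : IsOpen B := by
    rw [isOpen_iff_mem_nhds]
    intro t ht
    have := isCompact_Icc.eventually_forall_of_forall_eventually (x₀ := t) (K := Icc (0:ℝ) 1)
      (P := fun t x => mkC x t ∈ interior X) (by
        intro x hx
        have hcont : ContinuousAt (fun p : ℝ × ℝ => mkC p.2 p.1) (t, x) :=
          (hmk.comp continuous_swap).continuousAt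
        exact hcont.eventually (isOpen_interior.mem_nhds (ht x hx)))
    exact this
  have hAc : IsClosed A := by
    have : A = ⋂ x, (fun t => mkC x t) ⁻¹' X := by ext t; simp [hA]
    rw [this]
    exact isClosed_iInter fun x => hX.preimage (by unfold mkC; fun_prop)
  have := hJ.subset_left_of_subset_union hBo hAc.isOpen_compl
    (Set.disjoint_left.2 fun t ht ht' => ht' (hBA ht))
    (fun t ht => by
      by_cases h' : t ∈ A
      · exact Or.inl fun x _ => h t ht h' x
      · exact Or.inr h')
    ⟨t0, ht0, fun x _ => h t0 ht0 h0 x⟩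
  exact fun t ht x => hBA (this ht) x

theorem band {Φ : ℂ ≃ₜ ℂ} (hcomm : ∀ z, Φ (z + 1) = Φ z + 1)
    {V : Set ℂ} (hV : IsOpen V) (hVp : ∀ z : ℂ, z + 1 ∈ V ↔ z ∈ V)
    (hVΦ : ∀ z, Φ z ∈ closure V → z ∈ V) (hE : Ends V) (htop : ∀ B : ℝ, ∃ M : ℝ, ∀ z : ℂ, M ≤ z.im → B ≤ (Φ z).im)
    (hbot : ∀ B : ℝ, ∃ M : ℝ, ∀ z : ℂ, z.im ≤ M → (Φ z).im ≤ B)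
    (Col : ℝ → Prop) (hC : ∀ t, Col t → (∀ t' ≥ t, Col t') ∨ (∀ t' ≤ t, Col t'))
    (hC1 : ∀ z, Col z.im → (Φ z).im = z.im) (hC2 : ∀ z, Col z.im → (Φ.symm z).im = z.im) :
    ∃ u : ℂ → ℝ, Continuous u ∧ (∀ z, u (z + 1) = u z) ∧
      (∃ s : ℝ, (s = 1 ∨ s = -1) ∧ ∃ M, (∀ z : ℂ, M ≤ s * z.im → u z = 0) ∧
        (∀ z : ℂ, s * z.im ≤ -M → u z = 1)) ∧
      (∀ z, 0 < u z → u z < 1 → 0 < u (Φ z) → u (Φ z) < 1 → False) ∧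
      (∀ z : ℂ, Col z.im → u z = 0 ∨ u z = 1) := by
  obtain ⟨s, hs, M, hM1, hM2⟩ := hE
  have hs2 : s * s = 1 := by rcases hs with rfl | rfl <;> norm_num
  have hE1 : ∃ M' : ℝ, ∀ z : ℂ, M' ≤ s * z.im → M ≤ s * (Φ z).im := by
    rcases hs with rfl | rfl
    · simpa using htop M
    · obtain ⟨M, hM⟩ := hbot (-M)
      exact ⟨-M, fun z hz => by have := hM z (by linarith); linarith⟩
  obtain ⟨M', hM'⟩ := hE1
  set P : Set ℂ := Φ ⁻¹' closure V with hP
  have hPc : IsClosed P := isClosed_closure.preimage Φ.continuous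
  have hPp : ∀ z : ℂ, z + 1 ∈ P ↔ z ∈ P := by
    intro z
    rw [hP, mem_preimage, mem_preimage, hcomm]
    exact closure_per hVp _
  have hbig : ∀ z : ℂ, M' ≤ s * z.im → z ∈ P := fun z hz => subset_closure (hM1 _ (hM' z hz))
  have hpt : ∀ t : ℝ, s * (mkC 0 (s * t)).im = t := by
    intro t; rw [mkC_im, ← mul_assoc, hs2, one_mul]
  obtain ⟨u, huc, hup, huP, huQ, -⟩ := per_ury (P := P) (Q := Vᶜ) hPc hV.isClosed_compl
    (Set.disjoint_left.2 fun z hz hz' => hz' (hVΦ z hz))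
    ⟨mkC 0 (s * M'), hbig _ (hpt _).ge⟩
    ⟨mkC 0 (s * (-M)), hM2 _ (hpt _).le⟩ hPp (fun z => not_congr (hVp z))
  refine ⟨u, huc, hup, ⟨s, hs, max M M', fun z hz => huP z (hbig z ((le_max_right _ _).trans hz)),
    fun z hz => huQ z (hM2 z (by have := le_max_left M M'; linarith))⟩, ?_, ?_⟩
  · intro z h1 h2 h3 h4
    by_cases h : Φ z ∈ V
    · rw [huP z (subset_closure h)] at h1
      exact lt_irrefl _ h1
    · rw [huQ _ h] at h4
      exact lt_irrefl _ h4
  · intro z hz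
    -- a connected set of collar heights going to infinity
    have key : ∀ J : Set ℝ, IsPreconnected J → (∀ t ∈ J, Col t) → z.im ∈ J →
        ((∃ t ∈ J, M ≤ s * t) ∨ ∃ t ∈ J, s * t ≤ -M) → u z = 0 ∨ u z = 1 := by
      intro J hJ hJC hzJ hJM
      have hzz : mkC z.re z.im = z := Complex.ext (by simp) (by simp)
      have hline : ∀ t ∈ J, ∀ x, ∃ x', Φ (mkC x t) = mkC x' t := by
        intro t ht x
        refine ⟨(Φ (mkC x t)).re, Complex.ext (by simp) ?_⟩
        rw [hC1 _ (by simpa using hJC t ht)]; simp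
      have hline' : ∀ t ∈ J, ∀ x, ∃ x', Φ (mkC x' t) = mkC x t := by
        intro t ht x
        refine ⟨(Φ.symm (mkC x t)).re, ?_⟩
        have : mkC (Φ.symm (mkC x t)).re t = Φ.symm (mkC x t) := by
          refine Complex.ext (by simp) ?_
          rw [hC2 _ (by simpa using hJC t ht)]; simp
        rw [this, Φ.apply_symm_apply]
      rcases hJM with ⟨t, ht, htM⟩ | ⟨t, ht, htM⟩
      · left
        have h := clopen_lines (X := closure V) isClosed_closure (closure_per hVp) hJ (by
          intro t ht h x
          obtain ⟨x', hx'⟩ := hline t ht x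
          refine interior_mono subset_closure (hV.interior_eq.symm ▸ hVΦ _ ?_)
          rw [hx']; exact h x') ht (fun x => subset_closure (hM1 _ (by simpa using htM)))
        apply huP
        obtain ⟨x', hx'⟩ := hline z.im hzJ z.re
        rw [hP, mem_preimage, ← hzz, hx']
        exact h _ hzJ _
      · right
        have h := clopen_lines (X := Vᶜ) hV.isClosed_compl (fun z => not_congr (hVp z)) hJ (by
          intro t ht h x
          obtain ⟨x', hx'⟩ := hline' t ht x
          rw [interior_compl, mem_compl_iff, ← hx']
          intro h'
          exact h x' (hVΦ _ h')) ht (fun x => hM2 _ (by simpa using htM))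
        apply huQ
        rw [← hzz]
        exact h _ hzJ _
    rcases hC _ hz with h | h
    · apply key (Ici z.im) isPreconnected_Ici h self_mem_Ici
      rcases hs with rfl | rfl
      · exact Or.inl ⟨max z.im M, mem_Ici.2 (le_max_left _ _), by simp⟩
      · refine Or.inr ⟨max z.im M, mem_Ici.2 (le_max_left _ _), ?_⟩
        have := le_max_right z.im M
        linarith
    · apply key (Iic z.im) isPreconnected_Iic h self_mem_Iic
      rcases hs with rfl | rfl
      · refine Or.inr ⟨min z.im (-M), mem_Iic.2 (min_le_left _ _), ?_⟩
        have := min_le_right z.im (-M)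
        linarith
      · refine Or.inl ⟨min z.im (-M), mem_Iic.2 (min_le_left _ _), ?_⟩
        have := min_le_right z.im (-M)
        linarith

end PB

open Filter Set Topology MeasureTheory

namespace PB

def Om (u : ℂ → ℝ) : Set ℂ := {z | 0 < u z ∧ u z < 1}

theorem Om_open {u : ℂ → ℝ} (hu : Continuous u) : IsOpen (Om u) :=
  (isOpen_lt continuous_const hu).inter (isOpen_lt hu continuous_const)

theorem u_int {u : ℂ → ℝ} (hp : ∀ z, u (z + 1) = u z) (n : ℤ) : ∀ z, u (z + n) = u z := by
  induction n using Int.induction_on with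
  | zero => simp
  | succ i ih => intro z; rw [← ih z, ← hp (z + (i:ℤ))]; push_cast; rw [add_assoc]
  | pred i ih => intro z; rw [← ih z, ← hp (z + ((-i - 1 : ℤ) : ℂ))]; push_cast; ring_nf

theorem Om_int {u : ℂ → ℝ} (hp : ∀ z, u (z + 1) = u z) (n : ℤ) (z : ℂ) :
    z + n ∈ Om u ↔ z ∈ Om u := by
  change (0 < u (z + n) ∧ u (z + n) < 1) ↔ (0 < u z ∧ u z < 1)
  rw [u_int hp]

theorem Om_joined_int {u : ℂ → ℝ} (hp : ∀ z, u (z + 1) = u z) {z w : ℂ} (n : ℤ)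
    (h : JoinedIn (Om u) z w) : JoinedIn (Om u) (z + n) (w + n) := by
  exact joined_translate h fun v hv => (Om_int hp n v).2 hv

/-- an equivariant locally constant function if there is no essential path -/
theorem exists_m {u : ℂ → ℝ} (hu : Continuous u) (hp : ∀ z, u (z + 1) = u z)
    (hno : ∀ z : ℂ, ∀ k : ℤ, JoinedIn (Om u) z (z + k) → k = 0) :
    ∃ m : ℂ → ℤ, (∀ z ∈ Om u, m (z + 1) = m z + 1) ∧
      ∀ z ∈ Om u, ∀ᶠ w in 𝓝 z, m w = m z := by
  classical
  let S : Setoid (Om u) :=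
    { r := fun z w => ∃ k : ℤ, JoinedIn (Om u) (z:ℂ) ((w:ℂ) + k)
      iseqv :=
        { refl := fun z => ⟨0, by simpa using JoinedIn.refl z.2⟩
          symm := by
            rintro z w ⟨k, hk⟩
            refine ⟨-k, ?_⟩
            have := Om_joined_int hp (-k) hk.symm
            simpa using this
          trans := by
            rintro z w v ⟨k, hk⟩ ⟨l, hl⟩
            refine ⟨l + k, ?_⟩
            have := hk.trans (Om_joined_int hp k hl)
            simpa [add_assoc] using this } }
  let ρ : Om u → Om u := fun z => (Quotient.mk S z).out
  have hρ : ∀ z : Om u, ∃ k : ℤ, JoinedIn (Om u) (z:ℂ) ((ρ z : ℂ) + k) := fun z =>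
    S.symm (Quotient.exact (Quotient.out_eq (Quotient.mk S z)))
  choose m hm using hρ
  have huniq : ∀ (z w : Om u) (k : ℤ), JoinedIn (Om u) (w:ℂ) ((z:ℂ) + k) → m w = m z + k := by
    intro z w k h
    have e : ρ w = ρ z := by
      have : Quotient.mk S w = Quotient.mk S z := Quotient.sound ⟨k, h⟩
      simp only [ρ, this]
    have h1 := hm w
    rw [e] at h1
    have h2 := h1.symm.trans (h.trans (Om_joined_int hp k (hm z)))
    have h3 := Om_joined_int hp (-(m w)) h2
    have := hno (ρ z : ℂ) (m z + k - m w) (by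
      convert h3 using 1
      · push_cast; ring
      · push_cast; ring)
    omega
  refine ⟨fun z => if h : z ∈ Om u then m ⟨z, h⟩ else 0, ?_, ?_⟩
  · intro z hz
    have hz1 : z + 1 ∈ Om u := by simpa using (Om_int hp 1 z).2 hz
    simp only [hz, hz1, dif_pos]
    exact huniq ⟨z, hz⟩ ⟨z + 1, hz1⟩ 1 (by simpa using JoinedIn.refl hz1)
  · intro z hz
    obtain ⟨r, hr, hball⟩ := Metric.isOpen_iff.1 (Om_open hu) z hz
    filter_upwards [Metric.ball_mem_nhds z hr] with w hw
    have hwO := hball hw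
    simp only [hz, hwO, dif_pos]
    have := huniq ⟨z, hz⟩ ⟨w, hwO⟩ 0 (by
      simp only [Int.cast_zero, add_zero]
      exact joined_segment (((convex_ball z r).segment_subset hw
        (Metric.mem_ball_self hr)).trans hball))
    simpa using this

noncomputable def chi (t : ℝ) : ℝ := max 0 (min 1 (3 * t - 1))

theorem chi_zero {t : ℝ} (h : t ≤ 1 / 3) : chi t = 0 := by
  unfold chi
  rw [max_eq_left]
  exact (min_le_right _ _).trans (by linarith)

theorem chi_one {t : ℝ} (h : 2 / 3 ≤ t) : chi t = 1 := by
  unfold chi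
  rw [min_eq_left (by linarith), max_eq_right zero_le_one]

theorem chi_continuous : Continuous chi := by unfold chi; fun_prop

theorem exp_int (n : ℤ) : Complex.exp (2 * Real.pi * Complex.I * n) = 1 := by
  rw [mul_comm]; exact Complex.exp_int_mul_two_pi_mul_I n

theorem essential_path {u : ℂ → ℝ} (hu : Continuous u) (hp : ∀ z, u (z + 1) = u z)
    {s M : ℝ} (hs : s = 1 ∨ s = -1) (h0 : ∀ z : ℂ, M ≤ s * z.im → u z = 0)
    (h1 : ∀ z : ℂ, s * z.im ≤ -M → u z = 1) :
    ∃ z : ℂ, ∃ k : ℤ, k ≠ 0 ∧ JoinedIn (Om u) z (z + k) := by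
  classical
  by_contra hcon
  push Not at hcon
  obtain ⟨m, hm1, hm2⟩ := exists_m hu hp (fun z k h => by
    by_contra hk; exact hcon z k hk h)
  have hs2 : s * s = 1 := by rcases hs with rfl | rfl <;> norm_num
  set Q : ℂ → ℂ := fun z => if z ∈ Om u then
    Complex.exp (2 * Real.pi * Complex.I * m z * (chi (u z) : ℝ)) else 1 with hQ
  have hQlow : ∀ z, u z ≤ 1 / 3 → Q z = 1 := by
    intro z hz
    simp only [hQ, chi_zero hz]; simp
  have hQhigh : ∀ z, 2 / 3 ≤ u z → Q z = 1 := by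
    intro z hz
    simp only [hQ, chi_one hz]
    simp [exp_int]
  have hQ0 : ∀ z, Q z ≠ 0 := by
    intro z
    simp only [hQ]
    split_ifs
    · exact Complex.exp_ne_zero _
    · exact one_ne_zero
  have hQc : Continuous Q := by
    rw [continuous_iff_continuousAt]
    intro z
    by_cases hz : z ∈ Om u
    · have hcc : ContinuousAt (fun w => Complex.exp (2 * Real.pi * Complex.I * m z *
          (chi (u w) : ℝ))) z := by
        have := chi_continuous
        fun_prop
      refine hcc.congr ?_
      filter_upwards [(Om_open hu).mem_nhds hz, hm2 z hz] with w hw hw2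
      simp only [hQ, hw, if_true, hw2]
    · have : ∀ᶠ w in 𝓝 z, Q w = 1 := by
        by_cases h : 0 < u z
        · have h' : 1 ≤ u z := by
            by_contra hlt; exact hz ⟨h, not_le.1 hlt⟩
          filter_upwards [hu.continuousAt.eventually (lt_mem_nhds
            (show (2/3:ℝ) < u z by linarith))] with w hw
          exact hQhigh w (le_of_lt hw)
        · filter_upwards [hu.continuousAt.eventually (gt_mem_nhds
            (show u z < (1/3:ℝ) by linarith))] with w hw
          exact hQlow w (le_of_lt hw)
      exact (continuousAt_const (y := (1:ℂ))).congr (this.mono fun w hw => hw.symm)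
  obtain ⟨P, hPc, hP⟩ := exp_lift Q hQc hQ0
  have hconst := exp_const (X := ℂ)
    (g := fun z => P (z + 1) - P z - 2 * Real.pi * Complex.I * (chi (u z) : ℝ)) (by
      have := chi_continuous
      fun_prop) (by
      intro z
      rw [Complex.exp_sub, Complex.exp_sub, hP, hP]
      by_cases hz : z ∈ Om u
      · have hz1 : z + 1 ∈ Om u := by simpa using (Om_int hp 1 z).2 hz
        simp only [hQ, hz, hz1, if_true, hp, hm1 z hz]
        rw [← Complex.exp_sub, ← Complex.exp_sub]
        convert Complex.exp_zero using 2
        push_cast; ring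
      · have hz1 : z + 1 ∉ Om u := fun h => hz ((Om_int hp 1 z).1 (by simpa using h))
        simp only [hQ, hz, hz1, if_false]
        by_cases h : 0 < u z
        · have h' : 1 ≤ u z := by
            by_contra hlt; exact hz ⟨h, not_le.1 hlt⟩
          rw [chi_one (by linarith)]
          simp
        · rw [chi_zero (by linarith)]; simp) (mkC 0 (s * M)) (mkC 0 (s * (-M)))
  have hpt : ∀ x t : ℝ, s * (mkC x (s * t)).im = t := by
    intro x t; rw [mkC_im, ← mul_assoc, hs2, one_mul]
  have hline : ∀ t : ℝ, (∀ x, Q (mkC x t) = 1) → P (mkC 0 t + 1) = P (mkC 0 t) := by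
    intro t ht
    have := exp_const (X := ℝ) (g := fun x => P (mkC x t)) (by unfold mkC; fun_prop)
      (fun x => by rw [hP, ht]) 0 1
    have e : mkC 1 t = mkC 0 t + 1 := by apply Complex.ext <;> simp
    rw [← e]; exact this
  have e1 := hline (s * M) (fun x => hQlow _ (by rw [h0 _ (hpt x M).ge]; norm_num))
  have e2 := hline (s * (-M)) (fun x => hQhigh _ (by rw [h1 _ (hpt x (-M)).le]; norm_num))
  have u1 := h0 _ (hpt 0 M).ge
  have u2 := h1 _ (hpt 0 (-M)).le
  simp only [e1, e2, u1, u2, chi_zero (show (0:ℝ) ≤ 1/3 by norm_num),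
    chi_one (show (2/3:ℝ) ≤ 1 by norm_num)] at hconst
  simp [Real.pi_ne_zero] at hconst

end PB

open Filter Set Topology MeasureTheory

namespace PB

noncomputable def lat (n : ℕ) (v : ℤ × ℤ) : ℂ := mkC (v.1 / n) (v.2 / n)

def UStep (v w : ℤ × ℤ) : Prop :=
  (w.2 = v.2 ∧ (w.1 = v.1 + 1 ∨ w.1 = v.1 - 1)) ∨ (w.1 = v.1 ∧ (w.2 = v.2 + 1 ∨ w.2 = v.2 - 1))

def Adj (O : Set ℂ) (n : ℕ) (v w : ℤ × ℤ) : Prop :=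
  UStep v w ∧ segment ℝ (lat n v) (lat n w) ⊆ O

def Box (n : ℕ) (p : ℂ) : Set ℂ :=
  Ioo (p.re - 1 / n) (p.re + 1 / n) ×ℂ Ioo (p.im - 1 / n) (p.im + 1 / n)

theorem mem_Box {n : ℕ} {p q : ℂ} : q ∈ Box n p ↔
    (p.re - 1 / n < q.re ∧ q.re < p.re + 1 / n) ∧ (p.im - 1 / n < q.im ∧ q.im < p.im + 1 / n) := by
  rw [Box, Complex.mem_reProdIm]; rfl

theorem Box_symm {n : ℕ} {p q : ℂ} (h : q ∈ Box n p) : p ∈ Box n q := by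
  rw [mem_Box] at *
  obtain ⟨⟨h1, h2⟩, h3, h4⟩ := h
  refine ⟨⟨?_, ?_⟩, ?_, ?_⟩ <;> linarith

theorem Box_open (n : ℕ) (p : ℂ) : IsOpen (Box n p) := isOpen_Ioo.reProdIm isOpen_Ioo

theorem Box_convex (n : ℕ) (p : ℂ) : Convex ℝ (Box n p) :=
  ((convex_Ioo _ _).linear_preimage Complex.reLm).inter
    ((convex_Ioo _ _).linear_preimage Complex.imLm)

theorem Box_cover {n : ℕ} (hn : 0 < n) (p : ℂ) : ∃ v, lat n v ∈ Box n p := by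
  have hn' : (0:ℝ) < n := by exact_mod_cast hn
  have key : ∀ x : ℝ, x - 1 / n < (⌊x * n⌋ : ℝ) / n ∧ (⌊x * n⌋ : ℝ) / n < x + 1 / n := by
    intro x
    have h1 := Int.floor_le (x * n)
    have h2 := Int.lt_floor_add_one (x * n)
    constructor
    · rw [lt_div_iff₀ hn', sub_mul, div_mul_cancel₀ _ hn'.ne']; linarith
    · rw [div_lt_iff₀ hn', add_mul, div_mul_cancel₀ _ hn'.ne']; linarith
  refine ⟨(⌊p.re * n⌋, ⌊p.im * n⌋), ?_⟩
  rw [mem_Box]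
  simp only [lat, mkC_re, mkC_im]
  exact ⟨key p.re, key p.im⟩

theorem near_diff {n : ℕ} (hn : 0 < n) {x : ℝ} {a b : ℤ} (h1 : x - 1 / n < (a:ℝ) / n)
    (h2 : (a:ℝ) / n < x + 1 / n) (h3 : x - 1 / n < (b:ℝ) / n) (h4 : (b:ℝ) / n < x + 1 / n) :
    b = a ∨ b = a + 1 ∨ b = a - 1 := by
  have hn' : (0:ℝ) < n := by exact_mod_cast hn
  have e1 : (a:ℝ) / n - b / n < 2 / n := by
    have : (2:ℝ) / n = 1 / n + 1 / n := by ring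
    linarith
  have e2 : (b:ℝ) / n - a / n < 2 / n := by
    have : (2:ℝ) / n = 1 / n + 1 / n := by ring
    linarith
  rw [← sub_div, div_lt_div_iff_of_pos_right hn'] at e1 e2
  have e1' : a - b < 2 := by exact_mod_cast e1
  have e2' : b - a < 2 := by exact_mod_cast e2
  omega

theorem near_reach {O : Set ℂ} {n : ℕ} (hn : 0 < n) {p : ℂ} (hp : Box n p ⊆ O) {v w : ℤ × ℤ}
    (hv : lat n v ∈ Box n p) (hw : lat n w ∈ Box n p) :
    Relation.ReflTransGen (Adj O n) v w := by
  have hv' := mem_Box.1 hv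
  have hw' := mem_Box.1 hw
  simp only [lat, mkC_re, mkC_im] at hv' hw'
  have hm : lat n (w.1, v.2) ∈ Box n p := by
    rw [mem_Box]; simp only [lat, mkC_re, mkC_im]; exact ⟨hw'.1, hv'.2⟩
  have hA : Relation.ReflTransGen (Adj O n) v (w.1, v.2) := by
    rcases near_diff hn hv'.1.1 hv'.1.2 hw'.1.1 hw'.1.2 with h | h
    · rw [h]
    · exact Relation.ReflTransGen.single ⟨Or.inl ⟨rfl, h⟩,
        ((Box_convex n p).segment_subset hv hm).trans hp⟩
  have hB : Relation.ReflTransGen (Adj O n) (w.1, v.2) w := by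
    rcases near_diff hn hv'.2.1 hv'.2.2 hw'.2.1 hw'.2.2 with h | h
    · rw [← h]
    · exact Relation.ReflTransGen.single ⟨Or.inr ⟨rfl, h⟩,
        ((Box_convex n p).segment_subset hm hw).trans hp⟩
  exact hA.trans hB

theorem lattice_walk {O : Set ℂ} (hO : IsOpen O) {z : ℂ} {k : ℤ}
    (h : JoinedIn O z (z + k)) : ∃ n : ℕ, 3 ≤ n ∧ ∃ v : ℤ × ℤ,
      Relation.ReflTransGen (Adj O n) v (v.1 + k * n, v.2) := by
  obtain ⟨γ, hγ⟩ := h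
  have hK : IsCompact (range γ) := isCompact_range γ.continuous
  obtain ⟨δ, hδ, hδO⟩ := hK.exists_thickening_subset_open hO (range_subset_iff.2 hγ)
  obtain ⟨n0, hn0⟩ := exists_nat_gt (2 / δ)
  set n := max n0 3 with hn
  have hn3 : 3 ≤ n := le_max_right _ _
  have hnp : 0 < n := by omega
  have hn' : (0:ℝ) < n := by exact_mod_cast hnp
  have hnδ : 2 / (n:ℝ) < δ := by
    have : (n0:ℝ) ≤ n := by exact_mod_cast le_max_left _ _
    rw [div_lt_comm₀ hn' hδ]
    linarith
  have hBox : ∀ t, Box n (γ t) ⊆ O := by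
    intro t q hq
    apply hδO
    rw [Metric.mem_thickening_iff]
    refine ⟨γ t, mem_range_self t, ?_⟩
    rw [mem_Box] at hq
    have e : (2:ℝ) / n = 1 / n + 1 / n := by ring
    have h1 : |(q - γ t).re| < 1 / n := by rw [Complex.sub_re, abs_lt]; constructor <;> linarith
    have h2 : |(q - γ t).im| < 1 / n := by rw [Complex.sub_im, abs_lt]; constructor <;> linarith
    rw [dist_eq_norm]
    have := Complex.norm_le_abs_re_add_abs_im (q - γ t)
    linarith
  obtain ⟨v0, hv0⟩ := Box_cover hnp z
  set R := Relation.ReflTransGen (Adj O n) v0 with hR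
  refine ⟨n, hn3, v0, ?_⟩
  set S : Set unitInterval := {t | ∃ v, R v ∧ lat n v ∈ Box n (γ t)} with hS
  set S' : Set unitInterval := {t | ∃ v, ¬ R v ∧ lat n v ∈ Box n (γ t)} with hS'
  have hop : ∀ Q : ℤ × ℤ → Prop, IsOpen {t : unitInterval | ∃ v, Q v ∧ lat n v ∈ Box n (γ t)} := by
    intro Q
    have : {t : unitInterval | ∃ v, Q v ∧ lat n v ∈ Box n (γ t)} =
        ⋃ v, ⋃ (_ : Q v), γ ⁻¹' (Box n (lat n v)) := by
      ext t
      simp only [mem_iUnion, mem_preimage, exists_prop]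
      exact exists_congr fun v => and_congr_right fun _ => ⟨Box_symm, Box_symm⟩
    rw [this]
    exact isOpen_iUnion fun v => isOpen_iUnion fun _ => (Box_open _ _).preimage γ.continuous
  have hdisj : Disjoint S S' := by
    rw [Set.disjoint_left]
    rintro t ⟨v, hv, hv2⟩ ⟨w, hw, hw2⟩
    exact hw (Relation.ReflTransGen.trans hv (near_reach hnp (hBox t) hv2 hw2))
  have hsub := isPreconnected_univ.subset_left_of_subset_union (hop _) (hop _) hdisj (by
      intro t _
      obtain ⟨v, hv⟩ := Box_cover hnp (γ t)
      by_cases h : R v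
      · exact Or.inl ⟨v, h, hv⟩
      · exact Or.inr ⟨v, h, hv⟩)
      ⟨0, mem_univ _, v0, Relation.ReflTransGen.refl, by simpa using hv0⟩
  by_contra hcon
  have h1 : (1 : unitInterval) ∈ S := hsub (mem_univ _)
  refine Set.disjoint_left.1 hdisj h1 ⟨_, hcon, ?_⟩
  rw [mem_Box] at hv0 ⊢
  have e : ((v0.1 + k * n : ℤ) : ℝ) / n = v0.1 / n + k := by
    push_cast; field_simp
  simp only [lat, mkC_re, mkC_im, γ.target, Complex.add_re, Complex.add_im, Complex.intCast_re,
    Complex.intCast_im, add_zero, e] at hv0 ⊢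
  refine ⟨⟨?_, ?_⟩, hv0.2⟩ <;> linarith [hv0.1.1, hv0.1.2]

end PB

open Filter Set Topology MeasureTheory

namespace PB

def shiftZ (n : ℕ) (m : ℤ) (v : ℤ × ℤ) : ℤ × ℤ := (v.1 + m * n, v.2)

theorem shiftZ_zero (n : ℕ) (v : ℤ × ℤ) : shiftZ n 0 v = v := by simp [shiftZ]

theorem shiftZ_shiftZ (n : ℕ) (a b : ℤ) (v : ℤ × ℤ) :
    shiftZ n a (shiftZ n b v) = shiftZ n (b + a) v := by
  simp only [shiftZ, Prod.mk.injEq, and_true]; ring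

theorem lat_shift {n : ℕ} (hn : 0 < n) (m : ℤ) (v : ℤ × ℤ) :
    lat n (shiftZ n m v) = lat n v + m := by
  have hn' : (n:ℝ) ≠ 0 := by exact_mod_cast hn.ne'
  apply Complex.ext
  · simp only [lat, shiftZ, mkC_re, Complex.add_re, Complex.intCast_re]
    push_cast; field_simp
  · simp [lat, shiftZ]

theorem UStep_shift {n : ℕ} {m : ℤ} {v w : ℤ × ℤ} (h : UStep v w) :
    UStep (shiftZ n m v) (shiftZ n m w) := by
  unfold UStep shiftZ at *
  simp only
  rcases h with ⟨h1, h2 | h2⟩ | ⟨h1, h2 | h2⟩ <;> rw [h1, h2]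
  · left; exact ⟨rfl, Or.inl (by ring)⟩
  · left; exact ⟨rfl, Or.inr (by ring)⟩
  · right; exact ⟨rfl, Or.inl rfl⟩
  · right; exact ⟨rfl, Or.inr rfl⟩

theorem Adj_shift {O : Set ℂ} (hO : ∀ (m : ℤ) (z : ℂ), z + m ∈ O ↔ z ∈ O) {n : ℕ} (hn : 0 < n)
    (m : ℤ) {v w : ℤ × ℤ} (h : Adj O n v w) : Adj O n (shiftZ n m v) (shiftZ n m w) := by
  refine ⟨UStep_shift h.1, ?_⟩
  rw [lat_shift hn, lat_shift hn]
  intro z hz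
  have : z + ((-m : ℤ) : ℂ) ∈ segment ℝ (lat n v) (lat n w) := by
    rw [← mem_segment_translate ℝ (m : ℂ)]
    have e : (m:ℂ) + (z + ((-m : ℤ) : ℂ)) = z := by push_cast; ring
    rw [e, add_comm (m:ℂ), add_comm (m:ℂ)]
    exact hz
  exact (hO (-m) z).1 (h.2 this)

theorem min_walk {O : Set ℂ} (hO : ∀ (m : ℤ) (z : ℂ), z + m ∈ O ↔ z ∈ O) {n : ℕ} (hn : 3 ≤ n)
    {k : ℤ} (hk : k ≠ 0) {v : ℤ × ℤ} (h : Relation.ReflTransGen (Adj O n) v (shiftZ n k v)) :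
    ∃ l : ℕ, 3 ≤ l ∧ ∃ W : ℤ → ℤ × ℤ, ∃ k : ℤ, k ≠ 0 ∧ (∀ i, Adj O n (W i) (W (i + 1))) ∧
      (∀ i, W (i + l) = shiftZ n k (W i)) ∧
      (∀ i j m : ℤ, W i = shiftZ n m (W j) → (l : ℤ) ∣ i - j) := by
  classical
  have hn0 : 0 < n := by omega
  let P : ℕ → Prop := fun l => ∃ w : ℕ → ℤ × ℤ, ∃ k : ℤ, k ≠ 0 ∧ w l = shiftZ n k (w 0) ∧
    ∀ i < l, Adj O n (w i) (w (i + 1))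
  have hex : ∃ l, P l := by
    rcases Relation.reflTransGen_iff_eq_or_transGen.1 h with h | h
    · exfalso
      have := congrArg Prod.fst h
      simp only [shiftZ] at this
      have h2 : k * n = 0 := by linarith
      rcases mul_eq_zero.1 h2 with h3 | h3
      · exact hk h3
      · omega
    · obtain ⟨l, -, w, h0, hl, hw⟩ := transGen_chain h
      exact ⟨l, w, k, hk, by rw [hl, h0], hw⟩
  set l := Nat.find hex with hl
  obtain ⟨w, k, hk, hwl, hw⟩ : P l := Nat.find_spec hex
  have hmin : ∀ l' < l, ¬ P l' := fun l' h => Nat.find_min hex h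
  have hdisp : ∀ i ≤ l, |(w i).1 - (w 0).1| ≤ i := by
    intro i
    induction i with
    | zero => simp
    | succ i ih =>
      intro hi
      have h1 := ih (by omega)
      have h2 := (hw i (by omega)).1
      rw [abs_le] at h1 ⊢
      unfold UStep at h2
      push_cast
      omega
  have hl3 : 3 ≤ l := by
    have h1 := hdisp l le_rfl
    rw [hwl] at h1
    simp only [shiftZ, add_sub_cancel_left, abs_mul, Nat.abs_cast] at h1
    have h2 : 1 ≤ |k| := Int.one_le_abs hk
    have h3 : (3:ℤ) ≤ n := by exact_mod_cast hn
    have : (3:ℤ) ≤ l := by nlinarith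
    exact_mod_cast this
  have hdist : ∀ a b : ℕ, a < b → b < l → ∀ m : ℤ, w b ≠ shiftZ n m (w a) := by
    intro a b hab hbl m heq
    by_cases hm : m = 0
    · subst hm
      rw [shiftZ_zero] at heq
      refine hmin (l - (b - a)) (by omega)
        ⟨fun i => if i ≤ a then w i else w (i + (b - a)), k, hk, ?_, ?_⟩
      · simp only [zero_le, if_true]
        rw [if_neg (by omega), Nat.sub_add_cancel (by omega), hwl]
      · intro i hi
        simp only
        rcases lt_trichotomy i a with h | h | h
        · rw [if_pos (by omega), if_pos (by omega)]
          exact hw i (by omega)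
        · subst h
          rw [if_pos le_rfl, if_neg (by omega), ← heq]
          have := hw b hbl
          convert this using 2
          omega
        · rw [if_neg (by omega), if_neg (by omega)]
          have := hw (i + (b - a)) (by omega)
          convert this using 2
          omega
    · refine hmin (b - a) (by omega) ⟨fun i => w (a + i), m, hm, ?_, ?_⟩
      · simp only [add_zero]
        rw [← heq]; congr 1; omega
      · intro i hi
        exact hw (a + i) (by omega)
  have hl0 : (0:ℤ) < l := by omega
  set W : ℤ → ℤ × ℤ := fun i => shiftZ n ((i / l) * k) (w (i % l).toNat) with hW
  have hr : ∀ i : ℤ, (i % l).toNat < l := by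
    intro i
    have := Int.emod_lt_of_pos i hl0
    have := Int.emod_nonneg i hl0.ne'
    omega
  refine ⟨l, hl3, W, k, hk, ?_, ?_, ?_⟩
  · intro i
    have hA := Adj_shift hO hn0 ((i / l) * k) (hw _ (hr i))
    have e : W (i + 1) = shiftZ n ((i / l) * k) (w ((i % l).toNat + 1)) := by
      have h1 := Int.emod_lt_of_pos i hl0
      have h2 := Int.emod_nonneg i hl0.ne'
      have h3 := Int.emod_add_mul_ediv i l
      by_cases hlt : i % l + 1 < l
      · have e1 : (i + 1) / l = i / l ∧ (i + 1) % l = i % l + 1 := by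
          rw [Int.ediv_emod_unique hl0]
          refine ⟨by linarith, by omega, hlt⟩
        simp only [hW, e1.1, e1.2]
        congr 2
        omega
      · have e1 : (i + 1) / l = i / l + 1 ∧ (i + 1) % l = 0 := by
          rw [Int.ediv_emod_unique hl0]
          refine ⟨?_, le_rfl, hl0⟩
          have : i % l + 1 = l := by omega
          rw [mul_add]; linarith
        have e2 : (i % l).toNat + 1 = l := by omega
        simp only [hW, e1.1, e1.2, e2, hwl, shiftZ_shiftZ, Int.toNat_zero]
        congr 1
        ring
    rw [e]; exact hA
  · intro i
    simp only [hW, Int.add_emod_right, shiftZ_shiftZ]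
    rw [Int.add_ediv_of_dvd_right (dvd_refl _), Int.ediv_self hl0.ne']
    congr 1
    ring
  · intro i j m hij
    simp only [hW, shiftZ_shiftZ] at hij
    have h1 : w (i % l).toNat = shiftZ n ((j / l * k + m) - (i / l * k)) (w (j % l).toNat) := by
      have := congrArg (shiftZ n (-(i / l * k))) hij
      rw [shiftZ_shiftZ, shiftZ_shiftZ, add_neg_cancel, shiftZ_zero] at this
      rw [this]; rfl
    have h2 : w (j % l).toNat = shiftZ n (-((j / l * k + m) - (i / l * k))) (w (i % l).toNat) := by
      rw [h1, shiftZ_shiftZ, add_neg_cancel, shiftZ_zero]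
    have hn1 := Int.emod_nonneg i hl0.ne'
    have hn2 := Int.emod_nonneg j hl0.ne'
    have h3 : (i % l).toNat = (j % l).toNat := by
      rcases lt_trichotomy (i % l).toNat (j % l).toNat with h | h | h
      · exact absurd h2 (hdist _ _ h (hr j) _)
      · exact h
      · exact absurd h1 (hdist _ _ h (hr i) _)
    have h4 : i % l = j % l := by omega
    exact Int.ModEq.dvd (Int.ModEq.symm h4)

end PB

open Filter Set Topology MeasureTheory

namespace PB

noncomputable def pl (a : ℤ → ℤ) (t : ℝ) : ℝ :=
  a ⌊t⌋ + Int.fract t * (a (⌊t⌋ + 1) - a ⌊t⌋)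

theorem pl_on (a : ℤ → ℤ) (i : ℤ) {t : ℝ} (ht : t ∈ Icc (i:ℝ) (i + 1)) :
    pl a t = a i + (t - i) * (a (i + 1) - a i) := by
  rcases ht.2.lt_or_eq with h | h
  · have : ⌊t⌋ = i := Int.floor_eq_iff.2 ⟨ht.1, h⟩
    rw [pl, Int.fract, this]
  · have : ⌊t⌋ = i + 1 := by rw [h]; exact_mod_cast Int.floor_intCast (R := ℝ) (i + 1)
    rw [pl, Int.fract, this, h]
    push_cast; ring

theorem pl_continuous (a : ℤ → ℤ) : Continuous (pl a) := by
  have hlf : LocallyFinite fun i : ℤ => Icc (i:ℝ) (i + 1) := by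
    intro x
    refine ⟨Ioo (x - 1) (x + 1), Ioo_mem_nhds (by linarith) (by linarith), ?_⟩
    refine (Set.finite_Icc (⌊x⌋ - 3) (⌊x⌋ + 3)).subset ?_
    rintro i ⟨y, hy1, hy2⟩
    have h1 := Int.floor_le x
    have h2 := Int.lt_floor_add_one x
    have h3 : (i:ℝ) < ⌊x⌋ + 3 := by linarith [hy1.1, hy2.2]
    have h4 : (⌊x⌋:ℝ) - 3 < i := by linarith [hy1.2, hy2.1]
    constructor
    · have : ⌊x⌋ - 3 < i := by exact_mod_cast h4
      exact this.le
    · have : i < ⌊x⌋ + 3 := by exact_mod_cast h3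
      exact this.le
  refine hlf.continuous ?_ (fun i => isClosed_Icc) (fun i => ?_)
  · rw [Set.eq_univ_iff_forall]
    intro x
    exact mem_iUnion.2 ⟨⌊x⌋, Int.floor_le x, (Int.lt_floor_add_one x).le⟩
  · exact (Continuous.continuousOn (by fun_prop)).congr fun t ht => pl_on a i ht

theorem F1 {p p' : ℤ} {θ θ' : ℝ} (h0 : 0 ≤ θ) (h1 : θ < 1) (h0' : 0 ≤ θ') (h1' : θ' < 1)
    (h : (p:ℝ) + θ = p' + θ') : p = p' ∧ θ = θ' := by
  have e1 : (p:ℝ) < p' + 1 := by linarith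
  have e2 : (p':ℝ) < p + 1 := by linarith
  have e1' : p < p' + 1 := by exact_mod_cast e1
  have e2' : p' < p + 1 := by exact_mod_cast e2
  have : p = p' := by omega
  subst this
  exact ⟨rfl, by linarith⟩

theorem F2 {p p' : ℤ} {θ θ' : ℝ} (h0 : 0 ≤ θ) (h1 : θ < 1) (h0' : 0 ≤ θ') (h1' : θ' < 1)
    (h : (p:ℝ) + θ + θ' = p') : (p = p' ∧ θ = θ') ∨ p' = p + 1 := by
  have e1 : (p':ℝ) < p + 2 := by linarith
  have e2 : (p:ℝ) < p' + 1 := by linarith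
  have e1' : p' < p + 2 := by exact_mod_cast e1
  have e2' : p < p' + 1 := by exact_mod_cast e2
  by_cases hp : p' = p + 1
  · exact Or.inr hp
  · have : p = p' := by omega
    subst this
    exact Or.inl ⟨rfl, by linarith⟩

theorem edge_meet {n : ℕ} {m : ℤ} {v w v' w' : ℤ × ℤ} (h : UStep v w) (h' : UStep v' w')
    {θ θ' : ℝ} (h0 : 0 ≤ θ) (h1 : θ < 1) (h0' : 0 ≤ θ') (h1' : θ' < 1)
    (ha : (v.1:ℝ) + θ * (w.1 - v.1) = v'.1 + θ' * (w'.1 - v'.1) + m * n)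
    (hb : (v.2:ℝ) + θ * (w.2 - v.2) = v'.2 + θ' * (w'.2 - v'.2)) :
    (v = shiftZ n m v' ∧ θ = θ') ∨ (v = shiftZ n m w' ∧ w = shiftZ n m v') := by
  obtain ⟨a, b⟩ := v
  obtain ⟨c, d⟩ := w
  obtain ⟨a', b'⟩ := v'
  obtain ⟨c', d'⟩ := w'
  simp only [UStep, shiftZ, Prod.mk.injEq] at *
  set N : ℤ := m * n with hN
  have hN' : (m:ℝ) * n = (N:ℤ) := by rw [hN]; push_cast; ring
  rw [hN'] at ha
  clear_value N
  have z0 : (0:ℝ) ≤ 0 := le_rfl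
  have z1 : (0:ℝ) < 1 := one_pos
  rcases h with ⟨rfl, rfl | rfl⟩ | ⟨rfl, rfl | rfl⟩ <;>
  rcases h' with ⟨rfl, rfl | rfl⟩ | ⟨rfl, rfl | rfl⟩ <;>
  push_cast at ha hb
  · obtain ⟨e, e'⟩ := F1 (p := a) (p' := a' + N) h0 h1 h0' h1' (by push_cast; linarith)
    obtain ⟨g, -⟩ := F1 (p := d) (p' := d') z0 z1 z0 z1 (by linarith)
    exact Or.inl ⟨⟨e, g⟩, e'⟩
  · obtain ⟨g, -⟩ := F1 (p := d) (p' := d') z0 z1 z0 z1 (by linarith)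
    rcases F2 (p := a) (p' := a' + N) h0 h1 h0' h1' (by push_cast; linarith) with ⟨e, e'⟩ | e
    · exact Or.inl ⟨⟨e, g⟩, e'⟩
    · exact Or.inr ⟨⟨by omega, g⟩, by omega, g⟩
  · obtain ⟨e, e'⟩ := F1 (p := a) (p' := c' + N) h0 h1 z0 z1 (by push_cast; linarith)
    obtain ⟨g, g'⟩ := F1 (p := d) (p' := b') z0 z1 h0' h1' (by linarith)
    exact Or.inl ⟨⟨e, g⟩, by linarith⟩
  · obtain ⟨e, e'⟩ := F1 (p := a) (p' := c' + N) h0 h1 z0 z1 (by push_cast; linarith)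
    obtain ⟨g, g'⟩ := F1 (p := d) (p' := b') h0' h1' z0 z1 (by linarith)
    exact Or.inl ⟨⟨e, g⟩, by linarith⟩
  · obtain ⟨g, -⟩ := F1 (p := d) (p' := d') z0 z1 z0 z1 (by linarith)
    rcases F2 (p := a' + N) (p' := a) h0' h1' h0 h1 (by push_cast; linarith) with ⟨e, e'⟩ | e
    · exact Or.inl ⟨⟨e.symm, g⟩, e'.symm⟩
    · exact Or.inr ⟨⟨by omega, g⟩, by omega, g⟩
  · obtain ⟨e, e'⟩ := F1 (p := a' + N) (p' := a) h0 h1 h0' h1' (by push_cast; linarith)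
    obtain ⟨g, -⟩ := F1 (p := d) (p' := d') z0 z1 z0 z1 (by linarith)
    exact Or.inl ⟨⟨e.symm, g⟩, e'⟩
  · obtain ⟨e, e'⟩ := F1 (p := c' + N) (p' := a) h0 h1 z0 z1 (by push_cast; linarith)
    obtain ⟨g, g'⟩ := F1 (p := d) (p' := b') z0 z1 h0' h1' (by linarith)
    exact Or.inl ⟨⟨e.symm, g⟩, by linarith⟩
  · obtain ⟨e, e'⟩ := F1 (p := c' + N) (p' := a) h0 h1 z0 z1 (by push_cast; linarith)
    obtain ⟨g, g'⟩ := F1 (p := d) (p' := b') h0' h1' z0 z1 (by linarith)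
    exact Or.inl ⟨⟨e.symm, g⟩, by linarith⟩
  · obtain ⟨e, e'⟩ := F1 (p := c) (p' := a' + N) z0 z1 h0' h1' (by push_cast; linarith)
    obtain ⟨g, g'⟩ := F1 (p := b) (p' := d') h0 h1 z0 z1 (by linarith)
    exact Or.inl ⟨⟨e, g⟩, by linarith⟩
  · obtain ⟨e, e'⟩ := F1 (p := c) (p' := a' + N) h0' h1' z0 z1 (by push_cast; linarith)
    obtain ⟨g, g'⟩ := F1 (p := b) (p' := d') h0 h1 z0 z1 (by linarith)
    exact Or.inl ⟨⟨e, g⟩, by linarith⟩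
  · obtain ⟨e, -⟩ := F1 (p := c) (p' := c' + N) z0 z1 z0 z1 (by push_cast; linarith)
    obtain ⟨g, g'⟩ := F1 (p := b) (p' := b') h0 h1 h0' h1' (by linarith)
    exact Or.inl ⟨⟨e, g⟩, g'⟩
  · obtain ⟨e, -⟩ := F1 (p := c) (p' := c' + N) z0 z1 z0 z1 (by push_cast; linarith)
    rcases F2 (p := b) (p' := b') h0 h1 h0' h1' (by linarith) with ⟨g, g'⟩ | g
    · exact Or.inl ⟨⟨e, g⟩, g'⟩
    · exact Or.inr ⟨⟨e, by omega⟩, e, by omega⟩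
  · obtain ⟨e, e'⟩ := F1 (p := c) (p' := a' + N) z0 z1 h0' h1' (by push_cast; linarith)
    obtain ⟨g, g'⟩ := F1 (p := d') (p' := b) h0 h1 z0 z1 (by linarith)
    exact Or.inl ⟨⟨e, g.symm⟩, by linarith⟩
  · obtain ⟨e, e'⟩ := F1 (p := c) (p' := a' + N) h0' h1' z0 z1 (by push_cast; linarith)
    obtain ⟨g, g'⟩ := F1 (p := d') (p' := b) h0 h1 z0 z1 (by linarith)
    exact Or.inl ⟨⟨e, g.symm⟩, by linarith⟩
  · obtain ⟨e, -⟩ := F1 (p := c) (p' := c' + N) z0 z1 z0 z1 (by push_cast; linarith)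
    rcases F2 (p := b') (p' := b) h0' h1' h0 h1 (by linarith) with ⟨g, g'⟩ | g
    · exact Or.inl ⟨⟨e, g.symm⟩, g'.symm⟩
    · exact Or.inr ⟨⟨e, by omega⟩, e, by omega⟩
  · obtain ⟨e, -⟩ := F1 (p := c) (p' := c' + N) z0 z1 z0 z1 (by push_cast; linarith)
    obtain ⟨g, g'⟩ := F1 (p := b') (p' := b) h0 h1 h0' h1' (by linarith)
    exact Or.inl ⟨⟨e, g.symm⟩, g'⟩

theorem exists_loop {O : Set ℂ} (hO : IsOpen O) (hOp : ∀ (m : ℤ) (z : ℂ), z + m ∈ O ↔ z ∈ O)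
    {z : ℂ} {k : ℤ} (hk : k ≠ 0) (h : JoinedIn O z (z + k)) :
    ∃ Γ : ℝ → ℂ, Continuous Γ ∧ (∀ x, Γ x ∈ O) ∧ (∃ k : ℤ, k ≠ 0 ∧ ∀ x, Γ (x + 1) = Γ x + k) ∧
      ∀ x x' : ℝ, ∀ m : ℤ, Γ x = Γ x' + m → ∃ j : ℤ, x - x' = j := by
  obtain ⟨n, hn, v, hv⟩ := lattice_walk hO h
  obtain ⟨l, hl, W, k, hk, hA, hper, hinj⟩ := min_walk hOp hn hk hv
  have hn0 : 0 < n := by omega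
  have hn' : (n:ℝ) ≠ 0 := by exact_mod_cast hn0.ne'
  have hl' : (l:ℝ) ≠ 0 := by
    have : l ≠ 0 := by omega
    exact_mod_cast this
  set A := fun i => (W i).1 with hAdef
  set B := fun i => (W i).2 with hBdef
  set Γ : ℝ → ℂ := fun x => mkC (pl A (l * x) / n) (pl B (l * x) / n) with hΓ
  have hre : ∀ x, (Γ x).re = pl A (l * x) / n := fun x => by simp [hΓ]
  have him : ∀ x, (Γ x).im = pl B (l * x) / n := fun x => by simp [hΓ]
  refine ⟨Γ, ?_, ?_, ⟨k, hk, ?_⟩, ?_⟩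
  · have h1 := pl_continuous A
    have h2 := pl_continuous B
    simp only [hΓ, mkC]
    fun_prop
  · intro x
    apply (hA ⌊l * x⌋).2
    rw [segment_eq_image]
    refine ⟨Int.fract (l * x), ⟨Int.fract_nonneg _, (Int.fract_lt_one _).le⟩, ?_⟩
    apply Complex.ext
    · rw [hre]
      simp only [lat, Complex.add_re, Complex.real_smul, Complex.re_ofReal_mul, mkC_re, pl, hAdef]
      ring
    · rw [him]
      simp only [lat, Complex.add_im, Complex.real_smul, Complex.im_ofReal_mul, mkC_im, pl, hBdef]
      ring
  · intro x
    have e : (l:ℝ) * (x + 1) = l * x + (l:ℤ) := by push_cast; ring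
    have hA1 : ∀ i, A (i + l) = A i + k * n := fun i => by simp only [hAdef, hper, shiftZ]
    have hB1 : ∀ i, B (i + l) = B i := fun i => by simp only [hBdef, hper, shiftZ]
    have c1 : ∀ i : ℤ, i + l + 1 = (i + 1) + l := fun i => by ring
    apply Complex.ext
    · rw [hre, Complex.add_re, hre, e, Complex.intCast_re]
      simp only [pl, Int.floor_add_intCast, Int.fract_add_intCast, c1, hA1]
      push_cast
      field_simp
      ring
    · rw [him, Complex.add_im, him, e, Complex.intCast_im]
      simp only [pl, Int.floor_add_intCast, Int.fract_add_intCast, c1, hB1, add_zero]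
  · intro x x' m hx
    have h1 := congrArg Complex.re hx
    have h2 := congrArg Complex.im hx
    rw [Complex.add_re, hre, hre, Complex.intCast_re] at h1
    rw [Complex.add_im, him, him, Complex.intCast_im, add_zero] at h2
    have h1' : pl A (l * x) = pl A (l * x') + m * n := by
      field_simp at h1; linarith
    have h2' : pl B (l * x) = pl B (l * x') := by
      field_simp at h2; exact h2
    have key := edge_meet (n := n) (m := m) (hA ⌊l * x⌋).1 (hA ⌊l * x'⌋).1
      (Int.fract_nonneg (l * x)) (Int.fract_lt_one _) (Int.fract_nonneg (l * x'))
      (Int.fract_lt_one _) h1' h2'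
    rcases key with ⟨e1, e2⟩ | ⟨e1, e2⟩
    · obtain ⟨j, hj⟩ := hinj _ _ _ e1
      refine ⟨j, ?_⟩
      have hj' : ((⌊l * x⌋ : ℤ) : ℝ) - (⌊l * x'⌋ : ℤ) = l * j := by exact_mod_cast hj
      have f1 := Int.floor_add_fract (l * x)
      have f2 := Int.floor_add_fract (l * x')
      have : (l:ℝ) * (x - x') = l * j := by rw [mul_sub]; linarith
      exact mul_left_cancel₀ hl' this
    · exfalso
      have d1 := hinj _ _ _ e1
      have d2 := hinj _ _ _ e2
      have d3 := dvd_sub d2 d1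
      have e3 : ⌊l * x⌋ + 1 - ⌊l * x'⌋ - (⌊l * x⌋ - (⌊l * x'⌋ + 1)) = 2 := by ring
      rw [e3] at d3
      have := Int.le_of_dvd (by norm_num) d3
      omega

end PB

open Filter Set Topology MeasureTheory

namespace PB

theorem exists_circle_map {X : Type*} [TopologicalSpace X] {g : ℝ → X} (hg : Continuous g)
    (hp : ∀ x, g (x + 1) = g x) : ∃ γ : C(AddCircle (1:ℝ), X), ∀ x : ℝ, γ (x : AddCircle (1:ℝ)) = g x := by
  have hper : Function.Periodic g 1 := hp
  refine ⟨⟨hper.lift, ?_⟩, fun x => hper.lift_coe x⟩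
  have hq : IsQuotientMap (QuotientAddGroup.mk : ℝ → AddCircle (1:ℝ)) := isQuotientMap_quot_mk
  rw [hq.continuous_iff]
  exact hg

theorem coe_eq_iff (x y : ℝ) : (x : AddCircle (1:ℝ)) = y ↔ ∃ m : ℤ, x = y + m := by
  rw [QuotientAddGroup.eq, AddSubgroup.mem_zmultiples_iff]
  constructor
  · rintro ⟨k, hk⟩
    refine ⟨-k, ?_⟩
    simp at hk
    push_cast; linarith
  · rintro ⟨m, hm⟩
    refine ⟨-m, ?_⟩
    simp; linarith

/-- A loop with nonzero degree is not null-homotopic. -/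
theorem not_null {Y : Type*} [TopologicalSpace Y] {γ : C(AddCircle (1:ℝ), AddCircle (1:ℝ) × Y)}
    {g : ℝ → ℝ} (hg : Continuous g) {k : ℤ} (hk : k ≠ 0) (hgk : ∀ x, g (x + 1) = g x + k)
    (hγ : ∀ x : ℝ, (γ (x : AddCircle (1:ℝ))).1 = (g x : AddCircle (1:ℝ))) :
    ¬ ∃ a, ContinuousMap.Homotopic γ (ContinuousMap.const _ a) := by
  rintro ⟨a, ⟨H⟩⟩
  let e : AddCircle (1:ℝ) → ℂ := fun s => (AddCircle.toCircle s : ℂ)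
  have hec : Continuous e := continuous_subtype_val.comp AddCircle.continuous_toCircle
  have he0 : ∀ s, e s ≠ 0 := fun s => Circle.coe_ne_zero _
  have hexp : ∀ x : ℝ, e x = Complex.exp (2 * Real.pi * Complex.I * x) := by
    intro x
    simp only [e, AddCircle.toCircle_apply_mk, Circle.coe_exp]
    congr 1
    push_cast; ring
  obtain ⟨E, hEc, hE⟩ := exp_lift (X := ℝ × ℝ)
    (fun p => e (H (Set.projIcc (0:ℝ) 1 zero_le_one p.1, (p.2 : AddCircle (1:ℝ)))).1) (by
      refine hec.comp (continuous_fst.comp (H.continuous.comp ?_))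
      exact (continuous_projIcc.comp continuous_fst).prodMk
        ((AddCircle.continuous_mk' 1).comp continuous_snd)) (fun p => he0 _)
  have hc := fun p q => exp_const (X := ℝ × ℝ) (g := fun p => E (p.1, p.2 + 1) - E p)
    (by fun_prop) (by
      intro p
      rw [Complex.exp_sub, hE, hE]
      simp only
      have : ((p.2 + 1 : ℝ) : AddCircle (1:ℝ)) = p.2 := (coe_eq_iff _ _).2 ⟨1, by simp⟩
      rw [this]
      exact div_self (he0 _)) p q
  have h1 := exp_const (X := ℝ) (g := fun x => E (1, x) - E (1, 0)) (by fun_prop) (by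
      intro x
      rw [Complex.exp_sub, hE, hE]
      simp only [Set.projIcc_right]
      have e1 : ∀ s, H ((⟨1, right_mem_Icc.2 zero_le_one⟩ : Icc (0:ℝ) 1), s) = a := fun s => H.apply_one s
      rw [e1, e1]
      exact div_self (he0 _)) 0 1
  have h2 := exp_const (X := ℝ) (g := fun x => E (0, x) - 2 * Real.pi * Complex.I * g x)
    (by fun_prop) (by
      intro x
      rw [Complex.exp_sub, hE]
      simp only [Set.projIcc_left]
      have e1 : ∀ s, H ((⟨0, left_mem_Icc.2 zero_le_one⟩ : Icc (0:ℝ) 1), s) = γ s := fun s => H.apply_zero s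
      rw [e1, hγ, ← hexp]
      exact div_self (he0 _)) 0 1
  have h3 := hc (0, 0) (1, 0)
  have h4 := hgk 0
  simp only [zero_add] at h1 h2 h3 h4
  rw [h4] at h2
  push_cast at h2
  have : (2 * Real.pi * Complex.I * k : ℂ) = 0 := by
    linear_combination h1 - h2 - h3
  simp [Real.pi_ne_zero, hk] at this

theorem mem_interior_of {I : Set ℝ} (hI : I.OrdConnected) (y : I) (h1 : ¬ IsTop y)
    (h2 : ¬ IsBot y) : (y:ℝ) ∈ interior I := by
  simp only [IsTop, IsBot, not_forall, not_le] at h1 h2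
  obtain ⟨b, hb⟩ := h1
  obtain ⟨a, ha⟩ := h2
  rw [mem_interior_iff_mem_nhds]
  exact Filter.mem_of_superset (Icc_mem_nhds (show (a:ℝ) < y from ha) (show (y:ℝ) < b from hb))
    (hI.out a.2 b.2)

theorem loop_final {I : Set ℝ} (hI : I.OrdConnected) {σ : I → ℝ} {c : ℝ → I} (hσ : Coord I σ c)
    {f : AnnulusT I → AnnulusT I} {F : StripT I → StripT I} {Φ : ℂ → ℂ}
    (hlift : ∀ z : StripT I, projT I (F z) = f (projT I z))
    (hΦ : ∀ z, rr c (Φ z) = F (rr c z))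
    {u : ℂ → ℝ} (hu : Continuous u) (hup : ∀ z, u (z + 1) = u z)
    (hends : ∃ s : ℝ, (s = 1 ∨ s = -1) ∧ ∃ M, (∀ z : ℂ, M ≤ s * z.im → u z = 0) ∧
        (∀ z : ℂ, s * z.im ≤ -M → u z = 1))
    (hfree : ∀ z, 0 < u z → u z < 1 → 0 < u (Φ z) → u (Φ z) < 1 → False)
    (hcol : ∀ z : ℂ, IsTop (c z.im) ∨ IsBot (c z.im) → u z = 0 ∨ u z = 1) :
    ∃ γ : C(AddCircle (1:ℝ), AnnulusT I), Function.Injective ⇑γ ∧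
      (∀ s : AddCircle (1:ℝ), ((γ s).2 : ℝ) ∈ interior I) ∧
      (¬ ∃ a : AnnulusT I, ContinuousMap.Homotopic γ (ContinuousMap.const _ a)) ∧
      f '' Set.range ⇑γ ∩ Set.range ⇑γ = ∅ := by
  obtain ⟨s, hs, M, hM0, hM1⟩ := hends
  obtain ⟨z, k0, hk0, hj⟩ := essential_path hu hup hs hM0 hM1
  obtain ⟨Γ, hΓc, hΓO, ⟨k, hk, hΓk⟩, hΓi⟩ := exists_loop (Om_open hu) (Om_int hup) hk0 hj
  have hnc : ∀ z ∈ Om u, ¬ (IsTop (c z.im) ∨ IsBot (c z.im)) := by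
    intro z hz h
    rcases hcol z h with h | h
    · exact hz.1.ne' h
    · exact hz.2.ne h
  have hsig : ∀ t, ¬ (IsTop (c t) ∨ IsBot (c t)) → σ (c t) = t := fun t h =>
    (hσ.eq_or t).resolve_right h
  -- equality in the annulus
  have heq : ∀ z w : ℂ, w ∈ Om u → projT I (rr c z) = projT I (rr c w) → ∃ m : ℤ, z = w + m := by
    intro z w hw h
    have h1 : ((z.re : ℝ) : AddCircle (1:ℝ)) = w.re := congrArg Prod.fst h
    have h2 : c z.im = c w.im := congrArg Prod.snd h
    obtain ⟨m, hm⟩ := (coe_eq_iff _ _).1 h1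
    refine ⟨m, Complex.ext (by simp [hm]) ?_⟩
    have e1 := hsig w.im (hnc w hw)
    have e2 := hsig z.im (by rw [h2]; exact hnc w hw)
    simp only [Complex.add_im, Complex.intCast_im, add_zero]
    rw [← e1, ← e2, h2]
  have hcc := hσ.cc
  obtain ⟨γ, hγ⟩ := exists_circle_map (g := fun x => projT I (rr c (Γ x))) (by
    have hr : Continuous (rr c) := by unfold rr; fun_prop
    exact continuous_projT.comp (hr.comp hΓc)) (by
    intro x
    simp only [projT, rr, hΓk, Complex.add_re, Complex.add_im, Complex.intCast_re,
      Complex.intCast_im, add_zero]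
    congr 1
    exact (coe_eq_iff _ _).2 ⟨k, rfl⟩)
  refine ⟨γ, ?_, ?_, ?_, ?_⟩
  · intro s s' h
    obtain ⟨x, rfl⟩ := QuotientAddGroup.mk_surjective s
    obtain ⟨x', rfl⟩ := QuotientAddGroup.mk_surjective s'
    rw [hγ, hγ] at h
    obtain ⟨m, hm⟩ := heq _ _ (hΓO x') h
    obtain ⟨j, hj⟩ := hΓi _ _ _ hm
    exact (coe_eq_iff x x').2 ⟨j, by linarith⟩
  · intro s
    obtain ⟨x, rfl⟩ := QuotientAddGroup.mk_surjective s
    rw [hγ]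
    have := hnc _ (hΓO x)
    exact mem_interior_of hI _ (fun h => this (Or.inl h)) (fun h => this (Or.inr h))
  · refine not_null (g := fun x => (Γ x).re) (by fun_prop) hk (fun x => by simp [hΓk]) ?_
    intro x
    rw [hγ]
    rfl
  · rw [Set.eq_empty_iff_forall_notMem]
    rintro _ ⟨⟨_, ⟨s, rfl⟩, rfl⟩, ⟨s', h⟩⟩
    obtain ⟨x, rfl⟩ := QuotientAddGroup.mk_surjective s
    obtain ⟨x', rfl⟩ := QuotientAddGroup.mk_surjective s'
    rw [hγ, hγ, ← hlift, ← hΦ] at h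
    obtain ⟨m, hm⟩ := heq _ _ (hΓO x') h.symm
    have := u_int hup m (Γ x')
    rw [← hm] at this
    exact hfree (Γ x) (hΓO x).1 (hΓO x).2 (this ▸ (hΓO x').1) (this ▸ (hΓO x').2)

end PB

open Filter Set Topology MeasureTheory

namespace PB

variable {I : Set ℝ} {σ : I → ℝ} {c : ℝ → I}

theorem shift_iter {G : StripT I → StripT I}
    (h : ∀ z : StripT I, G (z.1 + 1, z.2) = ((G z).1 + 1, (G z).2)) {m : ℤ} {z : StripT I}
    (hz : G z = (z.1 + (m : ℝ), z.2)) (k : ℕ) : G^[k] z = (z.1 + ((k * m : ℤ) : ℝ), z.2) := by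
  induction k with
  | zero => simp
  | succ k ih =>
    rw [Function.iterate_succ_apply', ih, strip_int h, hz]
    refine Prod.ext ?_ rfl
    push_cast
    ring

theorem min_period {f : AnnulusT I → AnnulusT I} {F : StripT I → StripT I}
    (hlift : ∀ z : StripT I, projT I (F z) = f (projT I z))
    (hcomm : ∀ z : StripT I, F (z.1 + 1, z.2) = ((F z).1 + 1, (F z).2))
    {p : ℤ} {q : ℕ} (hq : 1 ≤ q) (hpq : Nat.Coprime p.natAbs q) {z : StripT I}
    (hz : F^[q] z = (z.1 + (p : ℝ), z.2)) : Function.minimalPeriod f (projT I z) = q := by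
  have h1 : Function.IsPeriodicPt f q (projT I z) := by
    change f^[q] (projT I z) = projT I z
    rw [← proj_iter hlift, hz, proj_int]
  obtain ⟨k, hk⟩ := h1.minimalPeriod_dvd
  set d := Function.minimalPeriod f (projT I z) with hd
  have h2 : f^[d] (projT I z) = projT I z := Function.isPeriodicPt_minimalPeriod f _
  rw [← proj_iter hlift] at h2
  have h3 : (((F^[d] z).1 : ℝ) : AddCircle (1:ℝ)) = z.1 := congrArg Prod.fst h2
  have h4 : (F^[d] z).2 = z.2 := congrArg (fun w : AnnulusT I => w.2) h2
  obtain ⟨m, hm⟩ := (coe_eq_iff _ _).1 h3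
  have h5 := shift_iter (G := F^[d]) (strip_iter hcomm d) (m := m) (z := z) (Prod.ext hm h4) k
  rw [← Function.iterate_mul, ← hk, hz] at h5
  have h6 : z.1 + (p : ℝ) = z.1 + ((k * m : ℤ) : ℝ) := congrArg Prod.fst h5
  have h7 : p = k * m := by exact_mod_cast add_left_cancel h6
  have h8 : k ∣ p.natAbs := by
    rw [h7, Int.natAbs_mul]; simp
  have h9 : k ∣ q := ⟨d, by rw [hk, mul_comm]⟩
  have h10 : k = 1 := Nat.eq_one_of_dvd_coprimes hpq h8 h9
  rw [hk, h10, mul_one]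

theorem drift_iter {f : AnnulusT I → AnnulusT I} {F : StripT I → StripT I} (hf : Continuous f)
    (hlift : ∀ z : StripT I, projT I (F z) = f (projT I z))
    (hcomm : ∀ z : StripT I, F (z.1 + 1, z.2) = ((F z).1 + 1, (F z).2))
    {ψ : AnnulusT I → ℝ} (hψc : Continuous ψ)
    (hψ : ∀ z : StripT I, ψ (projT I z) = (F z).1 - z.1)
    (μ : Measure (AnnulusT I)) [IsProbabilityMeasure μ] (hmp : MeasurePreserving f μ μ)
    (hK : ∃ K : Set (AnnulusT I), IsCompact K ∧ μ Kᶜ = 0) (p : ℤ) (q : ℕ)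
    (ε : ℤ) (hε : ε = 1 ∨ ε = -1) (hintg : (ε : ℝ) * (q * ∫ z, ψ z ∂μ - p) < 0) :
    ∃ z : StripT I, ∀ U ∈ 𝓝 z, ∃ w ∈ U, ∃ n a : ℕ, 1 ≤ n ∧ 1 ≤ a ∧
      (((fun z : StripT I => ((F^[q] z).1 - (p : ℝ), (F^[q] z).2))^[n] w).1 + ((ε * a : ℤ) : ℝ),
        ((fun z : StripT I => ((F^[q] z).1 - (p : ℝ), (F^[q] z).2))^[n] w).2) ∈ U := by
  have hsub : ∀ z : StripT I, projT I (z.1 - (p : ℝ), z.2) = projT I z := by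
    intro z
    have := proj_int z (-p)
    push_cast at this
    rw [sub_eq_add_neg]; exact this
  refine drift (g := f^[q]) (φ := fun x => ∑ j ∈ Finset.range q, ψ (f^[j] x) - p) ?_ ?_ ?_ ?_ μ
    (hmp.iterate q) hK ε hε ?_
  · intro z
    rw [hsub, proj_iter hlift]
  · intro z
    simp only
    rw [strip_iter hcomm]
    refine Prod.ext ?_ rfl
    simp only
    ring
  · exact (continuous_finset_sum _ fun j _ => hψc.comp (hf.iterate j)).sub continuous_const
  · intro z
    simp only
    rw [← birk hlift hψ]
    ring
  · obtain ⟨K, hKc, hKμ⟩ := hK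
    obtain ⟨D, hD⟩ := hKc.exists_bound_of_continuousOn hψc.continuousOn
    have hψi : Integrable ψ μ := by
      refine Integrable.of_bound hψc.aestronglyMeasurable D ?_
      have : ∀ᵐ x ∂μ, x ∈ K := mem_ae_iff.2 hKμ
      filter_upwards [this] with x hx
      exact hD x hx
    have hψin : ∀ j, Integrable (fun x => ψ (f^[j] x)) μ := fun j =>
      (hmp.iterate j).integrable_comp_of_integrable hψi
    have hψinn : ∀ j, ∫ x, ψ (f^[j] x) ∂μ = ∫ x, ψ x ∂μ := by
      intro j
      have h := (hmp.iterate j)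
      have h2 := integral_map (μ := μ) (φ := f^[j]) h.measurable.aemeasurable (f := ψ)
        hψc.aestronglyMeasurable
      rw [h.map_eq] at h2
      exact h2.symm
    rw [integral_sub (integrable_finset_sum _ fun j _ => hψin j) (integrable_const _),
      integral_finset_sum _ fun j _ => hψin j]
    simpa [hψinn] using hintg

theorem OP.iter {F : ℂ → ℂ} (h : OP F) (hc : Continuous F) (hi : Function.Injective F) (n : ℕ) :
    OP F^[n] := by
  induction n with
  | zero => exact OP.id
  | succ n ih => rw [Function.iterate_succ]; exact OP.comp ih h hc hi

theorem OP.sub_const {F : ℂ → ℂ} (h : OP F) (a : ℂ) : OP fun z => F z - a := by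
  obtain ⟨L, hL, h⟩ := h
  exact ⟨L, hL, fun p hp => by rw [h p hp]; ring⟩

/-- the homeomorphism `T^{-p} Φ^q` -/
noncomputable def iterShift (Φ : ℂ ≃ₜ ℂ) (q : ℕ) (p : ℤ) : ℂ ≃ₜ ℂ where
  toFun z := Φ^[q] z - p
  invFun z := Φ.symm^[q] (z + p)
  left_inv z := by
    simp only [sub_add_cancel]
    exact (Function.LeftInverse.iterate Φ.symm_apply_apply q) z
  right_inv z := by
    have := (Function.LeftInverse.iterate Φ.apply_symm_apply q) (z + p)
    simp only [this, add_sub_cancel_right]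
  continuous_toFun := (Φ.continuous.iterate q).sub continuous_const
  continuous_invFun := (Φ.symm.continuous.iterate q).comp (by fun_prop)

theorem iterShift_apply (Φ : ℂ ≃ₜ ℂ) (q : ℕ) (p : ℤ) (z : ℂ) :
    iterShift Φ q p z = Φ^[q] z - p := rfl

theorem closure_per_int {O : Set ℂ} (hOp : ∀ z : ℂ, z + 1 ∈ O ↔ z ∈ O) (p : ℤ) (z : ℂ) :
    z + p ∈ closure O ↔ z ∈ closure O := by
  induction p using Int.induction_on generalizing z with
  | zero => simp
  | succ i ih =>
    have h1 := closure_per hOp (z + (i : ℤ))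
    rw [← ih z, ← h1]
    push_cast
    rw [add_assoc]
  | pred i ih =>
    have h1 := closure_per hOp (z + ((-i - 1 : ℤ) : ℂ))
    rw [← h1, ← ih z]
    push_cast
    rw [show z + (-(i:ℂ) - 1) + 1 = z + -(i:ℂ) by ring]

theorem main_aux (hI : I.OrdConnected) (hne : I.Nonempty)
    (f : AnnulusT I ≃ₜ AnnulusT I) (ftil : StripT I ≃ₜ StripT I)
    (hlift : ∀ z : StripT I, projT I (ftil z) = f (projT I z))
    (hcomm : ∀ z : StripT I, ftil (z.1 + 1, z.2) = ((ftil z).1 + 1, (ftil z).2))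
    (hend_bot : Tendsto (fun z : StripT I => (ftil z).2)
      (Filter.comap (Prod.snd : StripT I → I) atBot) atBot)
    (hend_top : Tendsto (fun z : StripT I => (ftil z).2)
      (Filter.comap (Prod.snd : StripT I → I) atTop) atTop)
    (ψ : AnnulusT I → ℝ) (hψc : Continuous ψ)
    (hψ : ∀ z : StripT I, ψ (projT I z) = (ftil z).1 - z.1)
    (μ₁ μ₂ : Measure (AnnulusT I))
    (hμ₁p : IsProbabilityMeasure μ₁) (hμ₂p : IsProbabilityMeasure μ₂)
    (hμ₁e : MeasurePreserving ⇑f μ₁ μ₁) (hμ₂e : MeasurePreserving ⇑f μ₂ μ₂)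
    (hμ₁c : ∃ K : Set (AnnulusT I), IsCompact K ∧ μ₁ Kᶜ = 0)
    (hμ₂c : ∃ K : Set (AnnulusT I), IsCompact K ∧ μ₂ Kᶜ = 0)
    (p : ℤ) (q : ℕ) (hq : 1 ≤ q) 
    (h1 : (∫ z, ψ z ∂μ₁) < (p : ℝ) / (q : ℝ)) (h2 : (p : ℝ) / (q : ℝ) < (∫ z, ψ z ∂μ₂))
    (hno : ∀ zt : StripT I, (⇑ftil)^[q] zt ≠ (zt.1 + (p : ℝ), zt.2)) :
    (∃ γ : C(AddCircle (1:ℝ), AnnulusT I), Function.Injective ⇑γ ∧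
      (∀ s : AddCircle (1:ℝ), ((γ s).2 : ℝ) ∈ interior I) ∧
      (¬ ∃ a : AnnulusT I, ContinuousMap.Homotopic γ (ContinuousMap.const _ a)) ∧
      ⇑f '' Set.range ⇑γ ∩ Set.range ⇑γ = ∅) := by
  haveI := hI
  have hne' : Nonempty I := hne.to_subtype
  obtain ⟨σ, c, hσ⟩ := exists_coord I hne
  obtain ⟨Φ, hΦ, hΦc, hΦO, hΦe, hΦ1, hΦ2, htop, hbot⟩ := exists_ext hσ ftil hcomm
    (top_ends ftil hne' hend_top) (bot_ends ftil hne' hend_bot)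
  have hqR : (0:ℝ) < q := by exact_mod_cast hq
  set G : StripT I → StripT I := fun z : StripT I => ((ftil^[q] z).1 - (p : ℝ), (ftil^[q] z).2)
    with hG
  obtain ⟨z1, hz1⟩ := drift_iter f.continuous hlift hcomm hψc hψ μ₁ hμ₁e hμ₁c p q 1 (Or.inl rfl)
    (by rw [lt_div_iff₀ hqR] at h1; push_cast; linarith)
  obtain ⟨z2, hz2⟩ := drift_iter f.continuous hlift hcomm hψc hψ μ₂ hμ₂e hμ₂c p q (-1) (Or.inr rfl)
    (by rw [div_lt_iff₀ hqR] at h2; push_cast; linarith)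
  rw [← hG] at hz1 hz2
  let emb : StripT I → ℂ := fun z => mkC z.1 (σ z.2)
  have hembc : Continuous emb := by
    have := hσ.sc
    simp only [emb, mkC]
    fun_prop
  have hemb1 : ∀ n z, Φ^[n] (emb z) = emb (ftil^[n] z) := by
    intro n
    induction n with
    | zero => intro z; rfl
    | succ n ih =>
      intro z
      rw [Function.iterate_succ_apply', ih, Function.iterate_succ_apply']
      exact hΦe _ _
  have hemba : ∀ (z : StripT I) (a : ℝ), emb (z.1 + a, z.2) = emb z + a := by
    intro z a
    apply Complex.ext <;> simp [emb]
  have hembG : ∀ z, iterShift Φ q p (emb z) = emb (G z) := by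
    intro z
    rw [iterShift_apply, hemb1]
    have := hemba (ftil^[q] z) (-p)
    rw [← sub_eq_add_neg] at this
    simp only [hG]
    rw [this]
    push_cast
    ring
  have hembGn : ∀ n z, (iterShift Φ q p)^[n] (emb z) = emb (G^[n] z) := by
    intro n
    induction n with
    | zero => intro z; rfl
    | succ n ih =>
      intro z
      rw [Function.iterate_succ_apply', ih, Function.iterate_succ_apply', hembG]
  have hrrn : ∀ n z, rr c (Φ^[n] z) = ftil^[n] (rr c z) := by
    intro n
    induction n with
    | zero => intro z; rfl
    | succ n ih =>
      intro z
      rw [Function.iterate_succ_apply', hΦ, ih, Function.iterate_succ_apply']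
  have hfpf : ∀ z, iterShift Φ q p z ≠ z := by
    intro z hz
    rw [iterShift_apply, sub_eq_iff_eq_add] at hz
    refine hno (rr c z) ?_
    rw [← hrrn, hz]
    simp [rr]
  obtain ⟨O, hO, hOp, hOs, hOE⟩ := plane_main (Φ := iterShift Φ q p) (z1 := emb z1) (z2 := emb z2)
    (by
      intro z
      rw [iterShift_apply, iterShift_apply, comm_iter hΦc]
      ring)
    (OP.sub_const (OP.iter hΦO Φ.continuous Φ.injective q) p) hfpf
    (by
      intro U hU
      obtain ⟨w, hw, n, a, hn, ha, h⟩ := hz1 _ (hembc.continuousAt hU)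
      refine ⟨emb w, hw, n, a, hn, ha, ?_⟩
      have h' : emb _ ∈ U := h
      rw [hemba, ← hembGn] at h'
      simpa using h')
    (by
      intro U hU
      obtain ⟨w, hw, n, a, hn, ha, h⟩ := hz2 _ (hembc.continuousAt hU)
      refine ⟨emb w, hw, n, a, hn, ha, ?_⟩
      have h' : emb _ ∈ U := h
      rw [hemba, ← hembGn] at h'
      simpa [sub_eq_add_neg] using h')
  have hOq : ∀ z, Φ^[q] z ∈ closure O → z ∈ O := by
    intro z hz
    have h3 : iterShift Φ q p z ∈ closure O := by
      rw [iterShift_apply, ← closure_per_int hOp p]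
      simpa using hz
    simpa using hOs _ h3
  obtain ⟨V, hV, hVp, hVΦ, hVE⟩ := root Φ.continuous hΦc htop hbot hq hO hOp hOq hOE
  obtain ⟨u, hu, hup, hends, hfree, hcol⟩ := band hΦc hV hVp hVΦ hVE htop hbot
    (fun t => IsTop (c t) ∨ IsBot (c t)) (by
      rintro t (ht | ht)
      · exact Or.inl fun t' h => Or.inl fun y => (ht y).trans (hσ.cm h)
      · exact Or.inr fun t' h => Or.inr fun y => (hσ.cm h).trans (ht y)) hΦ1 hΦ2
  exact loop_final hI hσ hlift hΦ hu hup hends hfree hcol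

end PB

theorem poincare_birkhoff_generalized
    (I : Set ℝ) (hI : I.OrdConnected) (hIne : ∃ a ∈ I, ∃ b ∈ I, a < b)
    (f : AnnulusT I ≃ₜ AnnulusT I) (ftil : StripT I ≃ₜ StripT I)
    (hlift : ∀ z : StripT I, projT I (ftil z) = f (projT I z))
    (hcomm : ∀ z : StripT I, ftil (z.1 + 1, z.2) = ((ftil z).1 + 1, (ftil z).2))
    (hend_bot : Tendsto (fun z : StripT I => (ftil z).2)
      (Filter.comap (Prod.snd : StripT I → I) atBot) atBot)
    (hend_top : Tendsto (fun z : StripT I => (ftil z).2)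
      (Filter.comap (Prod.snd : StripT I → I) atTop) atTop)
    (ψ : AnnulusT I → ℝ) (hψc : Continuous ψ)
    (hψ : ∀ z : StripT I, ψ (projT I z) = (ftil z).1 - z.1)
    (μ₁ μ₂ : Measure (AnnulusT I))
    (hμ₁p : IsProbabilityMeasure μ₁) (hμ₂p : IsProbabilityMeasure μ₂)
    (hμ₁e : Ergodic ⇑f μ₁) (hμ₂e : Ergodic ⇑f μ₂)
    (hμ₁c : ∃ K : Set (AnnulusT I), IsCompact K ∧ μ₁ Kᶜ = 0)
    (hμ₂c : ∃ K : Set (AnnulusT I), IsCompact K ∧ μ₂ Kᶜ = 0)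
    (hrot : (∫ z, ψ z ∂μ₁) < ∫ z, ψ z ∂μ₂) :
    (∀ p : ℤ, ∀ q : ℕ, 1 ≤ q → Nat.Coprime p.natAbs q →
      (∫ z, ψ z ∂μ₁) < (p : ℝ) / (q : ℝ) → (p : ℝ) / (q : ℝ) < (∫ z, ψ z ∂μ₂) →
      ∃ z : AnnulusT I, Function.minimalPeriod ⇑f z = q ∧
        ∃ zt : StripT I, projT I zt = z ∧
          (⇑ftil)^[q] zt = (zt.1 + (p : ℝ), zt.2)) ∨
    (∃ γ : C(AddCircle (1:ℝ), AnnulusT I), Function.Injective ⇑γ ∧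
      (∀ s : AddCircle (1:ℝ), ((γ s).2 : ℝ) ∈ interior I) ∧
      (¬ ∃ a : AnnulusT I, ContinuousMap.Homotopic γ (ContinuousMap.const _ a)) ∧
      ⇑f '' Set.range ⇑γ ∩ Set.range ⇑γ = ∅) := by
  refine or_iff_not_imp_right.2 fun hloop p q hq hpq h1 h2 => ?_
  by_contra hno
  obtain ⟨a, ha, -⟩ := hIne
  refine hloop (PB.main_aux hI ⟨a, ha⟩ f ftil hlift hcomm hend_bot hend_top ψ hψc hψ μ₁ μ₂ hμ₁p
    hμ₂p hμ₁e.toMeasurePreserving hμ₂e.toMeasurePreserving hμ₁c hμ₂c p q hq h1 h2 ?_)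
  intro zt hzt
  exact hno ⟨projT I zt, PB.min_period hlift hcomm hq hpq hzt, zt, rfl, hzt⟩
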